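/- arXiv:1707.04965 — 2 statements merged into one kernel-verified Lean document; each statement's English description precedes it below -/
import Mathlib

section
/- For every prime p > 5 there exists a constant C > 0, depending only on p, such that for every integer H ≥ 3, |#M_p(H) − (2·ν_p + 2^p)·H^(p−1)| ≤ C·H^(p−2)·(log H)^(2p²−5p+2), where #M_p(H) is the number of generalized degenerate monic integer polynomials of degree p and height at most H. -/
open Polynomial MeasureTheory

/-- A finite set of (nonzero) complex numbers is multiplicatively dependent:
there are integer exponents, not all zero, whose corresponding power product is 1. -/
def MulDep (S : Finset ℂ) : Prop :=
  ∃ k : ℂ → ℤ, (∃ z ∈ S, k z ≠ 0) ∧ ∏ z ∈ S, z ^ k z = 1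

/-- The distinct nonzero complex roots of an integer polynomial. -/
noncomputable def nzRoots (f : Polynomial ℤ) : Finset ℂ :=
  ((f.map (Int.castRingHom ℂ)).roots.toFinset).filter (fun z => z ≠ 0)

/-- A polynomial of degree at least 2 is generalized degenerate if its distinct
nonzero complex roots are multiplicatively dependent. -/
def GenDeg (f : Polynomial ℤ) : Prop :=
  2 ≤ f.natDegree ∧ MulDep (nzRoots f)

/-- Height (max absolute value of coefficients) at most `H`. -/
def HeightLe (f : Polynomial ℤ) (H : ℤ) : Prop :=
  ∀ i, |f.coeff i| ≤ H

def Iset (n : ℕ) (H : ℤ) : Set (Polynomial ℤ) :=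
  {f | f.Monic ∧ f.natDegree = n ∧ HeightLe f H ∧ Irreducible f ∧ GenDeg f}

def Rset (n : ℕ) (H : ℤ) : Set (Polynomial ℤ) :=
  {f | f.Monic ∧ f.natDegree = n ∧ HeightLe f H ∧ ¬ Irreducible f ∧ GenDeg f}

def Mset (n : ℕ) (H : ℤ) : Set (Polynomial ℤ) :=
  {f | f.Monic ∧ f.natDegree = n ∧ HeightLe f H ∧ GenDeg f}

def IstarSet (n : ℕ) (H : ℤ) : Set (Polynomial ℤ) :=
  {f | f.natDegree = n ∧ HeightLe f H ∧ Irreducible f ∧ GenDeg f}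

def RstarSet (n : ℕ) (H : ℤ) : Set (Polynomial ℤ) :=
  {f | f.natDegree = n ∧ HeightLe f H ∧ ¬ Irreducible f ∧ GenDeg f}

def MstarSet (n : ℕ) (H : ℤ) : Set (Polynomial ℤ) :=
  {f | f.natDegree = n ∧ HeightLe f H ∧ GenDeg f}

/-- `nu n` is the (n-1)-dimensional Lebesgue volume of the convex body
`|x_i| ≤ 1 (1 ≤ i ≤ n-1)`, `|x_1 + ⋯ + x_{n-1}| ≤ 1`. -/
noncomputable def nu (n : ℕ) : ℝ :=
  (volume {x : Fin (n - 1) → ℝ | (∀ i, |x i| ≤ 1) ∧ |∑ i, x i| ≤ 1}).toReal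

theorem gal_relation (q : ℚ[X]) [Fact ((q.map (algebraMap ℚ ℂ)).Splits)]
    (k : q.rootSet ℂ → ℤ) (r : ℚ) (σ : q.Gal)
    (h : ∏ z : q.rootSet ℂ, (z : ℂ) ^ k z = r) : ∏ z : q.rootSet ℂ, ((σ • z : q.rootSet ℂ) : ℂ) ^ k z = r := by
  classical
  set e := Gal.rootsEquivRoots q ℂ
  set φ := IsScalarTower.toAlgHom ℚ q.SplittingField ℂ
  have he : ∀ y, ((e y : q.rootSet ℂ) : ℂ) = φ (y : q.SplittingField) := fun y => rfl
  have h1 : ∏ y : q.rootSet q.SplittingField, ((y : q.SplittingField)) ^ k (e y) = r := by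
    apply φ.toRingHom.injective
    have : φ.toRingHom (r : q.SplittingField) = (r : ℂ) := by simp
    rw [this, ← h, map_prod, ← e.prod_comp]
    refine Finset.prod_congr rfl fun y _ => ?_
    exact map_zpow₀ φ.toRingHom _ _
  have h2 : ∏ y : q.rootSet q.SplittingField, (σ (y : q.SplittingField)) ^ k (e y) = r := by
    have := congrArg σ h1
    rw [map_prod] at this
    rw [← map_ratCast σ r, ← this]
    exact Finset.prod_congr rfl fun y _ => (map_zpow₀ σ _ _).symm
  have h3 := congrArg φ h2
  rw [map_prod, map_ratCast] at h3
  rw [← h3, ← e.prod_comp]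
  refine Finset.prod_congr rfl fun y _ => ?_
  rw [map_zpow₀, Gal.smul_def]
  simp only [e, Equiv.symm_apply_apply]
  rfl

theorem coeff_zero_dvd_aux {ι : Type*} [Fintype ι] [DecidableEq ι] (z : ι → ℂ) (hz : ∀ i, z i ≠ 0)
    (hint : ∀ i, IsIntegral ℤ (z i))
    (a : ι) (k : ι → ℤ) (ha : 0 < |k a|) (hk : ∀ i, |k i| ≤ |k a|) (h : ∏ i, z i ^ k i = 1) :
    IsIntegral ℤ ((∏ j ∈ Finset.univ.erase a, z j) / z a) := by
  wlog hpos : 0 < k a generalizing k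
  · refine this (fun i => - k i) (by simpa using ha) (by simpa using hk) ?_ ?_
    · simp only [zpow_neg, Finset.prod_inv_distrib, h, inv_one]
    · have : k a ≠ 0 := abs_pos.mp ha
      omega
  have hn : 0 < (k a).toNat := by omega
  refine IsIntegral.of_pow hn ?_
  have key : ((∏ j ∈ Finset.univ.erase a, z j) / z a) ^ (k a).toNat
      = ∏ j ∈ Finset.univ.erase a, z j ^ (k a + k j).toNat := by
    have h1 : z a ^ k a * ∏ j ∈ Finset.univ.erase a, z j ^ k j = 1 := by
      rw [← h, Finset.mul_prod_erase _ (fun j => z j ^ k j) (Finset.mem_univ a)]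
    have hp : ∀ j, (z j : ℂ) ^ (k a + k j).toNat = z j ^ k a * z j ^ k j := by
      intro j
      have := (abs_le.mp (hk j)).1
      rw [abs_of_pos hpos] at this
      rw [← zpow_natCast, Int.toNat_of_nonneg (by omega), zpow_add₀ (hz j)]
    rw [Finset.prod_congr rfl fun j _ => hp j, Finset.prod_mul_distrib, ← zpow_natCast,
      Int.toNat_of_nonneg hpos.le, div_zpow, Finset.prod_zpow, div_eq_mul_inv]
    congr 1
    exact (eq_inv_of_mul_eq_one_right h1).symm
  rw [key]
  exact IsIntegral.prod _ fun j _ => (hint j).pow _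

theorem exists_galois_action (g : ℤ[X]) (hm : g.Monic) (hi : Irreducible g) :
    ∃ (G ι : Type) (_ : Group G) (_ : Fintype G) (_ : Fintype ι) (_ : MulAction G ι) (z : ι → ℂ),
      MulAction.IsPretransitive G ι ∧ FaithfulSMul G ι ∧ Function.Injective z ∧
      g.map (Int.castRingHom ℂ) = ∏ i, (X - C (z i)) ∧
      (∀ (k : ι → ℤ) (r : ℚ) (σ : G), ∏ i, z i ^ k i = r → ∏ i, z (σ • i) ^ k i = r) ∧
      (g.natDegree.Prime → g.natDegree ∣ Nat.card G) := by
  classical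
  set q : ℚ[X] := g.map (Int.castRingHom ℚ) with hq
  have hqi : Irreducible q :=
    (IsPrimitive.Int.irreducible_iff_irreducible_map_cast hm.isPrimitive).1 hi
  have hqm : q.Monic := hm.map _
  have : Fact ((q.map (algebraMap ℚ ℂ)).Splits) := ⟨IsAlgClosed.splits _⟩
  have hgq : g.map (Int.castRingHom ℂ) = q.map (algebraMap ℚ ℂ) := by
    rw [hq, Polynomial.map_map]
    congr 1
  refine ⟨q.Gal, q.rootSet ℂ, inferInstance, Fintype.ofFinite _, inferInstance, inferInstance,
    fun i => (i : ℂ), Gal.galAction_isPretransitive _ _ hqi, ⟨fun {a b} h => ?_⟩,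
    Subtype.val_injective, ?_, fun k r σ h => gal_relation q k r σ h, fun hp => ?_⟩
  · exact Gal.galActionHom_injective q ℂ (Equiv.ext h)
  · have hsep : (q.map (algebraMap ℚ ℂ)).Separable := hqi.separable.map
    have hnd : (q.map (algebraMap ℚ ℂ)).roots.Nodup := nodup_roots hsep
    rw [hgq, (IsAlgClosed.splits (q.map (algebraMap ℚ ℂ))).eq_prod_roots_of_monic
      (hqm.map _)]
    have hS : ∀ x, x ∈ (q.map (algebraMap ℚ ℂ)).roots.toFinset ↔ x ∈ q.rootSet ℂ := by
      intro x
      simp [rootSet, aroots]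
    rw [← Finset.prod_subtype _ hS (fun x => X - C x), Finset.prod_eq_multiset_prod,
      Multiset.toFinset_val, hnd.dedup]
  · have : q.natDegree = g.natDegree := hm.natDegree_map _
    rw [← this] at hp ⊢
    exact Gal.prime_degree_dvd_card hqi hp

theorem roots_toFinset_eq_image {ι : Type*} [Fintype ι] (z : ι → ℂ) (P : ℂ[X])
    (h : P = ∏ i, (X - C (z i))) : P.roots.toFinset = Finset.univ.image z := by
  have hP : P ≠ 0 := by
    rw [h]; exact (monic_prod_of_monic _ _ fun i _ => monic_X_sub_C _).ne_zero
  ext x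
  rw [Multiset.mem_toFinset, mem_roots hP, IsRoot.def, h, eval_prod, Finset.prod_eq_zero_iff]
  simp [sub_eq_zero, eq_comm]

theorem isIntegral_of_map_eq_prod {ι : Type*} [Fintype ι] (z : ι → ℂ) (g : ℤ[X]) (hm : g.Monic)
    (h : g.map (Int.castRingHom ℂ) = ∏ i, (X - C (z i))) (i : ι) : IsIntegral ℤ (z i) := by
  refine ⟨g, hm, ?_⟩
  have : (g.map (Int.castRingHom ℂ)).eval (z i) = 0 := by
    rw [h, eval_prod]
    exact Finset.prod_eq_zero (Finset.mem_univ i) (by simp)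
  rwa [eval_map] at this

theorem coeff_zero_of_map_eq_prod {ι : Type*} [Fintype ι] (z : ι → ℂ) (g : ℤ[X])
    (h : g.map (Int.castRingHom ℂ) = ∏ i, (X - C (z i))) :
    (g.coeff 0 : ℂ) = ∏ i, (- z i) := by
  have : (g.map (Int.castRingHom ℂ)).coeff 0 = (g.coeff 0 : ℂ) := by simp
  rw [← this, h, coeff_zero_eq_eval_zero, eval_prod]
  simp

theorem coeff_one_of_map_eq_prod {ι : Type*} [Fintype ι] [DecidableEq ι] (z : ι → ℂ) (g : ℤ[X])
    (h : g.map (Int.castRingHom ℂ) = ∏ i, (X - C (z i))) :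
    (g.coeff 1 : ℂ) = ∑ i, ∏ j ∈ Finset.univ.erase i, (- z j) := by
  have : (derivative (g.map (Int.castRingHom ℂ))).coeff 0 = (g.coeff 1 : ℂ) := by
    simp [coeff_derivative]
  rw [← this, h, coeff_zero_eq_eval_zero, derivative_prod_finset, eval_finsetSum]
  simp [eval_prod]

theorem dvd_of_isIntegral_div {a b : ℤ} (ha : a ≠ 0) (h : IsIntegral ℤ ((b : ℂ) / a)) : a ∣ b := by
  have h1 : IsIntegral ℤ ((b : ℚ) / a) := by
    have h2 : algebraMap ℚ ℂ ((b : ℚ) / a) = (b : ℂ) / a := by simp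
    rw [← h2] at h
    exact (isIntegral_algebraMap_iff (algebraMap ℚ ℂ).injective).1 h
  obtain ⟨y, hy⟩ := IsIntegrallyClosed.isIntegral_iff.1 h1
  refine ⟨y, ?_⟩
  have ha' : (a : ℚ) ≠ 0 := by exact_mod_cast ha
  rw [eq_div_iff ha'] at hy
  have : (y : ℚ) * a = b := by simpa using hy
  rw [mul_comm]
  exact_mod_cast this.symm

theorem coeff_zero_dvd_coeff_one_sq (g : ℤ[X]) (hm : g.Monic) (hi : Irreducible g)
    (h0 : g.coeff 0 ≠ 0) (k : ℂ → ℤ)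
    (hk : ∃ x ∈ (g.map (Int.castRingHom ℂ)).roots.toFinset, k x ≠ 0)
    (h : ∏ x ∈ (g.map (Int.castRingHom ℂ)).roots.toFinset, x ^ k x = 1) :
    g.coeff 0 ∣ g.coeff 1 ^ 2 := by
  classical
  obtain ⟨G, ι, _, _, _, _, z, htrans, -, hinj, hg, hrel, -⟩ := exists_galois_action g hm hi
  have hint := isIntegral_of_map_eq_prod z g hm hg
  have hc0 := coeff_zero_of_map_eq_prod z g hg
  have hz : ∀ i, z i ≠ 0 := by
    intro i hi0
    refine h0 ?_
    have : (g.coeff 0 : ℂ) = 0 := by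
      rw [hc0]; exact Finset.prod_eq_zero (Finset.mem_univ i) (by simp [hi0])
    exact_mod_cast this
  rw [roots_toFinset_eq_image z _ hg] at hk h
  rw [Finset.prod_image fun a _ b _ hab => hinj hab] at h
  obtain ⟨x, hx, hkx⟩ := hk
  obtain ⟨i₀, -, rfl⟩ := Finset.mem_image.1 hx
  obtain ⟨i₁, -, hmax⟩ := Finset.exists_max_image Finset.univ (fun i => |k (z i)|)
    ⟨i₀, Finset.mem_univ _⟩
  have hpos : 0 < |k (z i₁)| := (abs_pos.2 hkx).trans_le (hmax i₀ (Finset.mem_univ _))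
  have hdiag : ∀ a, IsIntegral ℤ ((∏ j ∈ Finset.univ.erase a, z j) / z a) := by
    intro a
    obtain ⟨σ, hσ⟩ := htrans.exists_smul_eq i₁ a
    have h1 := hrel (fun i => k (z i)) 1 σ (by simpa using h)
    have hs : σ⁻¹ • a = i₁ := by rw [← hσ, inv_smul_smul]
    refine coeff_zero_dvd_aux z hz hint a (fun i => k (z (σ⁻¹ • i))) ?_ ?_ ?_
    · simpa [hs] using hpos
    · intro i
      simpa [hs] using hmax (σ⁻¹ • i) (Finset.mem_univ _)
    · rw [← Equiv.prod_comp (MulAction.toPerm σ) (fun i => z i ^ k (z (σ⁻¹ • i)))]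
      simpa using h1
  have hterm : ∀ a b, IsIntegral ℤ ((∏ j ∈ Finset.univ.erase b, (- z j)) / (- z a)) := by
    intro a b
    by_cases hab : a = b
    · subst hab
      rw [Finset.prod_neg, div_neg, mul_div_assoc]
      exact (((isIntegral_one.neg).pow _).mul (hdiag a)).neg
    · rw [← Finset.mul_prod_erase (Finset.univ.erase b) (fun j => - z j)
        (Finset.mem_erase.2 ⟨hab, Finset.mem_univ a⟩),
        mul_div_cancel_left₀ _ (neg_ne_zero.2 (hz a))]
      exact IsIntegral.prod _ fun j _ => (hint j).neg
  refine dvd_of_isIntegral_div h0 ?_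
  have hexp : ((g.coeff 1 ^ 2 : ℤ) : ℂ) / (g.coeff 0 : ℂ)
      = ∑ a, ∑ b, (∏ j ∈ Finset.univ.erase b, (- z j)) / (- z a) := by
    have hinv : ∀ a, (∏ j ∈ Finset.univ.erase a, (- z j)) = (g.coeff 0 : ℂ) / (- z a) := by
      intro a
      rw [eq_div_iff (neg_ne_zero.2 (hz a)), hc0, mul_comm,
        Finset.mul_prod_erase _ (fun j => - z j) (Finset.mem_univ a)]
    have h0' : (g.coeff 0 : ℂ) ≠ 0 := by exact_mod_cast h0
    push_cast
    rw [sq, coeff_one_of_map_eq_prod z g hg, Finset.sum_mul_sum, Finset.sum_div]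
    refine Finset.sum_congr rfl fun a _ => ?_
    rw [Finset.sum_div]
    refine Finset.sum_congr rfl fun b _ => ?_
    rw [hinv a]
    field_simp
  rw [hexp]
  exact IsIntegral.sum _ fun a _ => IsIntegral.sum _ fun b _ => hterm a b

theorem abs_coeff_zero_zpow_eq (g : ℤ[X]) (hm : g.Monic) (hi : Irreducible g)
    (h0 : g.coeff 0 ≠ 0) (k : ℂ → ℤ) (c m : ℤ) (hc : 2 ≤ |c|) (hm0 : m ≠ 0)
    (h : ∏ x ∈ (g.map (Int.castRingHom ℂ)).roots.toFinset, x ^ k x = (c : ℂ) ^ m) :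
    ∃ A B : ℤ, A ≠ 0 ∧ B ≠ 0 ∧ (|g.coeff 0| : ℝ) ^ A = (|c| : ℝ) ^ B := by
  classical
  obtain ⟨G, ι, _, _, _, _, z, htrans, -, hinj, hg, hrel, -⟩ := exists_galois_action g hm hi
  have hc0 := coeff_zero_of_map_eq_prod z g hg
  rw [roots_toFinset_eq_image z _ hg, Finset.prod_image fun a _ b _ hab => hinj hab] at h
  have hι : Nonempty ι := by
    by_contra hempty
    rw [not_nonempty_iff] at hempty
    have h1 : (1 : ℂ) = (c : ℂ) ^ m := by simpa using h
    have h2 : (1 : ℝ) = (|c| : ℝ) ^ m := by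
      have := congrArg norm h1
      simpa [norm_zpow] using this
    have h3 : (1 : ℝ) < |(c : ℝ)| := by
      have : (2 : ℝ) ≤ |(c : ℝ)| := by exact_mod_cast hc
      linarith
    exact hm0 ((zpow_eq_one_iff_right₀ (by positivity) h3.ne').1 h2.symm)
  set F : ι → ℝ := fun i => ∏ σ : G, ‖z (σ • i)‖ with hF
  have hFconst : ∀ i j, F i = F j := by
    intro i j
    obtain ⟨τ, rfl⟩ := htrans.exists_smul_eq i j
    simp only [hF]
    rw [← Equiv.prod_comp (Equiv.mulRight τ) (fun σ => ‖z (σ • i)‖)]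
    simp [mul_smul]
  have hFprod : ∏ i, F i = |(g.coeff 0 : ℝ)| ^ Fintype.card G := by
    have hn : |(g.coeff 0 : ℝ)| = ∏ i, ‖z i‖ := by
      have := congrArg norm hc0
      simpa using this
    simp only [hF]
    rw [Finset.prod_comm, hn, ← Finset.card_univ, ← Finset.prod_const]
    refine Finset.prod_congr rfl fun σ _ => ?_
    exact Equiv.prod_comp (MulAction.toPerm σ) (fun i => ‖z i‖)
  obtain ⟨i₀⟩ := hι
  have hFpow : F i₀ ^ Fintype.card ι = |(g.coeff 0 : ℝ)| ^ Fintype.card G := by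
    rw [← hFprod, Finset.prod_congr rfl fun i _ => hFconst i i₀, Finset.prod_const,
      Finset.card_univ]
  have hFrel : F i₀ ^ (∑ i, k (z i)) = (|c| : ℝ) ^ (m * Fintype.card G) := by
    have h1 : ∀ σ : G, ∏ i, ‖z (σ • i)‖ ^ k (z i) = (|c| : ℝ) ^ m := by
      intro σ
      have := hrel (fun i => k (z i)) ((c : ℚ) ^ m) σ (by simpa using h)
      have := congrArg norm this
      simpa [norm_prod, norm_zpow] using this
    have h2 : ∏ σ : G, ∏ i, ‖z (σ • i)‖ ^ k (z i) = (|c| : ℝ) ^ (m * Fintype.card G) := by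
      rw [Finset.prod_congr rfl fun σ _ => h1 σ, Finset.prod_const, Finset.card_univ, zpow_mul,
        zpow_natCast]
    have hF0 : F i₀ ≠ 0 := by
      intro h00
      have : (0 : ℝ) = |(g.coeff 0 : ℝ)| ^ Fintype.card G := by
        rw [← hFpow, h00, zero_pow]
        exact (Fintype.card_pos_iff.2 ⟨i₀⟩).ne'
      have h3 : |(g.coeff 0 : ℝ)| ≠ 0 := by simpa using h0
      exact pow_ne_zero _ h3 this.symm
    have hsum : ∀ s : Finset ι, F i₀ ^ (∑ i ∈ s, k (z i)) = ∏ i ∈ s, F i₀ ^ k (z i) := by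
      intro s
      induction s using Finset.induction_on with
      | empty => simp
      | insert a s ha ih => rw [Finset.sum_insert ha, Finset.prod_insert ha, zpow_add₀ hF0, ih]
    rw [← h2, Finset.prod_comm, hsum]
    refine Finset.prod_congr rfl fun i _ => ?_
    rw [hFconst i₀ i, Finset.prod_zpow]
  have hcardG : (Fintype.card G : ℤ) ≠ 0 := by exact_mod_cast Fintype.card_ne_zero
  have hcardι : (Fintype.card ι : ℤ) ≠ 0 := by
    exact_mod_cast (Fintype.card_pos_iff.2 ⟨i₀⟩).ne'
  refine ⟨Fintype.card G * ∑ i, k (z i), m * Fintype.card G * Fintype.card ι, ?_,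
    mul_ne_zero (mul_ne_zero hm0 hcardG) hcardι, ?_⟩
  · refine mul_ne_zero hcardG fun hs => ?_
    rw [hs, zpow_zero] at hFrel
    have h3 : (1 : ℝ) < |(c : ℝ)| := by
      have : (2 : ℝ) ≤ |(c : ℝ)| := by exact_mod_cast hc
      linarith
    exact mul_ne_zero hm0 hcardG ((zpow_eq_one_iff_right₀ (by positivity) h3.ne').1 hFrel.symm)
  · rw [zpow_mul, zpow_natCast, ← hFpow, ← zpow_natCast, ← zpow_mul, mul_comm, zpow_mul, hFrel,
      ← zpow_mul]

theorem shift_eq_of_sum_eq_zero {p : ℕ} (hp : p.Prime) (k : ℕ → ℤ) (u : ℕ → ℝ)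
    (hper : ∀ t, u (t + p) = u t) (hk : ∃ i < p, ∃ j < p, k i ≠ k j)
    (h : ∀ t, ∑ i ∈ Finset.range p, k i * u (i + t) = 0) (t : ℕ) : u (t + 1) = u t := by
  have : Fact p.Prime := ⟨hp⟩
  let T : Module.End ℚ (ℕ → ℝ) := LinearMap.funLeft ℚ ℝ (· + 1)
  have hT : ∀ (i : ℕ) (v : ℕ → ℝ) (t : ℕ), (T ^ i) v t = v (t + i) := by
    intro i
    induction i with
    | zero => intro v t; simp
    | succ i ih =>
      intro v t
      rw [pow_succ, Module.End.mul_apply, ih, LinearMap.funLeft_apply, add_assoc]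
  let K : ℚ[X] := ∑ i ∈ Finset.range p, C (k i : ℚ) * X ^ i
  have hKcoeff : ∀ i < p, K.coeff i = k i := by
    intro i hi
    simp [K, coeff_X_pow, hi]
  have hK : aeval T K u = 0 := by
    funext s
    have : aeval T K u s = ∑ i ∈ Finset.range p, k i * u (i + s) := by
      simp only [K, map_sum, map_mul, aeval_C, map_pow, aeval_X, LinearMap.sum_apply,
        Finset.sum_apply, Module.End.mul_apply, Module.algebraMap_end_apply, Pi.smul_apply, hT]
      refine Finset.sum_congr rfl fun i _ => ?_
      rw [add_comm s i, Algebra.smul_def]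
      simp
    rw [this, h]; rfl
  have hP : aeval T ((X ^ p - 1 : ℚ[X])) u = 0 := by
    funext s
    simp [hT, hper]
  have hfac : cyclotomic p ℚ * (X - 1) = X ^ p - 1 := cyclotomic_prime_mul_X_sub_one ℚ p
  have hcop : IsCoprime (cyclotomic p ℚ) K := by
    refine ((cyclotomic.irreducible_rat hp.pos).coprime_iff_not_dvd).2 fun ⟨q, hq⟩ => ?_
    obtain ⟨i, hi, j, hj, hij⟩ := hk
    have hK0 : K ≠ 0 := by
      intro h0
      have h1 := hKcoeff i hi
      have h2 := hKcoeff j hj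
      rw [h0, coeff_zero] at h1 h2
      exact hij (by exact_mod_cast h1.symm.trans h2)
    have hq0 : q ≠ 0 := by rintro rfl; simp [hK0] at hq
    have hdeg : K.natDegree < p := by
      refine (natDegree_lt_iff_degree_lt hK0).2 ?_
      refine (degree_sum_le _ _).trans_lt ?_
      rw [Finset.sup_lt_iff (by exact WithBot.bot_lt_coe p)]
      intro i hi
      refine (degree_C_mul_X_pow_le i _).trans_lt ?_
      exact_mod_cast Finset.mem_range.1 hi
    have hqdeg : q.natDegree = 0 := by
      rw [hq, natDegree_mul (cyclotomic_ne_zero p ℚ) hq0, natDegree_cyclotomic,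
        Nat.totient_prime hp] at hdeg
      omega
    obtain ⟨c, rfl⟩ := natDegree_eq_zero.1 hqdeg
    have hc : ∀ i < p, K.coeff i = c := by
      intro i hi
      rw [hq, coeff_mul_C, cyclotomic_prime]
      simp [coeff_X_pow, hi]
    have := (hKcoeff i hi).symm.trans ((hc i hi).trans ((hc j hj).symm.trans (hKcoeff j hj)))
    exact hij (by exact_mod_cast this)
  obtain ⟨a, b, hab⟩ := hcop
  have hw : aeval T (X - 1 : ℚ[X]) u = 0 := by
    have hid : (X - 1 : ℚ[X]) = a * (X ^ p - 1) + (X - 1) * b * K := by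
      rw [← hfac]; linear_combination -(X - 1) * hab
    rw [hid, map_add, map_mul, map_mul, LinearMap.add_apply, Module.End.mul_apply,
      Module.End.mul_apply, hP, hK, map_zero, map_zero, add_zero]
  have := congrFun hw t
  simpa [T, LinearMap.funLeft_apply, sub_eq_zero] using this

theorem norm_roots_eq (g : ℤ[X]) (hm : g.Monic) (hi : Irreducible g)
    (hp : g.natDegree.Prime) (h0 : g.coeff 0 ≠ 0) (h1 : |g.coeff 0| ≠ 1) (k : ℂ → ℤ)
    (hk : ∃ x ∈ (g.map (Int.castRingHom ℂ)).roots.toFinset, k x ≠ 0)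
    (h : ∏ x ∈ (g.map (Int.castRingHom ℂ)).roots.toFinset, x ^ k x = 1)
    {x y : ℂ} (hx : x ∈ (g.map (Int.castRingHom ℂ)).roots.toFinset)
    (hy : y ∈ (g.map (Int.castRingHom ℂ)).roots.toFinset) : ‖x‖ = ‖y‖ := by
  classical
  obtain ⟨G, ι, _, _, _, _, z, htrans, hfaith, hinj, hg, hrel, hdvd⟩ := exists_galois_action g hm hi
  have hc0 := coeff_zero_of_map_eq_prod z g hg
  set p := g.natDegree with hpdef
  have : Fact p.Prime := ⟨hp⟩
  have hz : ∀ i, z i ≠ 0 := by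
    intro i hi0
    refine h0 ?_
    have : (g.coeff 0 : ℂ) = 0 := by
      rw [hc0]; exact Finset.prod_eq_zero (Finset.mem_univ i) (by simp [hi0])
    exact_mod_cast this
  have hcard : Fintype.card ι = p := by
    have h2 : (g.map (Int.castRingHom ℂ)).natDegree = p := hm.natDegree_map _
    rw [hg, natDegree_prod_of_monic _ _ fun i _ => monic_X_sub_C _] at h2
    simpa using h2
  rw [roots_toFinset_eq_image z _ hg] at hk h hx hy
  rw [Finset.prod_image fun a _ b _ hab => hinj hab] at h
  obtain ⟨σ, hσ⟩ := exists_prime_orderOf_dvd_card' p (hdvd hp)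
  have hτ : orderOf (MulAction.toPerm σ : Equiv.Perm ι) = p := by
    rw [← hσ]
    exact orderOf_injective (MulAction.toPermHom G ι) MulAction.toPerm_injective σ
  have hcyc : (MulAction.toPerm σ : Equiv.Perm ι).IsCycle :=
    Equiv.Perm.isCycle_of_prime_order'' (by rwa [hcard]) (by rw [hτ, hcard])
  have hsupp : (MulAction.toPerm σ : Equiv.Perm ι).support = Finset.univ := by
    rw [← Finset.card_eq_iff_eq_univ, ← hcyc.orderOf, hτ, hcard]
  have hmove : ∀ i : ι, (MulAction.toPerm σ : Equiv.Perm ι) i ≠ i := fun i =>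
    Equiv.Perm.mem_support.1 (hsupp ▸ Finset.mem_univ i)
  have hσp : σ ^ p = 1 := by rw [← hσ]; exact pow_orderOf_eq_one σ
  obtain ⟨i₀, -, rfl⟩ := Finset.mem_image.1 hx
  obtain ⟨j₀, -, rfl⟩ := Finset.mem_image.1 hy
  have hexists : ∀ j, ∃ n < p, σ ^ n • i₀ = j := by
    intro j
    obtain ⟨n, hn⟩ := hcyc.exists_pow_eq (hmove i₀) (hmove j)
    refine ⟨n % p, Nat.mod_lt _ hp.pos, ?_⟩
    rw [← hσ, pow_mod_orderOf, ← hn]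
    have : (MulAction.toPerm σ : Equiv.Perm ι) ^ n = MulAction.toPerm (σ ^ n) :=
      (map_pow (MulAction.toPermHom G ι) σ n).symm
    rw [this]; rfl
  have hbij : Function.Bijective (fun n : Fin p => σ ^ (n : ℕ) • i₀) := by
    rw [Fintype.bijective_iff_surjective_and_card]
    refine ⟨fun j => ?_, by simp [hcard]⟩
    obtain ⟨n, hn, hj⟩ := hexists j
    exact ⟨⟨n, hn⟩, hj⟩
  have hreindex : ∀ f : ι → ℝ, ∏ i, f i = ∏ n ∈ Finset.range p, f (σ ^ n • i₀) := by
    intro f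
    rw [← hbij.prod_comp f, Finset.prod_range (fun n => f (σ ^ n • i₀))]
  have hlog : ∀ t : ℕ, ∑ n ∈ Finset.range p,
      (k (z (σ ^ n • i₀)) : ℝ) * Real.log ‖z (σ ^ (n + t) • i₀)‖ = 0 := by
    intro t
    have h2 := hrel (fun i => k (z i)) 1 (σ ^ t) (by simpa using h)
    have h3 : ∏ i, ‖z (σ ^ t • i)‖ ^ k (z i) = 1 := by
      have := congrArg norm h2
      simpa [norm_prod, norm_zpow] using this
    rw [hreindex] at h3
    have h4 := congrArg Real.log h3
    rw [Real.log_prod (fun n _ => zpow_ne_zero _ (norm_ne_zero_iff.2 (hz _))), Real.log_one] at h4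
    rw [← h4]
    refine Finset.sum_congr rfl fun n _ => ?_
    rw [Real.log_zpow, add_comm n t, pow_add, mul_smul]
  have hnc : ∃ i < p, ∃ j < p, k (z (σ ^ i • i₀)) ≠ k (z (σ ^ j • i₀)) := by
    by_contra hcon
    push Not at hcon
    obtain ⟨w, hw, hkw⟩ := hk
    obtain ⟨j₁, -, rfl⟩ := Finset.mem_image.1 hw
    have hconst : ∀ j, k (z j) = k (z j₁) := by
      intro j
      obtain ⟨n, hn, rfl⟩ := hexists j
      obtain ⟨m, hm', hj⟩ := hexists j₁
      rw [← hj]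
      exact hcon n hn m hm'
    have h2 : (|(g.coeff 0 : ℝ)|) ^ k (z j₁) = 1 := by
      have hn : |(g.coeff 0 : ℝ)| = ∏ i, ‖z i‖ := by
        have := congrArg norm hc0
        simpa using this
      rw [hn, ← Finset.prod_zpow]
      have := congrArg norm h
      simpa [norm_prod, norm_zpow, hconst] using this
    have h3 : |(g.coeff 0 : ℝ)| ≠ 1 := by exact_mod_cast h1
    exact hkw ((zpow_eq_one_iff_right₀ (abs_nonneg _) h3).1 h2)
  have hshift := shift_eq_of_sum_eq_zero hp (fun n => k (z (σ ^ n • i₀)))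
    (fun n => Real.log ‖z (σ ^ n • i₀)‖) (fun t => by simp [pow_add, hσp]) hnc hlog
  have hall : ∀ n : ℕ, Real.log ‖z (σ ^ n • i₀)‖ = Real.log ‖z i₀‖ := by
    intro n
    induction n with
    | zero => simp
    | succ n ih => rw [← ih]; exact hshift n
  obtain ⟨n, -, hn⟩ := hexists j₀
  have := hall n
  rw [hn] at this
  exact (Real.log_injOn_pos (norm_pos_iff.2 (hz j₀)) (norm_pos_iff.2 (hz i₀)) this).symm

theorem ncard_le_of_key {α : Type*} (S : Set ℤ[X]) (m n : ℕ) (key : ℤ[X] → α) (P : Finset α)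
    (B : ℕ → ℕ) (hkey : ∀ f ∈ S, key f ∈ P) (hB : ∀ f ∈ S, ∀ j < n, |f.coeff (j + m)| ≤ B j)
    (hinj : ∀ f ∈ S, ∀ g ∈ S, key f = key g →
      (∀ j < n, f.coeff (j + m) = g.coeff (j + m)) → f = g) :
    S.Finite ∧ S.ncard ≤ P.card * ∏ j ∈ Finset.range n, (2 * B j + 1) := by
  classical
  let Q : Finset (α × (Fin n → ℤ)) :=
    P ×ˢ Fintype.piFinset fun j : Fin n => Finset.Icc (-(B j : ℤ)) (B j)
  let φ : ℤ[X] → α × (Fin n → ℤ) := fun f => (key f, fun j => f.coeff (j + m))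
  have hmaps : ∀ f ∈ S, φ f ∈ (Q : Set (α × (Fin n → ℤ))) := by
    intro f hf
    simp only [Q, φ, Finset.coe_product, Set.mem_prod, Finset.mem_coe, Fintype.mem_piFinset,
      Finset.mem_Icc]
    exact ⟨hkey f hf, fun j => abs_le.1 (hB f hf j j.2)⟩
  have hφ : Set.InjOn φ S := by
    intro f hf g hg hfg
    have h := Prod.ext_iff.1 hfg
    exact hinj f hf g hg h.1 fun j hj => congrFun h.2 ⟨j, hj⟩
  refine ⟨Set.Finite.of_injOn hmaps hφ Q.finite_toSet, ?_⟩
  refine (Set.ncard_le_ncard_of_injOn φ hmaps hφ Q.finite_toSet).trans ?_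
  rw [Set.ncard_coe_finset, Finset.card_product, Fintype.card_piFinset,
    Finset.prod_range (fun j => 2 * B j + 1)]
  refine Nat.mul_le_mul_left _ (le_of_eq (Finset.prod_congr rfl fun j _ => ?_))
  rw [Int.card_Icc]
  omega

theorem monic_ext_of_coeff_eq {n : ℕ} {f g : ℤ[X]} (hf : f.Monic) (hg : g.Monic)
    (hfn : f.natDegree = n) (hgn : g.natDegree = n) (h : ∀ i < n, f.coeff i = g.coeff i) :
    f = g := by
  ext i
  rcases lt_trichotomy i n with hi | rfl | hi
  · exact h i hi
  · have h1 := hf.coeff_natDegree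
    have h2 := hg.coeff_natDegree
    rw [hfn] at h1
    rw [hgn] at h2
    rw [h1, h2]
  · rw [coeff_eq_zero_of_natDegree_lt (hfn ▸ hi), coeff_eq_zero_of_natDegree_lt (hgn ▸ hi)]

/-- The Mahler measure of an integer polynomial. -/
noncomputable def intMahler (f : ℤ[X]) : ℝ := (f.map (Int.castRingHom ℂ)).mahlerMeasure

theorem intMahler_mul (f g : ℤ[X]) : intMahler (f * g) = intMahler f * intMahler g := by
  rw [intMahler, Polynomial.map_mul, mahlerMeasure_mul]; rfl

theorem one_le_intMahler {f : ℤ[X]} (hf : f ≠ 0) : 1 ≤ intMahler f := one_le_mahlerMeasure_of_ne_zero hf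

theorem intMahler_X_sub_C (c : ℤ) : intMahler (X - C c) = max 1 |(c : ℝ)| := by
  have h := mahlerMeasure_X_sub_C (c : ℂ)
  simpa [intMahler] using h

theorem abs_coeff_le_intMahler {f : ℤ[X]} {n : ℕ} (hf : f.natDegree ≤ n) (i : ℕ) :
    (|f.coeff i| : ℝ) ≤ 2 ^ n * intMahler f := by
  have h := norm_coeff_le_choose_mul_mahlerMeasure i (f.map (Int.castRingHom ℂ))
  have h1 : ‖(f.map (Int.castRingHom ℂ)).coeff i‖ = |(f.coeff i : ℝ)| := by simp
  rw [h1] at h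
  refine h.trans (mul_le_mul_of_nonneg_right ?_ (mahlerMeasure_nonneg _))
  have h2 : (f.map (Int.castRingHom ℂ)).natDegree ≤ n := natDegree_map_le.trans hf
  have h3 := (Nat.choose_le_two_pow (f.map (Int.castRingHom ℂ)).natDegree i).trans
    (Nat.pow_le_pow_right two_pos h2)
  exact_mod_cast h3

theorem intMahler_le_of_heightLe {f : ℤ[X]} {n : ℕ} {H : ℤ} (hf : f.natDegree ≤ n)
    (h : ∀ i, |f.coeff i| ≤ H) : intMahler f ≤ (n + 1) * H := by
  refine (mahlerMeasure_le_sum_norm_coeff _).trans ?_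
  rw [Polynomial.sum_over_range' _ (by simp) (n + 1)
    (Nat.lt_succ_of_le (natDegree_map_le.trans hf))]
  refine (Finset.sum_le_card_nsmul _ _ (H : ℝ) fun i _ => ?_).trans (by simp)
  have : ‖(f.map (Int.castRingHom ℂ)).coeff i‖ = |(f.coeff i : ℝ)| := by simp
  rw [this]
  exact_mod_cast h i

/-- Monic integer polynomials of degree `n` and Mahler measure at most `T`. -/
def mahlerSet (n : ℕ) (T : ℝ) : Set ℤ[X] := {f | f.Monic ∧ f.natDegree = n ∧ intMahler f ≤ T}

theorem ncard_mahlerSet_inter_le {α : Type*} (n : ℕ) {T : ℝ} (hT : 1 ≤ T) (S : Set ℤ[X])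
    (hS : S ⊆ mahlerSet n T) (m : ℕ) (hmn : m ≤ n) (key : ℤ[X] → α) (P : Finset α)
    (hkey : ∀ f ∈ S, key f ∈ P)
    (hinj : ∀ f ∈ S, ∀ g ∈ S, key f = key g → ∀ i < m, f.coeff i = g.coeff i) :
    S.Finite ∧ (S.ncard : ℝ) ≤ P.card * (3 * 2 ^ n * T) ^ (n - m) := by
  have h := ncard_le_of_key S m (n - m) key P (fun _ => ⌊2 ^ n * T⌋₊) hkey ?_ ?_
  · refine ⟨h.1, (Nat.cast_le.2 h.2).trans ?_⟩
    rw [Finset.prod_const, Finset.card_range]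
    push_cast
    refine mul_le_mul_of_nonneg_left (pow_le_pow_left₀ (by positivity) ?_ _) (by positivity)
    have h1 : (⌊2 ^ n * T⌋₊ : ℝ) ≤ 2 ^ n * T := Nat.floor_le (by positivity)
    have h2 : (1 : ℝ) ≤ 2 ^ n := one_le_pow₀ (by norm_num)
    nlinarith
  · intro f hf j _
    obtain ⟨-, hdeg, hM⟩ := hS hf
    have h1 := (abs_coeff_le_intMahler hdeg.le (j + m)).trans
      (mul_le_mul_of_nonneg_left hM (by positivity))
    have h2 : (f.coeff (j + m)).natAbs ≤ ⌊2 ^ n * T⌋₊ := by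
      refine Nat.le_floor ?_
      rw [Nat.cast_natAbs]
      exact_mod_cast h1
    rw [Int.abs_eq_natAbs]
    exact_mod_cast h2
  · intro f hf g hg hfg hc
    obtain ⟨hfm, hfn, -⟩ := hS hf
    obtain ⟨hgm, hgn, -⟩ := hS hg
    refine monic_ext_of_coeff_eq hfm hgm hfn hgn fun i hi => ?_
    rcases lt_or_ge i m with him | him
    · exact hinj f hf g hg hfg i him
    · have := hc (i - m) (by omega)
      rwa [Nat.sub_add_cancel him] at this

theorem ncard_mahlerSet_le (n : ℕ) {T : ℝ} (hT : 1 ≤ T) :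
    (mahlerSet n T).Finite ∧ ((mahlerSet n T).ncard : ℝ) ≤ (3 * 2 ^ n * T) ^ n := by
  have := ncard_mahlerSet_inter_le n hT (mahlerSet n T) subset_rfl 0 (Nat.zero_le n)
    (fun _ => ()) {()} (by simp) (by simp)
  simpa using this

theorem eval_ne_zero_of_irreducible {g : ℤ[X]} (hm : g.Monic) (hi : Irreducible g)
    (hd : 2 ≤ g.natDegree) (c : ℤ) : g.eval c ≠ 0 := by
  intro h
  have h1 : X - C c ∣ g := dvd_iff_isRoot.2 h
  obtain ⟨q, hq⟩ := h1
  have hqm : q.Monic := (monic_X_sub_C c).of_mul_monic_left (hq ▸ hm)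
  rcases hi.isUnit_or_isUnit hq with hu | hu
  · exact not_isUnit_X_sub_C c hu
  · have := hqm.eq_one_of_isUnit hu
    rw [hq, this, mul_one, natDegree_X_sub_C] at hd
    omega

theorem coeff_zero_ne_zero_of_irreducible {g : ℤ[X]} (hm : g.Monic) (hi : Irreducible g)
    (hd : 2 ≤ g.natDegree) : g.coeff 0 ≠ 0 := by
  rw [coeff_zero_eq_eval_zero]
  exact_mod_cast eval_ne_zero_of_irreducible hm hi hd 0

theorem mem_roots_toFinset_intCast {g : ℤ[X]} (hm : g.Monic) (c : ℤ) :
    (c : ℂ) ∈ (g.map (Int.castRingHom ℂ)).roots.toFinset ↔ g.eval c = 0 := by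
  rw [Multiset.mem_toFinset, mem_roots (hm.map _).ne_zero, IsRoot.def, eval_intCast_map]
  simp

theorem nzRoots_of_irreducible {g : ℤ[X]} (hm : g.Monic) (hi : Irreducible g)
    (hd : 2 ≤ g.natDegree) : nzRoots g = (g.map (Int.castRingHom ℂ)).roots.toFinset := by
  refine Finset.filter_true_of_mem ?_
  rintro z hz rfl
  have := (mem_roots_toFinset_intCast hm 0).1 (by simpa using hz)
  exact eval_ne_zero_of_irreducible hm hi hd 0 this

theorem norm_root_pow_eq {g : ℤ[X]} (hm : g.Monic)
    (h : ∀ x ∈ (g.map (Int.castRingHom ℂ)).roots, ∀ y ∈ (g.map (Int.castRingHom ℂ)).roots,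
      ‖x‖ = ‖y‖) {x : ℂ} (hx : x ∈ (g.map (Int.castRingHom ℂ)).roots) :
    ‖x‖ ^ g.natDegree = |(g.coeff 0 : ℝ)| := by
  have hs : (g.map (Int.castRingHom ℂ)).Splits := IsAlgClosed.splits _
  have h1 := hs.coeff_zero_eq_prod_roots_of_monic (hm.map _)
  have h2 : ‖(g.map (Int.castRingHom ℂ)).coeff 0‖ = |(g.coeff 0 : ℝ)| := by simp
  rw [← h2, h1, norm_mul, norm_pow, norm_neg, norm_one, one_pow, one_mul,
    show ‖(g.map (Int.castRingHom ℂ)).roots.prod‖ =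
      ((g.map (Int.castRingHom ℂ)).roots.map fun y => ‖y‖).prod from
      map_multiset_prod (normHom : ℂ →*₀ ℝ) _,
    Multiset.map_congr rfl fun y hy => h y hy x hx, Multiset.map_const', Multiset.prod_replicate]
  rw [← hs.natDegree_eq_card_roots, hm.natDegree_map]

theorem two_mul_sum_range_sub (p : ℕ) : 2 * ∑ j ∈ Finset.range p, (p - j) = p * (p + 1) := by
  induction p with
  | zero => simp
  | succ n ih =>
    rw [Finset.sum_range_succ', Finset.sum_congr rfl fun j _ => Nat.add_sub_add_right n 1 j,
      mul_add, ih]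
    simp only [Nat.sub_zero]
    ring

theorem ncard_irreducible_le {p : ℕ} (hp : p.Prime) (h5 : 5 ≤ p) {H : ℤ} (hH : 1 ≤ H) :
    ({f | f ∈ Mset p H ∧ Irreducible f ∧ |f.coeff 0| ≠ 1}.ncard : ℝ) ≤
      (3 * 2 ^ p) ^ p * (H : ℝ) ^ (p - 2) := by
  have hH' : (1 : ℝ) ≤ H := by exact_mod_cast hH
  have hp0 : p ≠ 0 := by omega
  obtain ⟨t, ht1, ht⟩ : ∃ t : ℝ, 1 ≤ t ∧ t ^ p = H :=
    ⟨(H : ℝ) ^ ((p : ℝ)⁻¹), Real.one_le_rpow hH' (by positivity),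
      Real.rpow_inv_natCast_pow (by positivity) hp0⟩
  have key := ncard_le_of_key {f | f ∈ Mset p H ∧ Irreducible f ∧ |f.coeff 0| ≠ 1} 0 p
    (fun _ => ()) {()} (fun j => ⌊2 ^ p * t ^ (p - j)⌋₊) (by simp) ?_ ?_
  · refine (Nat.cast_le.2 key.2).trans ?_
    rw [Finset.card_singleton, one_mul, Nat.cast_prod]
    have hle : ∀ j ∈ Finset.range p, ((2 * ⌊2 ^ p * t ^ (p - j)⌋₊ + 1 : ℕ) : ℝ) ≤
        3 * 2 ^ p * t ^ (p - j) := by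
      intro j _
      have h1 : (⌊2 ^ p * t ^ (p - j)⌋₊ : ℝ) ≤ 2 ^ p * t ^ (p - j) :=
        Nat.floor_le (by positivity)
      have h2 : (1 : ℝ) ≤ 2 ^ p * t ^ (p - j) :=
        one_le_mul_of_one_le_of_one_le (one_le_pow₀ (by norm_num)) (one_le_pow₀ ht1)
      push_cast
      linarith
    refine (Finset.prod_le_prod (fun _ _ => Nat.cast_nonneg _) hle).trans ?_
    rw [Finset.prod_mul_distrib, Finset.prod_const, Finset.card_range, Finset.prod_pow_eq_pow_sum,
      ← ht, ← pow_mul]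
    refine mul_le_mul_of_nonneg_left (pow_le_pow_right₀ ht1 ?_) (by positivity)
    have h2 := two_mul_sum_range_sub p
    obtain ⟨q, rfl⟩ := Nat.exists_eq_add_of_le h5
    have : 5 + q - 2 = 3 + q := by omega
    rw [this]
    nlinarith
  · rintro f ⟨⟨hm, hdeg, hH2, -, k, hk, hrel⟩, hi, h1⟩ j hj
    rw [add_zero]
    have hd2 : 2 ≤ f.natDegree := by omega
    rw [nzRoots_of_irreducible hm hi hd2] at hk hrel
    have h0 := coeff_zero_ne_zero_of_irreducible hm hi hd2
    have hnorm : ∀ z ∈ (f.map (Int.castRingHom ℂ)).roots, ‖z‖ ≤ t := by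
      intro z hz
      have := norm_root_pow_eq hm (fun x hx y hy => norm_roots_eq f hm hi (hdeg ▸ hp) h0 h1 k hk
        hrel (Multiset.mem_toFinset.2 hx) (Multiset.mem_toFinset.2 hy)) hz
      rw [hdeg] at this
      refine le_of_pow_le_pow_left₀ hp0 (by positivity) ?_
      rw [this, ht]
      exact_mod_cast hH2 0
    have hc := coeff_le_of_roots_le j hm (IsAlgClosed.splits _) hnorm
    have h3 : ‖(f.map (Int.castRingHom ℂ)).coeff j‖ = |(f.coeff j : ℝ)| := by simp
    rw [h3, hdeg, mul_comm] at hc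
    have h4 : (p.choose j : ℝ) ≤ 2 ^ p := by exact_mod_cast Nat.choose_le_two_pow p j
    have h5 : (f.coeff j).natAbs ≤ ⌊2 ^ p * t ^ (p - j)⌋₊ := by
      refine Nat.le_floor ?_
      rw [Nat.cast_natAbs]
      push_cast
      exact hc.trans (mul_le_mul_of_nonneg_right h4 (by positivity))
    rw [Int.abs_eq_natAbs]
    exact_mod_cast h5
  · rintro f ⟨⟨hfm, hfn, -⟩, -⟩ g ⟨⟨hgm, hgn, -⟩, -⟩ - h
    exact monic_ext_of_coeff_eq hfm hgm hfn hgn h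

theorem ncard_image2_mul_le {A B : Set ℤ[X]} (hA : A.Finite) (hB : B.Finite) :
    (Set.image2 (· * ·) A B).Finite ∧
      (Set.image2 (· * ·) A B).ncard ≤ A.ncard * B.ncard := by
  refine ⟨hA.image2 _ hB, ?_⟩
  rw [← Set.image_prod, ← Set.ncard_prod]
  exact Set.ncard_image_le (hA.prod hB)

theorem natLog_two_floor_le {T : ℝ} (hT : 1 ≤ T) :
    (Nat.log 2 ⌊T⌋₊ : ℝ) ≤ 2 * Real.log T := by
  have h1 : (2 : ℝ) ^ Nat.log 2 ⌊T⌋₊ ≤ T := by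
    have := Nat.pow_log_le_self 2 (Nat.floor_pos.2 hT).ne'
    exact (Nat.le_floor_iff (by positivity)).1 this |> fun h => by exact_mod_cast h
  have h2 := Real.log_le_log (by positivity) h1
  rw [Real.log_pow] at h2
  have h3 := Real.log_two_gt_d9
  have h4 : (0 : ℝ) ≤ Nat.log 2 ⌊T⌋₊ := Nat.cast_nonneg _
  nlinarith

theorem ncard_mul_two_le (p : ℕ) {T : ℝ} (hT : 1 ≤ T) :
    {f : ℤ[X] | f.natDegree = p ∧ intMahler f ≤ T ∧ ∃ g h : ℤ[X], g.Monic ∧ h.Monic ∧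
      f = g * h ∧ 2 ≤ g.natDegree ∧ 2 ≤ h.natDegree}.Finite ∧
    ({f : ℤ[X] | f.natDegree = p ∧ intMahler f ≤ T ∧ ∃ g h : ℤ[X], g.Monic ∧ h.Monic ∧
      f = g * h ∧ 2 ≤ g.natDegree ∧ 2 ≤ h.natDegree}.ncard : ℝ) ≤
      p * (6 * 2 ^ p) ^ p * (T ^ (p - 2) * (2 * Real.log T + 1)) := by
  set S := {f : ℤ[X] | f.natDegree = p ∧ intMahler f ≤ T ∧ ∃ g h : ℤ[X], g.Monic ∧ h.Monic ∧
      f = g * h ∧ 2 ≤ g.natDegree ∧ 2 ≤ h.natDegree}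
  set L := Nat.log 2 ⌊T⌋₊ with hL
  have hTL : ∀ i ∈ Finset.range (L + 1), (2 : ℝ) ^ i ≤ T := by
    intro i hi
    have h1 : 2 ^ i ≤ ⌊T⌋₊ :=
      (Nat.pow_le_pow_right two_pos (Nat.lt_succ_iff.1 (Finset.mem_range.1 hi))).trans
        (Nat.pow_log_le_self 2 (Nat.floor_pos.2 hT).ne')
    exact_mod_cast (Nat.le_floor_iff (by positivity)).1 h1
  let I : Finset (ℕ × ℕ) := Finset.Ico 2 (p - 1) ×ˢ Finset.range (L + 1)
  let F : ℕ × ℕ → Set ℤ[X] := fun q =>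
    Set.image2 (· * ·) (mahlerSet q.1 (2 ^ (q.2 + 1))) (mahlerSet (p - q.1) (T / 2 ^ q.2))
  have hF : ∀ q ∈ I, (F q).Finite ∧ ((F q).ncard : ℝ) ≤ (6 * 2 ^ p) ^ p * T ^ (p - 2) := by
    rintro ⟨r, i⟩ hq
    simp only [I, Finset.mem_product, Finset.mem_Ico] at hq
    obtain ⟨⟨hr2, hrp⟩, hi⟩ := hq
    have hx : (1 : ℝ) ≤ 2 ^ i := one_le_pow₀ (by norm_num)
    have hy : 1 ≤ T / 2 ^ i := (one_le_div (by positivity)).2 (hTL i hi)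
    have h1 := ncard_mahlerSet_le r (T := 2 ^ (i + 1)) (one_le_pow₀ (by norm_num))
    have h2 := ncard_mahlerSet_le (p - r) hy
    have h3 := ncard_image2_mul_le h1.1 h2.1
    refine ⟨h3.1, (Nat.cast_le.2 h3.2).trans ?_⟩
    rw [Nat.cast_mul]
    refine (mul_le_mul h1.2 h2.2 (by positivity) (by positivity)).trans ?_
    have hr : (2 : ℝ) ^ r ≤ 2 ^ p := pow_le_pow_right₀ (by norm_num) (by omega)
    have hpr : (2 : ℝ) ^ (p - r) ≤ 2 ^ p := pow_le_pow_right₀ (by norm_num) (by omega)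
    have e1 : (3 * 2 ^ r * 2 ^ (i + 1) : ℝ) ^ r ≤ (6 * 2 ^ p) ^ r * (2 ^ i) ^ (p - 2) := by
      refine (?_ : _ ≤ (6 * 2 ^ p : ℝ) ^ r * (2 ^ i) ^ r).trans
        (mul_le_mul_of_nonneg_left (pow_le_pow_right₀ hx (by omega)) (by positivity))
      rw [← mul_pow]
      refine pow_le_pow_left₀ (by positivity) ?_ _
      rw [pow_succ]
      nlinarith
    have e2 : (3 * 2 ^ (p - r) * (T / 2 ^ i) : ℝ) ^ (p - r) ≤
        (6 * 2 ^ p) ^ (p - r) * (T / 2 ^ i) ^ (p - 2) := by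
      refine (?_ : _ ≤ (6 * 2 ^ p : ℝ) ^ (p - r) * (T / 2 ^ i) ^ (p - r)).trans
        (mul_le_mul_of_nonneg_left (pow_le_pow_right₀ hy (by omega)) (by positivity))
      rw [← mul_pow]
      refine pow_le_pow_left₀ (by positivity) ?_ _
      refine mul_le_mul_of_nonneg_right ?_ (by positivity)
      linarith [pow_pos (two_pos (α := ℝ)) p]
    refine (mul_le_mul e1 e2 (by positivity) (by positivity)).trans (le_of_eq ?_)
    have e3 : (6 * 2 ^ p : ℝ) ^ p = (6 * 2 ^ p) ^ r * (6 * 2 ^ p) ^ (p - r) := by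
      rw [← pow_add]; congr 1; omega
    have e4 : T ^ (p - 2) = (2 ^ i) ^ (p - 2) * (T / 2 ^ i) ^ (p - 2) := by
      rw [← mul_pow, mul_div_cancel₀ _ (by positivity)]
    rw [e3, e4]
    ring
  have hSF : S ⊆ ⋃ q ∈ I, F q := by
    rintro f ⟨hdeg, hM, g, h, hg, hh, rfl, hg2, hh2⟩
    rw [hg.natDegree_mul hh] at hdeg
    have hM1 := one_le_intMahler hg.ne_zero
    have hM2 := one_le_intMahler hh.ne_zero
    rw [intMahler_mul] at hM
    have hgT : intMahler g ≤ T := by nlinarith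
    have hlow : (2 : ℝ) ^ Nat.log 2 ⌊intMahler g⌋₊ ≤ intMahler g := by
      have := Nat.pow_log_le_self 2 (Nat.floor_pos.2 hM1).ne'
      exact_mod_cast (Nat.le_floor_iff (by positivity)).1 this
    have hup : intMahler g ≤ 2 ^ (Nat.log 2 ⌊intMahler g⌋₊ + 1) := by
      have h1 := Nat.lt_pow_succ_log_self one_lt_two ⌊intMahler g⌋₊
      have h2 := Nat.lt_floor_add_one (intMahler g)
      have h3 : (⌊intMahler g⌋₊ : ℝ) + 1 ≤ 2 ^ (Nat.log 2 ⌊intMahler g⌋₊ + 1) := by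
        exact_mod_cast h1
      linarith
    refine Set.mem_biUnion (x := (g.natDegree, Nat.log 2 ⌊intMahler g⌋₊)) ?_ ?_
    · simp only [I, Finset.coe_product, Set.mem_prod, Finset.mem_coe, Finset.mem_Ico,
        Finset.mem_range]
      exact ⟨⟨hg2, by omega⟩, Nat.lt_succ_of_le (Nat.log_mono_right (Nat.floor_mono hgT))⟩
    · refine ⟨g, ⟨hg, rfl, hup⟩, h, ⟨hh, by simp only; omega, ?_⟩, rfl⟩
      rw [le_div_iff₀ (by positivity)]
      refine le_trans ?_ hM
      rw [mul_comm]
      exact mul_le_mul_of_nonneg_right hlow (by positivity)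
  have hfin : (⋃ q ∈ I, F q).Finite := I.finite_toSet.biUnion fun q hq => (hF q hq).1
  refine ⟨hfin.subset hSF, ?_⟩
  have h1 : (S.ncard : ℝ) ≤ ∑ q ∈ I, ((F q).ncard : ℝ) := by
    exact_mod_cast (Set.ncard_le_ncard hSF hfin).trans (Finset.set_ncard_biUnion_le I F)
  refine h1.trans ((Finset.sum_le_card_nsmul _ _ _ fun q hq => (hF q hq).2).trans ?_)
  rw [nsmul_eq_mul, Finset.card_product, Finset.card_range, Nat.card_Ico]
  have h2 := natLog_two_floor_le hT
  rw [← hL] at h2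
  have h3 : ((p - 1 - 2 : ℕ) : ℝ) ≤ p := by exact_mod_cast (by omega : p - 1 - 2 ≤ p)
  push_cast
  calc ((p - 1 - 2 : ℕ) : ℝ) * (L + 1) * ((6 * 2 ^ p) ^ p * T ^ (p - 2))
      ≤ p * (2 * Real.log T + 1) * ((6 * 2 ^ p) ^ p * T ^ (p - 2)) := by
        gcongr
    _ = _ := by ring

theorem sum_Icc_inv_le (B : ℕ) :
    ∑ r ∈ Finset.Icc 1 B, (r : ℝ)⁻¹ ≤ 1 + Real.log B := by
  refine le_trans (le_of_eq ?_) (harmonic_le_one_add_log B)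
  rw [harmonic_eq_sum_Icc]
  push_cast
  rfl

theorem exists_of_dvd_sq {a b : ℤ} (ha : a ≠ 0) (h : a ∣ b ^ 2) :
    ∃ r s : ℕ, 0 < r ∧ 0 < s ∧ a.natAbs = r ^ 2 * s ∧ ((r * s : ℕ) : ℤ) ∣ b := by
  obtain ⟨s, r, hrs, hs⟩ := Nat.sq_mul_squarefree a.natAbs
  have ha' : a.natAbs ≠ 0 := Int.natAbs_ne_zero.2 ha
  have hr0 : 0 < r := by
    rcases Nat.eq_zero_or_pos r with rfl | h
    · simp at hrs; omega
    · exact h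
  have hs0 : 0 < s := by
    rcases Nat.eq_zero_or_pos s with rfl | h
    · simp at hrs; omega
    · exact h
  refine ⟨r, s, hr0, hs0, hrs.symm, ?_⟩
  rw [Int.natCast_dvd]
  have h1 : r ^ 2 * s ∣ b.natAbs ^ 2 := by
    rw [hrs, ← Int.natAbs_pow]
    exact Int.natAbs_dvd_natAbs.2 h
  obtain ⟨t, ht⟩ := (Nat.pow_dvd_pow_iff two_ne_zero).1 ((dvd_mul_right _ _).trans h1)
  rw [ht] at h1 ⊢
  rw [mul_pow] at h1
  have h2 := (mul_dvd_mul_iff_left (by positivity)).1 h1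
  exact mul_dvd_mul_left r ((hs.dvd_pow_iff_dvd two_ne_zero).1 h2)

/-- Pairs `(a, b)` of integers in `[-B, B]` with `a ≠ 0` and `a ∣ b ^ 2`. -/
noncomputable def dvdSqPairs (B : ℕ) : Finset (ℤ × ℤ) :=
  (Finset.Icc (-(B : ℤ)) B ×ˢ Finset.Icc (-(B : ℤ)) B).filter fun q => q.1 ≠ 0 ∧ q.1 ∣ q.2 ^ 2

theorem card_dvdSqPairs_le (B : ℕ) :
    ((dvdSqPairs B).card : ℝ) ≤ 6 * B * (1 + Real.log B) ^ 2 := by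
  classical
  let I : Finset (ℕ × ℕ) :=
    (Finset.Icc 1 B ×ˢ Finset.Icc 1 B).filter fun q => q.1 * q.2 ≤ B
  let D : ℕ × ℕ → Finset (ℤ × ℤ) := fun q =>
    (({1, -1} : Finset ℤ) ×ˢ Finset.Icc (-((B / (q.1 * q.2) : ℕ) : ℤ)) ((B / (q.1 * q.2) : ℕ) : ℤ)).image
      fun w => (w.1 * (q.1 ^ 2 * q.2 : ℕ), (q.1 * q.2 : ℕ) * w.2)
  have hsub : dvdSqPairs B ⊆ I.biUnion D := by
    rintro ⟨a, b⟩ hab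
    simp only [dvdSqPairs, Finset.mem_filter, Finset.mem_product, Finset.mem_Icc] at hab
    obtain ⟨⟨ha, hb⟩, ha0, hd⟩ := hab
    obtain ⟨r, s, hr, hs, hrs, u, hu⟩ := exists_of_dvd_sq ha0 hd
    have haB : r ^ 2 * s ≤ B := by rw [← hrs]; omega
    have hrsB : r * s ≤ B := by nlinarith
    have hrB : r ≤ B := by nlinarith
    have hsB : s ≤ B := by nlinarith
    rw [Finset.mem_biUnion]
    refine ⟨(r, s), by simp only [I, Finset.mem_filter, Finset.mem_product, Finset.mem_Icc]; omega, ?_⟩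
    simp only [D, Finset.mem_image, Finset.mem_product, Finset.mem_Icc, Prod.mk.injEq]
    refine ⟨(a.sign, u), ⟨?_, ?_⟩, ?_, hu.symm⟩
    · rcases lt_or_gt_of_ne ha0 with h | h
      · simp [Int.sign_eq_neg_one_of_neg h]
      · simp [Int.sign_eq_one_of_pos h]
    · have : u.natAbs ≤ B / (r * s) := by
        rw [Nat.le_div_iff_mul_le (by positivity)]
        have h1 : b.natAbs = r * s * u.natAbs := by
          rw [hu, Int.natAbs_mul, Int.natAbs_natCast]
        have h2 : b.natAbs ≤ B := by omega
        linarith [mul_comm u.natAbs (r * s)]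
      omega
    · rw [← hrs]
      exact Int.sign_mul_natAbs a
  have hD : ∀ q ∈ I, ((D q).card : ℝ) ≤ 6 * B * ((q.1 : ℝ)⁻¹ * (q.2 : ℝ)⁻¹) := by
    rintro ⟨r, s⟩ hq
    simp only [I, Finset.mem_filter, Finset.mem_product, Finset.mem_Icc] at hq
    obtain ⟨⟨⟨hr, -⟩, hs, -⟩, hrs⟩ := hq
    have h1 : (D (r, s)).card ≤ 2 * (2 * (B / (r * s)) + 1) := by
      refine Finset.card_image_le.trans ?_
      rw [Finset.card_product, Int.card_Icc]
      refine Nat.mul_le_mul (Finset.card_le_two) ?_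
      simp only
      omega
    have h2 : 2 * (2 * (B / (r * s)) + 1) ≤ 6 * (B / (r * s)) := by
      have : 1 ≤ B / (r * s) := (Nat.one_le_div_iff (by positivity)).2 hrs
      omega
    have h3 : ((B / (r * s) : ℕ) : ℝ) ≤ B / (r * s) := by
      exact_mod_cast Nat.cast_div_le (α := ℝ) (m := B) (n := r * s)
    calc ((D (r, s)).card : ℝ) ≤ 6 * ((B / (r * s) : ℕ) : ℝ) := by exact_mod_cast h1.trans h2
      _ ≤ 6 * (B / (r * s)) := by linarith
      _ = _ := by simp only; field_simp
  calc ((dvdSqPairs B).card : ℝ) ≤ ∑ q ∈ I, ((D q).card : ℝ) := by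
        exact_mod_cast (Finset.card_le_card hsub).trans Finset.card_biUnion_le
    _ ≤ ∑ q ∈ I, 6 * B * ((q.1 : ℝ)⁻¹ * (q.2 : ℝ)⁻¹) := Finset.sum_le_sum hD
    _ ≤ ∑ q ∈ Finset.Icc 1 B ×ˢ Finset.Icc 1 B, 6 * B * ((q.1 : ℝ)⁻¹ * (q.2 : ℝ)⁻¹) :=
        Finset.sum_le_sum_of_subset_of_nonneg (Finset.filter_subset _ _)
          fun _ _ _ => by positivity
    _ = 6 * B * (∑ r ∈ Finset.Icc 1 B, (r : ℝ)⁻¹) ^ 2 := by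
        rw [← Finset.mul_sum, sq, Finset.sum_mul_sum, ← Finset.sum_product']
    _ ≤ _ := by
        refine mul_le_mul_of_nonneg_left (pow_le_pow_left₀ ?_ (sum_Icc_inv_le B) 2) (by positivity)
        exact Finset.sum_nonneg fun _ _ => by positivity

theorem natAbs_eq_of_zpow_eq {q : ℕ} (hq : q.Prime) {c : ℤ} (hc : c ≠ 0) (hqc : (q : ℤ) ∣ c)
    {a a' A E A' E' : ℤ} (hA : A ≠ 0) (hE : E ≠ 0) (hE' : E' ≠ 0)
    (h : (|a| : ℝ) ^ A = (|c| : ℝ) ^ E) (h' : (|a'| : ℝ) ^ A' = (|c| : ℝ) ^ E')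
    (hv : padicValInt q a = padicValInt q a') : a.natAbs = a'.natAbs := by
  have : Fact q.Prime := ⟨hq⟩
  have hval : ∀ {a A E : ℤ}, (|a| : ℝ) ^ A = (|c| : ℝ) ^ E →
      A * (padicValInt q a : ℤ) = E * (padicValInt q c : ℤ) := by
    intro a A E h
    have h1 : ((a.natAbs : ℤ) : ℚ) ^ A = ((c.natAbs : ℤ) : ℚ) ^ E := by
      rw [Int.natCast_natAbs, Int.natCast_natAbs, ← Rat.cast_inj (α := ℝ)]
      push_cast
      exact h
    have h2 := congrArg (padicValRat q) h1
    rw [padicValRat.zpow, padicValRat.zpow, padicValRat.of_int, padicValRat.of_int] at h2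
    exact h2
  have e1 := hval h
  have e2 := hval h'
  rw [← hv] at e2
  have hvc : (padicValInt q c : ℤ) ≠ 0 := by
    have : 1 ≤ padicValInt q c := by
      rw [padicValInt, ← padicValNat_dvd_iff_le (Int.natAbs_ne_zero.2 hc), pow_one]
      exact Int.natCast_dvd.1 hqc
    omega
  have hva : (padicValInt q a : ℤ) ≠ 0 := by
    intro h0
    rw [h0, mul_zero] at e1
    exact mul_ne_zero hE hvc e1.symm
  have e3 : A * E' = A' * E := by
    have : (A * E' - A' * E) * (padicValInt q a * padicValInt q c : ℤ) = 0 := by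
      linear_combination (E' * padicValInt q c : ℤ) * e1 - (E * padicValInt q c : ℤ) * e2
    rcases mul_eq_zero.1 this with h | h
    · linarith
    · exact absurd h (mul_ne_zero hva hvc)
  have e4 : (|a| : ℝ) ^ (A * E') = (|a'| : ℝ) ^ (A * E') := by
    rw [zpow_mul, h, e3, zpow_mul, h', ← zpow_mul, ← zpow_mul, mul_comm]
  have e5 := (zpow_left_inj₀ (abs_nonneg _) (abs_nonneg _) (mul_ne_zero hA hE')).1 e4
  have e6 : |a| = |a'| := by exact_mod_cast e5
  rw [Int.abs_eq_natAbs, Int.abs_eq_natAbs] at e6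
  exact_mod_cast e6

open Classical in
/-- Pairs `(a, b)` of integers in `[-B, B]` with `a ≠ 0` and `|a|`, `|c|` multiplicatively
dependent. -/
noncomputable def zpowPairs (B : ℕ) (c : ℤ) : Finset (ℤ × ℤ) :=
  (Finset.Icc (-(B : ℤ)) B).filter (fun a : ℤ => a ≠ 0 ∧
    ∃ A E : ℤ, A ≠ 0 ∧ E ≠ 0 ∧ (|a| : ℝ) ^ A = (|c| : ℝ) ^ E) ×ˢ Finset.Icc (-(B : ℤ)) B

theorem card_zpowPairs_le (B : ℕ) {c : ℤ} (hc : 2 ≤ |c|) :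
    (zpowPairs B c).card ≤ 2 * (Nat.log 2 B + 1) * (2 * B + 1) := by
  classical
  have hc0 : c ≠ 0 := by rintro rfl; simp at hc
  obtain ⟨q, hq, hqc⟩ := Nat.exists_prime_and_dvd (n := c.natAbs) (by
    rw [Int.abs_eq_natAbs] at hc; omega)
  rw [zpowPairs, Finset.card_product]
  refine Nat.mul_le_mul ?_ (by rw [Int.card_Icc]; omega)
  have hcard : (({1, -1} : Finset ℤ) ×ˢ Finset.range (Nat.log 2 B + 1)).card ≤
      2 * (Nat.log 2 B + 1) := by
    rw [Finset.card_product, Finset.card_range]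
    exact Nat.mul_le_mul_right _ Finset.card_le_two
  refine (Finset.card_le_card_of_injOn (fun a => (a.sign, padicValInt q a)) ?_ ?_).trans hcard
  · intro a ha
    simp only [Finset.coe_filter, Set.mem_ofPred_eq, Finset.mem_Icc] at ha
    obtain ⟨haB, ha0, -⟩ := ha
    simp only [Finset.coe_product, Set.mem_prod, Finset.mem_coe, Finset.mem_range]
    refine ⟨?_, Nat.lt_succ_of_le ?_⟩
    · rcases lt_or_gt_of_ne ha0 with h | h
      · simp [Int.sign_eq_neg_one_of_neg h]
      · simp [Int.sign_eq_one_of_pos h]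
    · refine (padicValNat_le_nat_log _).trans ?_
      exact (Nat.log_anti_left one_lt_two hq.two_le).trans (Nat.log_mono_right (by omega))
  · intro a ha a' ha' haa
    simp only [Finset.coe_filter, Set.mem_ofPred_eq, Finset.mem_Icc] at ha ha'
    obtain ⟨-, -, A, E, hA, hE, h⟩ := ha
    obtain ⟨-, -, A', E', -, hE', h'⟩ := ha'
    obtain ⟨hs, hv⟩ := Prod.ext_iff.1 haa
    have h3 := natAbs_eq_of_zpow_eq hq hc0 (Int.natCast_dvd.2 hqc) hA hE hE' h h' hv
    rw [← Int.sign_mul_natAbs a, ← Int.sign_mul_natAbs a', h3]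
    simp only at hs
    rw [hs]

theorem nzRoots_X_sub_C_mul {g : ℤ[X]} (hm : g.Monic) (c : ℤ) :
    nzRoots ((X - C c) * g) = if c = 0 then nzRoots g else insert (c : ℂ) (nzRoots g) := by
  have hne : ((X - C c) * g).map (Int.castRingHom ℂ) ≠ 0 :=
    (((monic_X_sub_C c).mul hm).map _).ne_zero
  have h1 : (((X - C c) * g).map (Int.castRingHom ℂ)).roots.toFinset =
      insert (c : ℂ) (g.map (Int.castRingHom ℂ)).roots.toFinset := by
    rw [Polynomial.map_mul] at hne ⊢
    rw [roots_mul hne, Multiset.toFinset_add, Polynomial.map_sub, map_X, map_C, roots_X_sub_C,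
      Multiset.toFinset_singleton]
    rfl
  rw [nzRoots, h1, Finset.filter_insert, ← nzRoots]
  by_cases hc : c = 0 <;> simp [hc]

theorem coeff_cond_of_genDeg {g : ℤ[X]} (hm : g.Monic) (hi : Irreducible g)
    (hd : 2 ≤ g.natDegree) {c : ℤ} (hc : |c| ≠ 1) (h : GenDeg ((X - C c) * g)) :
    g.coeff 0 ∣ g.coeff 1 ^ 2 ∨ 2 ≤ |c| ∧ ∃ A E : ℤ, A ≠ 0 ∧ E ≠ 0 ∧
      (|g.coeff 0| : ℝ) ^ A = (|c| : ℝ) ^ E := by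
  have h0 := coeff_zero_ne_zero_of_irreducible hm hi hd
  obtain ⟨-, k, hk, hrel⟩ := h
  have hgr := nzRoots_of_irreducible hm hi hd
  have hg := fun k => coeff_zero_dvd_coeff_one_sq g hm hi h0 k
  rw [← hgr] at hg
  rw [nzRoots_X_sub_C_mul hm] at hk hrel
  rcases eq_or_ne c 0 with rfl | hc0
  · rw [if_pos rfl] at hk hrel
    exact Or.inl (hg k hk hrel)
  rw [if_neg hc0] at hk hrel
  have hcg : (c : ℂ) ∉ nzRoots g := by
    rw [hgr, mem_roots_toFinset_intCast hm]
    exact eval_ne_zero_of_irreducible hm hi hd c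
  rw [Finset.prod_insert hcg] at hrel
  rcases eq_or_ne (k c) 0 with hkc | hkc
  · rw [hkc, zpow_zero, one_mul] at hrel
    obtain ⟨z, hz, hkz⟩ := hk
    rcases Finset.mem_insert.1 hz with rfl | hz
    · exact absurd hkc hkz
    · exact Or.inl (hg k ⟨z, hz, hkz⟩ hrel)
  · have hc2 : 2 ≤ |c| := by
      have := abs_pos.2 hc0
      omega
    refine Or.inr ⟨hc2, abs_coeff_zero_zpow_eq g hm hi h0 k c (-k c) hc2 (neg_ne_zero.2 hkc) ?_⟩
    rw [← hgr, zpow_neg]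
    exact eq_inv_of_mul_eq_one_right hrel

/-- Monic irreducible polynomials `g` of degree `n` and Mahler measure at most `T` such that
`(X - c) * g` is generalized degenerate. -/
def linFactorSet (n : ℕ) (T : ℝ) (c : ℤ) : Set ℤ[X] :=
  {g | g ∈ mahlerSet n T ∧ Irreducible g ∧ GenDeg ((X - C c) * g)}

theorem ncard_linFactorSet_le {n : ℕ} (hn : 2 ≤ n) {T : ℝ} (hT : 1 ≤ T) {c : ℤ} (hc : |c| ≠ 1) :
    (linFactorSet n T c).Finite ∧ ((linFactorSet n T c).ncard : ℝ) ≤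
      18 * (n + 1) ^ 2 * (3 * 2 ^ n) ^ n * (T ^ (n - 1) * (1 + Real.log T) ^ 2) := by
  classical
  set B := ⌊2 ^ n * T⌋₊ with hB
  have h2n : (1 : ℝ) ≤ 2 ^ n := one_le_pow₀ (by norm_num)
  have hX : 1 ≤ 2 ^ n * T := one_le_mul_of_one_le_of_one_le h2n hT
  have hB1 : 1 ≤ B := Nat.floor_pos.2 hX
  have hBX : (B : ℝ) ≤ 2 ^ n * T := Nat.floor_le (by positivity)
  have hB1' : (1 : ℝ) ≤ B := by exact_mod_cast hB1
  have hlogT : 0 ≤ Real.log T := Real.log_nonneg hT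
  have hlogX : Real.log (2 ^ n * T) ≤ n + Real.log T := by
    rw [Real.log_mul (by positivity) (by positivity), Real.log_pow]
    have : Real.log 2 ≤ 1 := by linarith [Real.log_two_lt_d9]
    nlinarith
  set W := (n + 1 : ℝ) * (1 + Real.log T) with hW
  have hWX : 1 + Real.log (2 ^ n * T) ≤ W := by
    have : (0 : ℝ) ≤ n := Nat.cast_nonneg _
    nlinarith
  have hlogX0 : 0 ≤ Real.log (2 ^ n * T) := Real.log_nonneg hX
  let P : Finset (ℤ × ℤ) := dvdSqPairs B ∪ if 2 ≤ |c| then zpowPairs B c else ∅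
  have h1 : ((dvdSqPairs B).card : ℝ) ≤ 6 * (2 ^ n * T) * W ^ 2 := by
    refine (card_dvdSqPairs_le B).trans ?_
    have h3 : 1 + Real.log B ≤ W := by
      linarith [Real.log_le_log (by linarith) hBX]
    have h4 : 0 ≤ 1 + Real.log B := by linarith [Real.log_nonneg hB1']
    gcongr
  have h2 : (((if 2 ≤ |c| then zpowPairs B c else ∅ : Finset (ℤ × ℤ)).card : ℕ) : ℝ) ≤
      12 * (2 ^ n * T) * W ^ 2 := by
    split_ifs with h
    · refine (Nat.cast_le.2 (card_zpowPairs_le B h)).trans ?_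
      have h3 := natLog_two_floor_le hX
      rw [← hB] at h3
      push_cast
      calc (2 * ((Nat.log 2 B : ℝ) + 1) * (2 * B + 1))
          ≤ 2 * (2 * W) * (3 * (2 ^ n * T)) := by
            gcongr
            · linarith
            · linarith
        _ ≤ 12 * (2 ^ n * T) * W ^ 2 := by
          have : W ≤ W ^ 2 := by nlinarith
          nlinarith
    · simp only [Finset.card_empty, Nat.cast_zero]
      positivity
  have hP : (P.card : ℝ) ≤ 18 * (2 ^ n * T) * W ^ 2 := by
    have : (P.card : ℝ) ≤ (dvdSqPairs B).card +
        ((if 2 ≤ |c| then zpowPairs B c else ∅ : Finset (ℤ × ℤ)).card : ℕ) := by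
      exact_mod_cast Finset.card_union_le _ _
    linarith
  have key := ncard_mahlerSet_inter_le n hT (linFactorSet n T c) (fun g hg => hg.1) 2 hn
    (fun g => (g.coeff 0, g.coeff 1)) P ?_ ?_
  · refine ⟨key.1, key.2.trans ?_⟩
    refine (mul_le_mul_of_nonneg_right hP (by positivity)).trans ?_
    obtain ⟨m, rfl⟩ := Nat.exists_eq_add_of_le hn
    have e1 : 2 + m - 2 = m := by omega
    have e2 : 2 + m - 1 = m + 1 := by omega
    rw [e1, e2, hW, mul_pow _ T, mul_pow _ (1 + Real.log T)]
    set Y : ℝ := 3 * 2 ^ (2 + m) with hY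
    have hY1 : 1 ≤ Y := by linarith
    have hY2 : 2 ^ (2 + m) * Y ^ m ≤ Y ^ (2 + m) := by
      have : (2 : ℝ) ^ (2 + m) ≤ Y := by linarith
      calc (2 : ℝ) ^ (2 + m) * Y ^ m ≤ (Y * Y) * Y ^ m := by
            gcongr
            nlinarith
        _ = _ := by ring
    calc 18 * (2 ^ (2 + m) * T) * (((2 + m : ℕ) + 1 : ℝ) ^ 2 * (1 + Real.log T) ^ 2) * (Y ^ m * T ^ m)
        = 18 * ((2 + m : ℕ) + 1 : ℝ) ^ 2 * (2 ^ (2 + m) * Y ^ m) *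
          (T ^ (m + 1) * (1 + Real.log T) ^ 2) := by ring
      _ ≤ _ := by gcongr
  · rintro g ⟨⟨hm, hdeg, hM⟩, hi, hG⟩
    have hB2 : ∀ i, |g.coeff i| ≤ B := by
      intro i
      have h4 := (abs_coeff_le_intMahler hdeg.le i).trans
        (mul_le_mul_of_nonneg_left hM (by positivity))
      have h5 : (g.coeff i).natAbs ≤ B := by
        refine Nat.le_floor ?_
        rw [Nat.cast_natAbs]
        exact_mod_cast h4
      rw [Int.abs_eq_natAbs]
      exact_mod_cast h5
    have h0 := coeff_zero_ne_zero_of_irreducible hm hi (hdeg ▸ hn)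
    have hI : ∀ i, g.coeff i ∈ Finset.Icc (-(B : ℤ)) B := fun i =>
      Finset.mem_Icc.2 (abs_le.1 (hB2 i))
    rcases coeff_cond_of_genDeg hm hi (hdeg ▸ hn) hc hG with h | ⟨hc2, h⟩
    · refine Finset.mem_union_left _ (Finset.mem_filter.2 ⟨?_, h0, h⟩)
      exact Finset.mem_product.2 ⟨hI 0, hI 1⟩
    · refine Finset.mem_union_right _ ?_
      rw [if_pos hc2]
      exact Finset.mem_product.2 ⟨Finset.mem_filter.2 ⟨hI 0, h0, h⟩, hI 1⟩
  · intro f _ g _ hfg i hi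
    obtain ⟨e0, e1⟩ := Prod.ext_iff.1 hfg
    interval_cases i
    · exact e0
    · exact e1

theorem sum_inv_max_le (N : ℕ) :
    ∑ c ∈ Finset.Icc (-(N : ℤ)) N, (max 1 |(c : ℝ)|)⁻¹ ≤ 3 + 2 * Real.log N := by
  rw [Finset.sum_Icc_of_even_eq_range (fun c => by simp) N, Finset.sum_range_succ']
  have h : ∑ r ∈ Finset.range N, (max 1 |(((r + 1 : ℕ) : ℤ) : ℝ)|)⁻¹ ≤ 1 + Real.log N := by
    refine le_trans (le_of_eq ?_) (harmonic_le_one_add_log N)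
    rw [harmonic]
    push_cast
    refine Finset.sum_congr rfl fun i _ => ?_
    have : (0 : ℝ) ≤ i := Nat.cast_nonneg _
    rw [abs_of_nonneg (by linarith), max_eq_right (by linarith)]
  simp only [nsmul_eq_mul, Nat.cast_zero, Int.cast_zero, abs_zero, Nat.cast_ofNat]
  rw [max_eq_left zero_le_one, inv_one]
  linarith

theorem ncard_linear_mul_le {n : ℕ} (hn : 2 ≤ n) {T : ℝ} (hT : 1 ≤ T) :
    {f : ℤ[X] | f.natDegree = n + 1 ∧ intMahler f ≤ T ∧ GenDeg f ∧ ∃ (c : ℤ) (g : ℤ[X]),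
      |c| ≠ 1 ∧ g.Monic ∧ Irreducible g ∧ f = (X - C c) * g}.Finite ∧
    ({f : ℤ[X] | f.natDegree = n + 1 ∧ intMahler f ≤ T ∧ GenDeg f ∧ ∃ (c : ℤ) (g : ℤ[X]),
      |c| ≠ 1 ∧ g.Monic ∧ Irreducible g ∧ f = (X - C c) * g}.ncard : ℝ) ≤
      54 * (n + 1) ^ 2 * (3 * 2 ^ n) ^ n * (T ^ (n - 1) * (1 + Real.log T) ^ 3) := by
  set S := {f : ℤ[X] | f.natDegree = n + 1 ∧ intMahler f ≤ T ∧ GenDeg f ∧ ∃ (c : ℤ) (g : ℤ[X]),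
      |c| ≠ 1 ∧ g.Monic ∧ Irreducible g ∧ f = (X - C c) * g}
  set N := ⌊T⌋₊ with hN
  have hN1 : 1 ≤ N := Nat.floor_pos.2 hT
  have hN1' : (1 : ℝ) ≤ N := by exact_mod_cast hN1
  have hNT : (N : ℝ) ≤ T := Nat.floor_le (by positivity)
  have hlogT : 0 ≤ Real.log T := Real.log_nonneg hT
  let I : Finset ℤ := (Finset.Icc (-(N : ℤ)) N).filter fun c => |c| ≠ 1
  let F : ℤ → Set ℤ[X] := fun c =>
    (fun g => (X - C c) * g) '' linFactorSet n (T / max 1 |(c : ℝ)|) c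
  set K : ℝ := 18 * (n + 1) ^ 2 * (3 * 2 ^ n) ^ n * (T ^ (n - 1) * (1 + Real.log T) ^ 2) with hK
  have hF : ∀ c ∈ I, (F c).Finite ∧ ((F c).ncard : ℝ) ≤ K * (max 1 |(c : ℝ)|)⁻¹ := by
    intro c hc
    obtain ⟨hcN, hc1⟩ := Finset.mem_filter.1 hc
    have hcN' : |(c : ℝ)| ≤ N := by exact_mod_cast abs_le.2 (Finset.mem_Icc.1 hcN)
    set x := max 1 |(c : ℝ)| with hx
    have hx1 : 1 ≤ x := le_max_left _ _
    have hxT : x ≤ T := (max_le hN1' hcN').trans hNT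
    have hTx : 1 ≤ T / x := (one_le_div (by positivity)).2 hxT
    have h := ncard_linFactorSet_le hn hTx hc1
    refine ⟨h.1.image _, (Nat.cast_le.2 (Set.ncard_image_le h.1)).trans (h.2.trans ?_)⟩
    have h1 : (T / x) ^ (n - 1) ≤ T ^ (n - 1) * x⁻¹ := by
      rw [div_pow, div_eq_mul_inv]
      refine mul_le_mul_of_nonneg_left (inv_anti₀ (by positivity) ?_) (by positivity)
      exact le_self_pow₀ hx1 (by omega)
    have h2 : 1 + Real.log (T / x) ≤ 1 + Real.log T := by
      have := Real.log_le_log (by positivity) (div_le_self (by positivity) hx1 : T / x ≤ T)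
      linarith
    have h3 : 0 ≤ 1 + Real.log (T / x) := by linarith [Real.log_nonneg hTx]
    calc _ ≤ 18 * (n + 1 : ℝ) ^ 2 * (3 * 2 ^ n) ^ n *
          ((T ^ (n - 1) * x⁻¹) * (1 + Real.log T) ^ 2) := by gcongr
      _ = _ := by rw [hK]; ring
  have hSF : S ⊆ ⋃ c ∈ I, F c := by
    rintro f ⟨hdeg, hM, hG, c, g, hc, hm, hi, rfl⟩
    rw [(monic_X_sub_C c).natDegree_mul hm, natDegree_X_sub_C] at hdeg
    have hM1 := one_le_intMahler hm.ne_zero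
    rw [intMahler_mul, intMahler_X_sub_C] at hM
    have hx1 : 1 ≤ max 1 |(c : ℝ)| := le_max_left _ _
    have hcT : |(c : ℝ)| ≤ T := by
      have : |(c : ℝ)| ≤ max 1 |(c : ℝ)| := le_max_right _ _
      nlinarith
    refine Set.mem_biUnion (x := c) (Finset.mem_filter.2 ⟨?_, hc⟩)
      ⟨g, ⟨⟨hm, by omega, ?_⟩, hi, hG⟩, rfl⟩
    · rw [Finset.mem_Icc, ← abs_le, Int.abs_eq_natAbs]
      have : c.natAbs ≤ N := by
        refine Nat.le_floor ?_
        rw [Nat.cast_natAbs]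
        exact_mod_cast hcT
      exact_mod_cast this
    · rw [le_div_iff₀ (by positivity), mul_comm]
      exact hM
  have hfin : (⋃ c ∈ I, F c).Finite := I.finite_toSet.biUnion fun c hc => (hF c hc).1
  refine ⟨hfin.subset hSF, ?_⟩
  have h1 : (S.ncard : ℝ) ≤ ∑ c ∈ I, ((F c).ncard : ℝ) := by
    exact_mod_cast (Set.ncard_le_ncard hSF hfin).trans (Finset.set_ncard_biUnion_le I F)
  have hK0 : 0 ≤ K := by positivity
  calc (S.ncard : ℝ) ≤ ∑ c ∈ I, K * (max 1 |(c : ℝ)|)⁻¹ :=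
        h1.trans (Finset.sum_le_sum fun c hc => (hF c hc).2)
    _ ≤ ∑ c ∈ Finset.Icc (-(N : ℤ)) N, K * (max 1 |(c : ℝ)|)⁻¹ :=
        Finset.sum_le_sum_of_subset_of_nonneg (Finset.filter_subset _ _)
          fun _ _ _ => by positivity
    _ ≤ K * (3 * (1 + Real.log T)) := by
        rw [← Finset.mul_sum]
        refine mul_le_mul_of_nonneg_left ((sum_inv_max_le N).trans ?_) hK0
        have := Real.log_le_log (by positivity) hNT
        linarith
    _ = _ := by rw [hK]; ring

/-- Monic integer polynomials of degree `n` and height at most `H`. -/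
def heightSet (n : ℕ) (H : ℤ) : Set ℤ[X] := {f | f.Monic ∧ f.natDegree = n ∧ HeightLe f H}

theorem ncard_heightSet_inter_le {n : ℕ} {H : ℤ} (hH : 1 ≤ H) {S : Set ℤ[X]}
    (hS : S ⊆ heightSet n H) (m : ℕ) (hmn : m ≤ n)
    (hinj : ∀ f ∈ S, ∀ g ∈ S, (∀ j, m ≤ j → f.coeff j = g.coeff j) → f = g) :
    S.Finite ∧ (S.ncard : ℝ) ≤ (3 * H) ^ (n - m) := by
  have key := ncard_le_of_key S m (n - m) (fun _ => ()) {()} (fun _ => H.toNat) (by simp) ?_ ?_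
  · refine ⟨key.1, (Nat.cast_le.2 key.2).trans ?_⟩
    rw [Finset.card_singleton, one_mul, Finset.prod_const, Finset.card_range]
    push_cast
    refine pow_le_pow_left₀ (by positivity) ?_ _
    have h1 : ((H.toNat : ℤ) : ℝ) = H := by rw [Int.toNat_of_nonneg (by omega)]
    have h2 : (1 : ℝ) ≤ H := by exact_mod_cast hH
    rw [Int.cast_natCast] at h1
    linarith
  · intro f hf j _
    have := (hS hf).2.2 (j + m)
    omega
  · intro f hf g hg _ h
    refine hinj f hf g hg fun j hj => ?_
    obtain ⟨hfm, hfn, -⟩ := hS hf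
    obtain ⟨hgm, hgn, -⟩ := hS hg
    rcases lt_trichotomy j n with hjn | rfl | hjn
    · have := h (j - m) (by omega)
      rwa [Nat.sub_add_cancel hj] at this
    · have h1 := hfm.coeff_natDegree
      have h2 := hgm.coeff_natDegree
      rw [hfn] at h1
      rw [hgn] at h2
      rw [h1, h2]
    · rw [coeff_eq_zero_of_natDegree_lt (hfn ▸ hjn), coeff_eq_zero_of_natDegree_lt (hgn ▸ hjn)]

theorem finite_heightSet (n : ℕ) {H : ℤ} (hH : 1 ≤ H) : (heightSet n H).Finite :=
  (ncard_heightSet_inter_le hH subset_rfl 0 (Nat.zero_le n)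
    fun _ _ _ _ h => Polynomial.ext fun j => h j (Nat.zero_le j)).1

theorem exists_factorization_of_not_irreducible {f : ℤ[X]} (hf : f.Monic) (hd : 5 ≤ f.natDegree)
    (hi : ¬ Irreducible f) :
    (∃ g h : ℤ[X], g.Monic ∧ h.Monic ∧ f = g * h ∧ 2 ≤ g.natDegree ∧ 2 ≤ h.natDegree) ∨
      ∃ (c : ℤ) (g : ℤ[X]), g.Monic ∧ Irreducible g ∧ f = (X - C c) * g := by
  have split : ∀ {f : ℤ[X]}, f.Monic → 4 ≤ f.natDegree → ¬ Irreducible f →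
      ∃ a b : ℤ[X], a.Monic ∧ b.Monic ∧ f = a * b ∧ 2 ≤ a.natDegree ∧ 1 ≤ b.natDegree := by
    intro f hf hd hi
    have hf1 : f ≠ 1 := by rintro rfl; simp at hd
    rw [hf.irreducible_iff_natDegree'] at hi
    push Not at hi
    obtain ⟨a, b, ha, hb, rfl, hab⟩ := hi hf1
    rw [ha.natDegree_mul hb, Finset.mem_Ioc] at hab
    rw [ha.natDegree_mul hb] at hd
    exact ⟨a, b, ha, hb, rfl, by omega, by omega⟩
  obtain ⟨a, b, ha, hb, rfl, ha2, hb1⟩ := split hf (by omega) hi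
  rw [ha.natDegree_mul hb] at hd
  rcases eq_or_lt_of_le hb1 with hb1 | hb1
  · by_cases hia : Irreducible a
    · refine Or.inr ⟨-b.coeff 0, a, ha, hia, ?_⟩
      have h := hb.eq_X_add_C hb1.symm
      rw [C_neg, sub_neg_eq_add, ← h, mul_comm]
    · obtain ⟨r, s, hr, hs, rfl, hr2, hs1⟩ := split ha (by omega) hia
      refine Or.inl ⟨r, s * b, hr, hs.mul hb, by ring, hr2, ?_⟩
      rw [hs.natDegree_mul hb]
      omega
  · exact Or.inl ⟨a, b, ha, hb, rfl, ha2, hb1⟩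

/-- The elements of `Mset p H` without the roots `±1` and with constant term different
from `±1`. -/
def sporadicSet (p : ℕ) (H : ℤ) : Set ℤ[X] :=
  {f | f ∈ Mset p H ∧ f.eval 1 ≠ 0 ∧ f.eval (-1) ≠ 0 ∧ |f.coeff 0| ≠ 1}

theorem ncard_sporadicSet_le {p : ℕ} (hp : p.Prime) (h5 : 5 ≤ p) :
    ∃ C : ℝ, 0 ≤ C ∧ ∀ H : ℤ, 3 ≤ H →
      ((sporadicSet p H).ncard : ℝ) ≤ C * ((H : ℝ) ^ (p - 2) * Real.log H ^ 3) := by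
  obtain ⟨n, rfl⟩ : ∃ n, p = n + 1 := ⟨p - 1, by omega⟩
  set p := n + 1 with hpn
  have hn2 : 2 ≤ n := by omega
  set K₁ : ℝ := (3 * 2 ^ p) ^ p
  set K₂ : ℝ := p * (6 * 2 ^ p) ^ p
  set K₃ : ℝ := 54 * (n + 1) ^ 2 * (3 * 2 ^ n) ^ n
  set Q : ℝ := ((p : ℝ) + 1) ^ (p - 2)
  refine ⟨K₁ + K₂ * (Q * (2 * (p + 2))) + K₃ * (Q * (p + 2) ^ 3), by positivity, ?_⟩
  intro H hH
  have hH' : (3 : ℝ) ≤ H := by exact_mod_cast hH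
  have hH1 : 1 ≤ H := by omega
  have hlog : 1 ≤ Real.log H := by
    rw [Real.le_log_iff_exp_le (by positivity)]
    linarith [Real.exp_one_lt_d9]
  set T : ℝ := (p + 1) * H with hT
  have hp0 : (0 : ℝ) ≤ p := Nat.cast_nonneg _
  have hT1 : 1 ≤ T := by nlinarith
  have hlogT : 1 + Real.log T ≤ (p + 2) * Real.log H := by
    rw [hT, Real.log_mul (by positivity) (by positivity)]
    have := Real.log_le_sub_one_of_pos (by positivity : (0 : ℝ) < p + 1)
    nlinarith
  have hlogT0 : 0 ≤ Real.log T := Real.log_nonneg hT1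
  have hTQ : T ^ (p - 2) = Q * (H : ℝ) ^ (p - 2) := mul_pow _ _ _
  set S₁ := {f | f ∈ Mset p H ∧ Irreducible f ∧ |f.coeff 0| ≠ 1} with hS₁
  set S₂ := {f : ℤ[X] | f.natDegree = p ∧ intMahler f ≤ T ∧ ∃ g h : ℤ[X], g.Monic ∧ h.Monic ∧
      f = g * h ∧ 2 ≤ g.natDegree ∧ 2 ≤ h.natDegree} with hS₂
  set S₃ := {f : ℤ[X] | f.natDegree = n + 1 ∧ intMahler f ≤ T ∧ GenDeg f ∧
      ∃ (c : ℤ) (g : ℤ[X]), |c| ≠ 1 ∧ g.Monic ∧ Irreducible g ∧ f = (X - C c) * g} with hS₃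
  have hf₁ : S₁.Finite := (finite_heightSet p hH1).subset
    fun f hf => ⟨hf.1.1, hf.1.2.1, hf.1.2.2.1⟩
  have b₁ : (S₁.ncard : ℝ) ≤ K₁ * (H : ℝ) ^ (p - 2) := ncard_irreducible_le hp h5 hH1
  obtain ⟨hf₂, b₂⟩ : S₂.Finite ∧ (S₂.ncard : ℝ) ≤ K₂ * (T ^ (p - 2) * (2 * Real.log T + 1)) :=
    ncard_mul_two_le p hT1
  obtain ⟨hf₃, b₃⟩ : S₃.Finite ∧
      (S₃.ncard : ℝ) ≤ K₃ * (T ^ (n - 1) * (1 + Real.log T) ^ 3) := ncard_linear_mul_le hn2 hT1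
  have hsub : sporadicSet p H ⊆ S₁ ∪ (S₂ ∪ S₃) := by
    rintro f ⟨hf, he1, he2, h0⟩
    have hfM : intMahler f ≤ T := intMahler_le_of_heightLe hf.2.1.le hf.2.2.1
    by_cases hi : Irreducible f
    · exact Or.inl ⟨hf, hi, h0⟩
    · right
      rcases exists_factorization_of_not_irreducible hf.1 (hf.2.1 ▸ h5) hi with h | ⟨c, g, hm, hg, h⟩
      · exact Or.inl ⟨hf.2.1, hfM, h⟩
      · refine Or.inr ⟨hf.2.1, hfM, hf.2.2.2, c, g, ?_, hm, hg, h⟩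
        intro hc
        have hfc : f.eval c = 0 := by rw [h]; simp
        rcases eq_or_eq_neg_of_abs_eq hc with rfl | rfl
        · exact he1 hfc
        · exact he2 hfc
  have hcard : ((sporadicSet p H).ncard : ℝ) ≤ S₁.ncard + (S₂.ncard + S₃.ncard) := by
    have h1 := Set.ncard_le_ncard hsub (hf₁.union (hf₂.union hf₃))
    have h2 := Set.ncard_union_le S₁ (S₂ ∪ S₃)
    have h3 := Set.ncard_union_le S₂ S₃
    exact_mod_cast (by omega : (sporadicSet p H).ncard ≤ S₁.ncard + (S₂.ncard + S₃.ncard))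
  have e : n - 1 = p - 2 := by omega
  rw [e] at b₃
  rw [hTQ] at b₂ b₃
  set L := Real.log H
  have hL3 : L ≤ L ^ 3 := le_self_pow₀ hlog (by norm_num)
  have hHp : (0 : ℝ) ≤ (H : ℝ) ^ (p - 2) := by positivity
  have c₁ : K₁ * (H : ℝ) ^ (p - 2) ≤ K₁ * ((H : ℝ) ^ (p - 2) * L ^ 3) := by
    refine mul_le_mul_of_nonneg_left (le_mul_of_one_le_right hHp ?_) (by positivity)
    linarith
  have c₂ : K₂ * (Q * (H : ℝ) ^ (p - 2) * (2 * Real.log T + 1)) ≤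
      K₂ * (Q * (H : ℝ) ^ (p - 2) * (2 * (p + 2) * L ^ 3)) := by
    refine mul_le_mul_of_nonneg_left (mul_le_mul_of_nonneg_left ?_ (by positivity)) (by positivity)
    nlinarith
  have c₃ : K₃ * (Q * (H : ℝ) ^ (p - 2) * (1 + Real.log T) ^ 3) ≤
      K₃ * (Q * (H : ℝ) ^ (p - 2) * ((p + 2) * L) ^ 3) := by
    gcongr
  calc _ ≤ K₁ * ((H : ℝ) ^ (p - 2) * L ^ 3) +
        (K₂ * (Q * (H : ℝ) ^ (p - 2) * (2 * (p + 2) * L ^ 3)) +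
          K₃ * (Q * (H : ℝ) ^ (p - 2) * ((p + 2) * L) ^ 3)) := by linarith
    _ = _ := by ring

/-- The convex body `|x_i| ≤ R`, `|∑ x_i| ≤ R`. -/
def sumBody (m : ℕ) (R : ℝ) : Set (Fin m → ℝ) := {x | (∀ i, |x i| ≤ R) ∧ |∑ i, x i| ≤ R}

open scoped Pointwise in
theorem volume_sumBody (m : ℕ) {R : ℝ} (hR : 0 < R) :
    (volume (sumBody m R)).toReal = nu (m + 1) * R ^ m := by
  have h1 : sumBody m R = R • sumBody m 1 := by
    ext x
    rw [Set.mem_smul_set_iff_inv_smul_mem₀ hR.ne']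
    simp only [sumBody, Set.mem_ofPred_eq, Pi.smul_apply, smul_eq_mul, ← Finset.mul_sum, abs_mul,
      abs_inv, abs_of_pos hR]
    simp only [inv_mul_le_iff₀ hR, mul_one]
  have h2 : nu (m + 1) = (volume (sumBody m 1)).toReal := rfl
  rw [h1, Measure.addHaar_smul, h2, ENNReal.toReal_mul, Module.finrank_fin_fun,
    ENNReal.toReal_ofReal (abs_nonneg _), abs_of_nonneg (by positivity), mul_comm]

theorem volume_sumBody_ne_top (m : ℕ) (R : ℝ) : volume (sumBody m R) ≠ ⊤ := by
  have h : sumBody m R ⊆ Set.Icc (fun _ => -R) (fun _ => R) := fun x hx =>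
    ⟨fun i => (abs_le.1 (hx.1 i)).1, fun i => (abs_le.1 (hx.1 i)).2⟩
  exact ((measure_mono h).trans_lt (isCompact_Icc.measure_lt_top)).ne

theorem nu_nonneg (n : ℕ) : 0 ≤ nu n := ENNReal.toReal_nonneg

/-- The unit cube with lower corner `x`. -/
def unitCube {m : ℕ} (x : Fin m → ℤ) : Set (Fin m → ℝ) :=
  Set.univ.pi fun i => Set.Ico (x i : ℝ) (x i + 1)

theorem mem_unitCube {m : ℕ} {x : Fin m → ℤ} {y : Fin m → ℝ} :
    y ∈ unitCube x ↔ ∀ i, ⌊y i⌋ = x i := by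
  simp [unitCube, Int.floor_eq_iff]

theorem volume_biUnion_unitCube {m : ℕ} (s : Finset (Fin m → ℤ)) :
    volume (⋃ x ∈ s, unitCube x) = s.card := by
  rw [measure_biUnion_finset]
  · have h : ∀ x ∈ s, volume (unitCube x) = 1 := by
      intro x _
      rw [unitCube, Real.volume_pi_Ico]
      simp
    rw [Finset.sum_congr rfl h]
    simp
  · intro x _ x' _ hne
    refine Set.disjoint_left.2 fun y hy hy' => hne (funext fun i => ?_)
    rw [← mem_unitCube.1 hy i, mem_unitCube.1 hy' i]
  · intro x _
    exact MeasurableSet.univ_pi fun i => measurableSet_Ico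

/-- The integer points `x` with `|x_i| ≤ H` and `|1 + ∑ x_i| ≤ H`. -/
def latticeSet (m : ℕ) (H : ℤ) : Set (Fin m → ℤ) :=
  {x | (∀ i, |x i| ≤ H) ∧ |1 + ∑ i, x i| ≤ H}

theorem finite_box (m : ℕ) (H : ℤ) : {x : Fin m → ℤ | ∀ i, |x i| ≤ H}.Finite := by
  refine (Fintype.piFinset fun _ : Fin m => Finset.Icc (-H) H).finite_toSet.subset fun x hx => ?_
  rw [Finset.mem_coe, Fintype.mem_piFinset]
  exact fun i => Finset.mem_Icc.2 (abs_le.1 (hx i))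

theorem ncard_box (m : ℕ) {H : ℤ} (hH : 0 ≤ H) :
    ({x : Fin m → ℤ | ∀ i, |x i| ≤ H}.ncard : ℝ) = (2 * H + 1) ^ m := by
  have h : {x : Fin m → ℤ | ∀ i, |x i| ≤ H} =
      (Fintype.piFinset fun _ : Fin m => Finset.Icc (-H) H : Finset (Fin m → ℤ)) := by
    ext x
    simp [abs_le, Pi.le_def, forall_and]
  rw [h, Set.ncard_coe_finset, Fintype.card_piFinset, Finset.prod_const, Finset.card_univ,
    Fintype.card_fin, Int.card_Icc, Nat.cast_pow]
  congr 1
  have : ((H + 1 - -H).toNat : ℤ) = 2 * H + 1 := by omega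
  exact_mod_cast this

theorem finite_latticeSet (m : ℕ) (H : ℤ) : (latticeSet m H).Finite :=
  (finite_box m H).subset fun _ hx => hx.1

theorem abs_sum_floor_le {m : ℕ} (y : Fin m → ℝ) :
    |1 + ∑ i, (⌊y i⌋ : ℝ) - ∑ i, y i| ≤ m + 1 := by
  have h1 : ∑ i, y i - ∑ i, (⌊y i⌋ : ℝ) = ∑ i, Int.fract (y i) := by
    rw [← Finset.sum_sub_distrib]
    rfl
  have h2 : 0 ≤ ∑ i, Int.fract (y i) := Finset.sum_nonneg fun i _ => Int.fract_nonneg _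
  have h3 : ∑ i, Int.fract (y i) ≤ m := by
    refine (Finset.sum_le_card_nsmul _ _ 1 fun i _ => (Int.fract_lt_one _).le).trans ?_
    simp
  rw [abs_le]
  constructor <;> linarith

theorem ncard_latticeSet_le (m : ℕ) {H : ℤ} (hH : 0 ≤ H) :
    ((latticeSet m H).ncard : ℝ) ≤ nu (m + 1) * (H + (m + 1)) ^ m := by
  have hH' : (0 : ℝ) ≤ H := by exact_mod_cast hH
  have hm : (0 : ℝ) ≤ m := Nat.cast_nonneg _
  set s := (finite_latticeSet m H).toFinset
  have hsub : (⋃ x ∈ s, unitCube x) ⊆ sumBody m (H + (m + 1)) := by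
    intro y hy
    simp only [Set.mem_iUnion] at hy
    obtain ⟨x, hx, hxy⟩ := hy
    obtain ⟨hx1, hx2⟩ := (finite_latticeSet m H).mem_toFinset.1 hx
    rw [mem_unitCube] at hxy
    constructor
    · intro i
      have h1 : |(⌊y i⌋ : ℝ)| ≤ H := by
        rw [hxy i]
        exact_mod_cast hx1 i
      have h2 := Int.floor_le (y i)
      have h3 := Int.lt_floor_add_one (y i)
      rw [abs_le] at h1 ⊢
      constructor <;> linarith
    · have h1 : |1 + ∑ i, (⌊y i⌋ : ℝ)| ≤ H := by
        simp only [hxy]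
        exact_mod_cast hx2
      have h2 := abs_sum_floor_le y
      rw [abs_le] at h1 h2 ⊢
      constructor <;> linarith
  have h := ENNReal.toReal_mono (volume_sumBody_ne_top m _) (measure_mono (μ := volume) hsub)
  rw [volume_biUnion_unitCube, volume_sumBody m (by positivity), ENNReal.toReal_natCast,
    ← Set.ncard_eq_toFinset_card _ (finite_latticeSet m H)] at h
  exact h

theorem le_ncard_latticeSet (m : ℕ) {H : ℤ} {R : ℝ} (hR : 0 < R) (hRH : R + (m + 1) ≤ H) :
    nu (m + 1) * R ^ m ≤ (latticeSet m H).ncard := by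
  have hm : (0 : ℝ) ≤ m := Nat.cast_nonneg _
  set s := (finite_latticeSet m H).toFinset
  have hsub : sumBody m R ⊆ ⋃ x ∈ s, unitCube x := by
    rintro y ⟨hy1, hy2⟩
    simp only [Set.mem_iUnion]
    refine ⟨fun i => ⌊y i⌋, (finite_latticeSet m H).mem_toFinset.2 ⟨fun i => ?_, ?_⟩,
      mem_unitCube.2 fun i => rfl⟩
    · have h1 := hy1 i
      have h2 := Int.floor_le (y i)
      have h3 := Int.lt_floor_add_one (y i)
      have h4 : |(⌊y i⌋ : ℝ)| ≤ H := by
        rw [abs_le] at h1 ⊢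
        constructor <;> linarith
      exact_mod_cast h4
    · have h2 := abs_sum_floor_le y
      have h4 : |1 + ∑ i, (⌊y i⌋ : ℝ)| ≤ H := by
        rw [abs_le] at h2 hy2 ⊢
        constructor <;> linarith
      exact_mod_cast h4
  have hfin : volume (⋃ x ∈ s, unitCube x) ≠ ⊤ := by
    rw [volume_biUnion_unitCube]
    exact ENNReal.natCast_ne_top _
  have h := ENNReal.toReal_mono hfin (measure_mono (μ := volume) hsub)
  rw [volume_biUnion_unitCube, volume_sumBody m hR, ENNReal.toReal_natCast,
    ← Set.ncard_eq_toFinset_card _ (finite_latticeSet m H)] at h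
  exact h

theorem abs_ncard_latticeSet_sub_le {m : ℕ} (hm : 1 ≤ m) :
    ∃ C : ℝ, 0 ≤ C ∧ ∀ H : ℤ, 1 ≤ H →
      |((latticeSet m H).ncard : ℝ) - nu (m + 1) * (H : ℝ) ^ m| ≤ C * (H : ℝ) ^ (m - 1) := by
  have hν := nu_nonneg (m + 1)
  set a : ℝ := m + 1 with ha
  have ha0 : 0 ≤ a := by positivity
  refine ⟨nu (m + 1) * (a * m * (1 + a) ^ (m - 1)), by positivity, fun H hH => ?_⟩
  have hH' : (1 : ℝ) ≤ H := by exact_mod_cast hH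
  have hpow : ∀ {x y : ℝ}, 0 ≤ x → x ≤ y → y ≤ (1 + a) * H → y - x ≤ a →
      nu (m + 1) * y ^ m - nu (m + 1) * x ^ m ≤
        nu (m + 1) * (a * m * (1 + a) ^ (m - 1)) * (H : ℝ) ^ (m - 1) := by
    intro x y hx hxy hy hyx
    have h1 := (le_abs_self _).trans (abs_pow_sub_pow_le y x m)
    rw [abs_of_nonneg (hx.trans hxy), abs_of_nonneg hx, max_eq_left hxy,
      abs_of_nonneg (sub_nonneg.2 hxy)] at h1
    rw [← mul_sub, mul_assoc, mul_assoc, ← mul_pow]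
    refine mul_le_mul_of_nonneg_left (h1.trans ?_) hν
    have : 0 ≤ y := hx.trans hxy
    gcongr
  have hup := ncard_latticeSet_le m (H := H) (by omega)
  have h1 := hpow (x := H) (y := H + a) (by linarith) (by linarith) (by nlinarith) (by linarith)
  have hlow : nu (m + 1) * (max 0 (H - a)) ^ m ≤ (latticeSet m H).ncard := by
    rcases le_or_gt ((H : ℝ) - a) 0 with h | h
    · rw [max_eq_left h, zero_pow (by omega), mul_zero]
      exact Nat.cast_nonneg _
    · rw [max_eq_right h.le]
      exact le_ncard_latticeSet m h (by linarith)
  have h2 := hpow (x := max 0 (H - a)) (y := H) (le_max_left _ _)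
    (max_le (by linarith) (by linarith)) (by nlinarith)
    (by linarith [le_max_right 0 ((H : ℝ) - a)])
  rw [abs_le]
  constructor <;> linarith

/-- The monic polynomial of degree `m + 1` with constant term `a` whose coefficients in degrees
`1, …, m` are given by `x`. -/
noncomputable def monicOfCoeffs {m : ℕ} (a : ℤ) (x : Fin m → ℤ) : ℤ[X] :=
  X ^ (m + 1) + ∑ j : Fin m, C (x j) * X ^ ((j : ℕ) + 1) + C a

theorem coeff_zero_monicOfCoeffs {m : ℕ} (a : ℤ) (x : Fin m → ℤ) :
    (monicOfCoeffs a x).coeff 0 = a := by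
  simp [monicOfCoeffs, coeff_X_pow, finsetSum_coeff]

theorem coeff_succ_monicOfCoeffs {m : ℕ} (a : ℤ) (x : Fin m → ℤ) (i : ℕ) :
    (monicOfCoeffs a x).coeff (i + 1) =
      if h : i < m then x ⟨i, h⟩ else if i = m then 1 else 0 := by
  have h1 : (monicOfCoeffs a x).coeff (i + 1) =
      (if i = m then 1 else 0) + ∑ j : Fin m, if i = j then x j else 0 := by
    rw [monicOfCoeffs, coeff_add, coeff_C_succ]
    simp [coeff_X_pow, finsetSum_coeff]
  rw [h1]
  split_ifs with hm h h
  · omega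
  · rw [Finset.sum_eq_zero, add_zero]
    intro j _
    rw [if_neg]
    have := j.2
    omega
  · rw [zero_add, Finset.sum_eq_single ⟨i, h⟩]
    · simp
    · intro j _ hj
      rw [if_neg]
      rintro rfl
      exact hj rfl
    · simp
  · rw [Finset.sum_eq_zero, add_zero]
    intro j _
    rw [if_neg]
    have := j.2
    omega

theorem coeff_fin_monicOfCoeffs {m : ℕ} (a : ℤ) (x : Fin m → ℤ) (i : Fin m) :
    (monicOfCoeffs a x).coeff (i + 1) = x i := by
  rw [coeff_succ_monicOfCoeffs, dif_pos i.2]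

theorem natDegree_monicOfCoeffs {m : ℕ} (a : ℤ) (x : Fin m → ℤ) :
    (monicOfCoeffs a x).natDegree = m + 1 := by
  refine natDegree_eq_of_le_of_coeff_ne_zero ?_ ?_
  · rw [natDegree_le_iff_coeff_eq_zero]
    intro N hN
    obtain ⟨i, rfl⟩ : ∃ i, N = i + 1 := ⟨N - 1, by omega⟩
    rw [coeff_succ_monicOfCoeffs, dif_neg (by omega), if_neg (by omega)]
  · rw [coeff_succ_monicOfCoeffs, dif_neg (by omega), if_pos rfl]
    exact one_ne_zero

theorem monic_monicOfCoeffs {m : ℕ} (a : ℤ) (x : Fin m → ℤ) : (monicOfCoeffs a x).Monic := by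
  rw [Monic, leadingCoeff, natDegree_monicOfCoeffs, coeff_succ_monicOfCoeffs,
    dif_neg (by omega), if_pos rfl]

theorem eq_monicOfCoeffs {m : ℕ} {f : ℤ[X]} (hm : f.Monic) (hd : f.natDegree = m + 1) :
    f = monicOfCoeffs (f.coeff 0) fun i : Fin m => f.coeff (i + 1) := by
  refine monic_ext_of_coeff_eq hm (monic_monicOfCoeffs _ _) hd (natDegree_monicOfCoeffs _ _) ?_
  intro i hi
  rcases i with - | i
  · rw [coeff_zero_monicOfCoeffs]
  · rw [coeff_succ_monicOfCoeffs, dif_pos (Nat.lt_of_succ_lt_succ hi)]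

theorem eval_monicOfCoeffs {m : ℕ} (a : ℤ) (x : Fin m → ℤ) (c : ℤ) :
    (monicOfCoeffs a x).eval c = c ^ (m + 1) + ∑ j : Fin m, x j * c ^ ((j : ℕ) + 1) + a := by
  simp [monicOfCoeffs, eval_finsetSum]

theorem ncard_heightSet_coeff_zero_eq {m : ℕ} {H : ℤ} (hH : 1 ≤ H) (φ : (Fin m → ℤ) → ℤ) :
    {f | f ∈ heightSet (m + 1) H ∧ f.coeff 0 = φ fun i => f.coeff (i + 1)}.ncard =
      {x : Fin m → ℤ | (∀ i, |x i| ≤ H) ∧ |φ x| ≤ H}.ncard := by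
  have hinj : Function.Injective fun x : Fin m → ℤ => monicOfCoeffs (φ x) x := by
    intro x y hxy
    funext i
    rw [← coeff_fin_monicOfCoeffs (φ x) x i, ← coeff_fin_monicOfCoeffs (φ y) y i]
    exact congrArg (fun f : ℤ[X] => f.coeff (i + 1)) hxy
  rw [← Set.ncard_image_of_injective _ hinj]
  congr 1
  ext f
  constructor
  · rintro ⟨⟨hm, hd, hh⟩, h0⟩
    refine ⟨fun i => f.coeff (i + 1), ⟨fun i => hh _, h0 ▸ hh 0⟩, ?_⟩
    simp only
    rw [← h0]
    exact (eq_monicOfCoeffs hm hd).symm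
  · rintro ⟨x, ⟨hx, hφ⟩, rfl⟩
    refine ⟨⟨monic_monicOfCoeffs _ _, natDegree_monicOfCoeffs _ _, fun i => ?_⟩, ?_⟩
    · rcases i with - | i
      · simpa only [coeff_zero_monicOfCoeffs] using hφ
      · simp only [coeff_succ_monicOfCoeffs]
        split_ifs with h
        · exact hx _
        · rw [abs_one]
          exact hH
        · rw [abs_zero]
          omega
    · simp only [coeff_zero_monicOfCoeffs, coeff_fin_monicOfCoeffs]

theorem ncard_heightSet_coeff_zero_const (m : ℕ) {H c : ℤ} (hH : 1 ≤ H) (hc : |c| ≤ H) :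
    ({f | f ∈ heightSet (m + 1) H ∧ f.coeff 0 = c}.ncard : ℝ) = (2 * H + 1) ^ m := by
  rw [ncard_heightSet_coeff_zero_eq hH fun _ => c, ← ncard_box m (by omega)]
  simp [hc]

theorem ncard_heightSet_eval_one (m : ℕ) {H : ℤ} (hH : 1 ≤ H) :
    {f | f ∈ heightSet (m + 1) H ∧ f.eval 1 = 0}.ncard = (latticeSet m H).ncard := by
  have h := ncard_heightSet_coeff_zero_eq hH fun x : Fin m → ℤ => -(1 + ∑ i, x i)
  simp only [abs_neg] at h
  rw [latticeSet, ← h]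
  congr 1
  ext f
  refine and_congr_right fun hf => ?_
  conv_lhs => rw [eq_monicOfCoeffs hf.1 hf.2.1, eval_monicOfCoeffs]
  simp only [one_pow, mul_one]
  constructor <;> intro h <;> linarith

theorem ncard_heightSet_eval_neg_one {m : ℕ} (hm : Even m) {H : ℤ} (hH : 1 ≤ H) :
    {f | f ∈ heightSet (m + 1) H ∧ f.eval (-1) = 0}.ncard = (latticeSet m H).ncard := by
  have h := ncard_heightSet_coeff_zero_eq hH fun x : Fin m → ℤ =>
    1 + ∑ i : Fin m, x i * (-1) ^ (i : ℕ)
  have hs : ∀ i : ℕ, ((-1 : ℤ) ^ i) * (-1) ^ i = 1 := fun i => by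
    rw [← mul_pow]
    simp
  have hinv : Function.Involutive fun (x : Fin m → ℤ) (i : Fin m) => x i * (-1) ^ (i : ℕ) := by
    intro x
    funext i
    simp only [mul_assoc, hs, mul_one]
  have himg : (fun (x : Fin m → ℤ) (i : Fin m) => x i * (-1) ^ (i : ℕ)) '' latticeSet m H =
      {x : Fin m → ℤ | (∀ i, |x i| ≤ H) ∧ |1 + ∑ i : Fin m, x i * (-1) ^ (i : ℕ)| ≤ H} := by
    rw [hinv.image_eq_preimage_symm]
    ext x
    simp [latticeSet, abs_mul]
  rw [← Set.ncard_image_of_injective (latticeSet m H) hinv.injective, himg, ← h]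
  congr 1
  ext f
  refine and_congr_right fun hf => ?_
  conv_lhs => rw [eq_monicOfCoeffs hf.1 hf.2.1, eval_monicOfCoeffs]
  simp only [pow_succ, hm.neg_one_pow, mul_neg, mul_one, Finset.sum_neg_distrib]
  constructor <;> intro h <;> linarith

theorem genDeg_of_eval_eq_zero {f : ℤ[X]} (hm : f.Monic) (hd : 2 ≤ f.natDegree) {c : ℤ}
    (hc : |c| = 1) (h : f.eval c = 0) : GenDeg f := by
  classical
  have hc0 : c ≠ 0 := by
    rintro rfl
    simp at hc
  have hmem : (c : ℂ) ∈ nzRoots f :=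
    Finset.mem_filter.2 ⟨(mem_roots_toFinset_intCast hm c).2 h, by exact_mod_cast hc0⟩
  refine ⟨hd, fun z => if z = c then 2 else 0, ⟨c, hmem, by simp⟩, ?_⟩
  rw [Finset.prod_eq_single_of_mem _ hmem]
  · have : c ^ 2 = 1 := by rw [← sq_abs, hc, one_pow]
    simp only [if_true]
    exact_mod_cast this
  · intro z _ hz
    simp [hz]

theorem genDeg_of_abs_coeff_zero_eq_one {f : ℤ[X]} (hm : f.Monic) (hd : 2 ≤ f.natDegree)
    (h : |f.coeff 0| = 1) : GenDeg f := by
  classical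
  set P := f.map (Int.castRingHom ℂ) with hP
  have hs : P.Splits := IsAlgClosed.splits _
  have hnz : nzRoots f = P.roots.toFinset := by
    refine Finset.filter_true_of_mem ?_
    rintro z hz rfl
    have h0 := (mem_roots_toFinset_intCast hm 0).1 (by simpa using hz)
    rw [← coeff_zero_eq_eval_zero] at h0
    rw [h0] at h
    simp at h
  have hcard : 0 < P.roots.card := by
    rw [← hs.natDegree_eq_card_roots, hm.natDegree_map]
    omega
  obtain ⟨z, hz⟩ := Multiset.card_pos_iff_exists_mem.1 hcard
  refine ⟨hd, fun z => 2 * (P.roots.count z : ℤ), ⟨z, ?_, ?_⟩, ?_⟩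
  · rw [hnz]
    exact Multiset.mem_toFinset.2 hz
  · have := Multiset.count_pos.2 hz
    simp only
    omega
  · have h1 : P.roots.prod ^ 2 = 1 := by
      have h2 : P.coeff 0 = (f.coeff 0 : ℂ) := by simp [hP]
      have h3 : (f.coeff 0) ^ 2 = 1 := by rw [← sq_abs, h, one_pow]
      have h4 : (f.coeff 0 : ℂ) ^ 2 = 1 := by exact_mod_cast h3
      rw [← h2, hs.coeff_zero_eq_prod_roots_of_monic (hm.map _), mul_pow, ← pow_mul, mul_comm _ 2,
        pow_mul, neg_one_sq, one_pow, one_mul] at h4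
      exact h4
    rw [hnz, ← h1, Finset.prod_multiset_count, ← Finset.prod_pow]
    refine Finset.prod_congr rfl fun x _ => ?_
    simp only
    rw [mul_comm, zpow_mul]
    norm_cast

theorem eval_sub_eq {f g : ℤ[X]} (h : ∀ j, 2 ≤ j → f.coeff j = g.coeff j) (c : ℤ) :
    f.eval c - g.eval c = (f.coeff 1 - g.coeff 1) * c + (f.coeff 0 - g.coeff 0) := by
  have h1 : (f - g).natDegree ≤ 1 := by
    rw [natDegree_le_iff_coeff_eq_zero]
    intro j hj
    rw [coeff_sub, h j hj, sub_self]
  rw [← eval_sub, eq_X_add_C_of_natDegree_le_one h1]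
  simp

theorem eq_of_coeff_eq {f g : ℤ[X]} (h : ∀ j, 2 ≤ j → f.coeff j = g.coeff j)
    (h0 : f.coeff 0 = g.coeff 0) (h1 : f.coeff 1 = g.coeff 1) : f = g := by
  ext j
  match j with
  | 0 => exact h0
  | 1 => exact h1
  | j + 2 => exact h _ (by omega)

theorem ncard_eval_coeff_zero_le {n : ℕ} (hn : 2 ≤ n) {H : ℤ} (hH : 1 ≤ H) {c : ℤ} (hc : |c| = 1)
    (d : ℤ) : ({f | f ∈ heightSet n H ∧ f.eval c = 0 ∧ f.coeff 0 = d}.ncard : ℝ) ≤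
      (3 * H) ^ (n - 2) := by
  refine (ncard_heightSet_inter_le hH (fun f hf => hf.1) 2 hn ?_).2
  rintro f ⟨-, hf, hf0⟩ g ⟨-, hg, hg0⟩ h
  have h1 := eval_sub_eq h c
  rw [hf, hg, hf0, hg0, sub_self, sub_self, add_zero] at h1
  have hc0 : c ≠ 0 := by
    rintro rfl
    simp at hc
  have h2 := (mul_eq_zero.1 h1.symm).resolve_right hc0
  exact eq_of_coeff_eq h (hf0.trans hg0.symm) (by linarith)

theorem ncard_eval_eval_le {n : ℕ} (hn : 2 ≤ n) {H : ℤ} (hH : 1 ≤ H) :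
    ({f | f ∈ heightSet n H ∧ f.eval 1 = 0 ∧ f.eval (-1) = 0}.ncard : ℝ) ≤ (3 * H) ^ (n - 2) := by
  refine (ncard_heightSet_inter_le hH (fun f hf => hf.1) 2 hn ?_).2
  rintro f ⟨-, hf, hf'⟩ g ⟨-, hg, hg'⟩ h
  have h1 := eval_sub_eq h 1
  have h2 := eval_sub_eq h (-1)
  rw [hf, hg] at h1
  rw [hf', hg'] at h2
  exact eq_of_coeff_eq h (by linarith) (by linarith)

theorem abs_ncard_Mset_sub_le {m : ℕ} (hm : Even m) (hm1 : 1 ≤ m) {H : ℤ} (hH : 1 ≤ H) :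
    |((Mset (m + 1) H).ncard : ℝ) - (2 * (latticeSet m H).ncard + 2 * (2 * H + 1) ^ m)| ≤
      5 * (3 * H) ^ (m - 1) + (sporadicSet (m + 1) H).ncard := by
  set U := heightSet (m + 1) H with hU
  have hUfin : U.Finite := finite_heightSet (m + 1) hH
  have hsep : ∀ P : ℤ[X] → Prop, {f | f ∈ U ∧ P f}.Finite := fun P => hUfin.sep P
  set A₁ := {f | f ∈ U ∧ f.eval 1 = 0}
  set A₂ := {f | f ∈ U ∧ f.eval (-1) = 0}
  set B₁ := {f | f ∈ U ∧ f.coeff 0 = 1}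
  set B₂ := {f | f ∈ U ∧ f.coeff 0 = -1}
  set R := sporadicSet (m + 1) H
  set M := Mset (m + 1) H
  have fA : (A₁ ∪ A₂).Finite := (hsep _).union (hsep _)
  have fB : (B₁ ∪ B₂).Finite := (hsep _).union (hsep _)
  have hMU : M ⊆ U := fun f hf => ⟨hf.1, hf.2.1, hf.2.2.1⟩
  have fM : M.Finite := hUfin.subset hMU
  have fR : R.Finite := fM.subset fun f hf => hf.1
  have sub₁ : A₁ ∪ A₂ ∪ (B₁ ∪ B₂) ⊆ M := by
    have hU2 : ∀ f ∈ U, GenDeg f → f ∈ M := fun f hf hG => ⟨hf.1, hf.2.1, hf.2.2, hG⟩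
    have hd : ∀ f ∈ U, 2 ≤ f.natDegree := fun f hf => by rw [hf.2.1]; omega
    rintro f ((⟨hf, h⟩ | ⟨hf, h⟩) | (⟨hf, h⟩ | ⟨hf, h⟩))
    · exact hU2 f hf (genDeg_of_eval_eq_zero hf.1 (hd f hf) (c := 1) (by simp) h)
    · exact hU2 f hf (genDeg_of_eval_eq_zero hf.1 (hd f hf) (c := -1) (by simp) h)
    · exact hU2 f hf (genDeg_of_abs_coeff_zero_eq_one hf.1 (hd f hf) (by simp [h]))
    · exact hU2 f hf (genDeg_of_abs_coeff_zero_eq_one hf.1 (hd f hf) (by simp [h]))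
  have sub₂ : M ⊆ A₁ ∪ A₂ ∪ (B₁ ∪ B₂) ∪ R := by
    intro f hf
    by_cases h : f ∈ A₁ ∪ A₂ ∪ (B₁ ∪ B₂)
    · exact Or.inl h
    · refine Or.inr ⟨hf, fun h1 => h (Or.inl (Or.inl ⟨hMU hf, h1⟩)),
        fun h1 => h (Or.inl (Or.inr ⟨hMU hf, h1⟩)), fun h1 => ?_⟩
      rcases eq_or_eq_neg_of_abs_eq h1 with h1 | h1
      · exact h (Or.inr (Or.inl ⟨hMU hf, h1⟩))
      · exact h (Or.inr (Or.inr ⟨hMU hf, h1⟩))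
  have cA := Set.ncard_union_add_ncard_inter A₁ A₂ (hsep _) (hsep _)
  have cB : (B₁ ∪ B₂).ncard = B₁.ncard + B₂.ncard := by
    refine Set.ncard_union_eq (Set.disjoint_left.2 ?_) (hsep _) (hsep _)
    rintro f ⟨-, h1⟩ ⟨-, h2⟩
    rw [h1] at h2
    omega
  have cAB := Set.ncard_union_add_ncard_inter (A₁ ∪ A₂) (B₁ ∪ B₂) fA fB
  have c₁ := Set.ncard_le_ncard sub₁ fM
  have c₂ := (Set.ncard_le_ncard sub₂ ((fA.union fB).union fR)).trans (Set.ncard_union_le _ _)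
  have iA : ((A₁ ∩ A₂).ncard : ℝ) ≤ (3 * H) ^ (m - 1) := by
    refine (Nat.cast_le.2 (Set.ncard_le_ncard ?_ (hsep _))).trans
      (ncard_eval_eval_le (n := m + 1) (by omega) hH)
    rintro f ⟨⟨hf, h1⟩, -, h2⟩
    exact ⟨hf, h1, h2⟩
  have iAB : (((A₁ ∪ A₂) ∩ (B₁ ∪ B₂)).ncard : ℝ) ≤ 4 * (3 * H) ^ (m - 1) := by
    let D : ℤ → ℤ → Set ℤ[X] := fun c d => {f | f ∈ U ∧ f.eval c = 0 ∧ f.coeff 0 = d}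
    have hD : ∀ c d : ℤ, |c| = 1 → ((D c d).ncard : ℝ) ≤ (3 * H) ^ (m - 1) := fun c d hc =>
      ncard_eval_coeff_zero_le (n := m + 1) (by omega) hH hc d
    have hsub : (A₁ ∪ A₂) ∩ (B₁ ∪ B₂) ⊆ (D 1 1 ∪ D 1 (-1)) ∪ (D (-1) 1 ∪ D (-1) (-1)) := by
      rintro f ⟨(⟨hf, h1⟩ | ⟨hf, h1⟩), (⟨-, h2⟩ | ⟨-, h2⟩)⟩
      · exact Or.inl (Or.inl ⟨hf, h1, h2⟩)
      · exact Or.inl (Or.inr ⟨hf, h1, h2⟩)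
      · exact Or.inr (Or.inl ⟨hf, h1, h2⟩)
      · exact Or.inr (Or.inr ⟨hf, h1, h2⟩)
    have h1 := Set.ncard_le_ncard hsub
      (((hsep _).union (hsep _)).union ((hsep _).union (hsep _)))
    have h2 := Set.ncard_union_le (D 1 1 ∪ D 1 (-1)) (D (-1) 1 ∪ D (-1) (-1))
    have h3 := Set.ncard_union_le (D 1 1) (D 1 (-1))
    have h4 := Set.ncard_union_le (D (-1) 1) (D (-1) (-1))
    have h5 : (((A₁ ∪ A₂) ∩ (B₁ ∪ B₂)).ncard : ℝ) ≤
        (D 1 1).ncard + (D 1 (-1)).ncard + ((D (-1) 1).ncard + (D (-1) (-1)).ncard) := by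
      have h6 : ((A₁ ∪ A₂) ∩ (B₁ ∪ B₂)).ncard ≤ (D 1 1).ncard + (D 1 (-1)).ncard +
          ((D (-1) 1).ncard + (D (-1) (-1)).ncard) := by omega
      simpa only [Nat.cast_add] using (Nat.cast_le (α := ℝ)).2 h6
    have e1 := hD 1 1 (by simp)
    have e2 := hD 1 (-1) (by simp)
    have e3 := hD (-1) 1 (by simp)
    have e4 := hD (-1) (-1) (by simp)
    linarith
  have nA₁ : A₁.ncard = (latticeSet m H).ncard := ncard_heightSet_eval_one m hH
  have nA₂ : A₂.ncard = (latticeSet m H).ncard := ncard_heightSet_eval_neg_one hm hH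
  have nB₁ : (B₁.ncard : ℝ) = (2 * H + 1) ^ m :=
    ncard_heightSet_coeff_zero_const m hH (by simpa using hH)
  have nB₂ : (B₂.ncard : ℝ) = (2 * H + 1) ^ m :=
    ncard_heightSet_coeff_zero_const m hH (by simpa using hH)
  rw [nA₁, nA₂] at cA
  have cA' : ((A₁ ∪ A₂).ncard : ℝ) + (A₁ ∩ A₂).ncard =
      (latticeSet m H).ncard + (latticeSet m H).ncard := by exact_mod_cast cA
  have cB' : ((B₁ ∪ B₂).ncard : ℝ) = B₁.ncard + B₂.ncard := by exact_mod_cast cB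
  have cAB' : ((A₁ ∪ A₂ ∪ (B₁ ∪ B₂)).ncard : ℝ) + ((A₁ ∪ A₂) ∩ (B₁ ∪ B₂)).ncard =
      (A₁ ∪ A₂).ncard + (B₁ ∪ B₂).ncard := by exact_mod_cast cAB
  have c₁' : ((A₁ ∪ A₂ ∪ (B₁ ∪ B₂)).ncard : ℝ) ≤ M.ncard := by exact_mod_cast c₁
  have c₂' : (M.ncard : ℝ) ≤ (A₁ ∪ A₂ ∪ (B₁ ∪ B₂)).ncard + R.ncard := by exact_mod_cast c₂
  have p1 : (0 : ℝ) ≤ (A₁ ∩ A₂).ncard := Nat.cast_nonneg _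
  have p2 : (0 : ℝ) ≤ ((A₁ ∪ A₂) ∩ (B₁ ∪ B₂)).ncard := Nat.cast_nonneg _
  have p3 : (0 : ℝ) ≤ R.ncard := Nat.cast_nonneg _
  rw [nB₁, nB₂] at cB'
  rw [abs_le]
  constructor <;> linarith

theorem stmt_8 (p : ℕ) (hp : p.Prime) (hgt : 5 < p) :
    ∃ C : ℝ, 0 < C ∧ ∀ H : ℤ, 3 ≤ H →
      |((Mset p H).ncard : ℝ) - (2 * nu p + 2 ^ p) * (H : ℝ) ^ (p - 1)| ≤
        C * (H : ℝ) ^ (p - 2) * (Real.log H) ^ (2 * p ^ 2 - 5 * p + 2) := by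
  obtain ⟨C₁, hC₁, h₁⟩ := abs_ncard_latticeSet_sub_le (m := p - 1) (by omega)
  obtain ⟨C₂, hC₂, h₂⟩ := ncard_sporadicSet_le hp (by omega)
  have heven : Even (p - 1) := hp.even_sub_one (by omega)
  obtain ⟨m, rfl⟩ : ∃ m, p = m + 1 := ⟨p - 1, by omega⟩
  have e1 : m + 1 - 1 = m := by omega
  have e2 : m + 1 - 2 = m - 1 := by omega
  have he : 3 ≤ 2 * (m + 1) ^ 2 - 5 * (m + 1) + 2 := by
    have : 5 * (m + 1) + 1 ≤ 2 * (m + 1) ^ 2 := by nlinarith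
    omega
  rw [e1] at h₁ heven ⊢
  rw [e2] at h₂ ⊢
  refine ⟨2 * C₁ + 2 * m * 3 ^ (m - 1) + 5 * 3 ^ (m - 1) + C₂, by positivity, fun H hH => ?_⟩
  have hH' : (3 : ℝ) ≤ H := by exact_mod_cast hH
  have hlog : 1 ≤ Real.log H := by
    rw [Real.le_log_iff_exp_le (by positivity)]
    linarith [Real.exp_one_lt_d9]
  set E := 2 * (m + 1) ^ 2 - 5 * (m + 1) + 2
  have hL1 : 1 ≤ Real.log H ^ E := one_le_pow₀ hlog
  have hL3 : Real.log H ^ 3 ≤ Real.log H ^ E := pow_le_pow_right₀ hlog he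
  have k₁ := h₁ H (by omega)
  have k₂ := h₂ H hH
  have k₃ := abs_ncard_Mset_sub_le heven (by omega : 1 ≤ m) (by omega : 1 ≤ H)
  have k₄ : |(2 * H + 1 : ℝ) ^ m - 2 ^ m * (H : ℝ) ^ m| ≤ m * 3 ^ (m - 1) * (H : ℝ) ^ (m - 1) := by
    rw [← mul_pow, mul_assoc (m : ℝ), ← mul_pow 3]
    refine (abs_pow_sub_pow_le _ _ m).trans ?_
    rw [abs_of_nonneg (by linarith : (0 : ℝ) ≤ 2 * H + 1),
      abs_of_nonneg (by linarith : (0 : ℝ) ≤ 2 * H), max_eq_left (by linarith),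
      add_sub_cancel_left, abs_one, one_mul]
    gcongr
    linarith
  set X := (H : ℝ) ^ (m - 1)
  have hX : 0 ≤ X := by positivity
  have hXL : X ≤ X * Real.log H ^ E := le_mul_of_one_le_right hX hL1
  have hXL3 : X * Real.log H ^ 3 ≤ X * Real.log H ^ E := mul_le_mul_of_nonneg_left hL3 hX
  have k₂' := k₂.trans (mul_le_mul_of_nonneg_left hXL3 hC₂)
  have hD : (2 * C₁ + 2 * m * 3 ^ (m - 1) + 5 * 3 ^ (m - 1)) * X ≤
      (2 * C₁ + 2 * m * 3 ^ (m - 1) + 5 * 3 ^ (m - 1)) * (X * Real.log H ^ E) :=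
    mul_le_mul_of_nonneg_left hXL (by positivity)
  rw [mul_pow] at k₃
  have e3 : (2 * nu (m + 1) + 2 ^ (m + 1)) * (H : ℝ) ^ m =
      2 * (nu (m + 1) * (H : ℝ) ^ m) + 2 * (2 ^ m * (H : ℝ) ^ m) := by ring
  have e4 : (2 * C₁ + 2 * m * 3 ^ (m - 1) + 5 * 3 ^ (m - 1) + C₂) * X * Real.log H ^ E =
      (2 * C₁ + 2 * m * 3 ^ (m - 1) + 5 * 3 ^ (m - 1)) * (X * Real.log H ^ E) +
        C₂ * (X * Real.log H ^ E) := by ring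
  rw [e3, e4]
  rw [abs_le] at k₁ k₃ k₄ ⊢
  constructor <;> linarith
end

section
/- There exist positive constants c1 and c2, depending only on n, such that for every integer n ≥ 2 and every integer H ≥ 3, c1·H^n ≤ #I*_n(H) ≤ c2·H^n·(log H)^(2n²−n−1), where #I*_n(H) is the number of generalized degenerate integer polynomials (not necessarily monic) of degree n and height at most H that are irreducible over ℤ. -/
open Polynomial MeasureTheory

/-- Simultaneous Dirichlet approximation. -/
theorem exists_simultaneous_approx {n : ℕ} (x : Fin n → ℝ) (m : Fin n) (hm : x m = 1)
    (hx : ∀ i, |x i| ≤ 1) {Q : ℕ} (hQ : 0 < Q) :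
    ∃ (p : Fin n → ℤ) (q : ℕ), 0 < q ∧ q ≤ Q ^ (n - 1) ∧ p m = q ∧
      (∀ i, |(q : ℝ) * x i - p i| ≤ 1 / Q) ∧ ∀ i, |(p i : ℝ)| ≤ q + 1 := by
  have hQ' : (0 : ℝ) < Q := by exact_mod_cast hQ
  let box : ℕ → Fin n → ℕ := fun q i => ⌊Int.fract ((q : ℝ) * x i) * Q⌋₊
  let T : Finset (Fin n → ℕ) :=
    Fintype.piFinset fun i => if i = m then {0} else Finset.range Q
  have hT : T.card = Q ^ (n - 1) := by
    rw [Fintype.card_piFinset, ← Finset.mul_prod_erase _ _ (Finset.mem_univ m)]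
    rw [Finset.prod_congr rfl (g := fun _ => Q)]
    · simp
    · intro i hi
      simp [Finset.ne_of_mem_erase hi]
  have hmaps : ∀ q ∈ Finset.range (Q ^ (n - 1) + 1), box q ∈ T := by
    intro q _
    refine Fintype.mem_piFinset.mpr fun i => ?_
    by_cases hi : i = m
    · subst hi
      simp [box, hm]
    · have h1 := Int.fract_lt_one ((q : ℝ) * x i)
      have h0 := Int.fract_nonneg ((q : ℝ) * x i)
      simp only [hi, if_false, Finset.mem_range, box]
      rw [Nat.floor_lt (by positivity)]
      nlinarith
  obtain ⟨a, ha, b, hb, hab, heq⟩ :=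
    Finset.exists_ne_map_eq_of_card_lt_of_maps_to (by simp [hT]) hmaps
  wlog hlt : a < b generalizing a b
  · exact this b hb a ha hab.symm heq.symm (lt_of_le_of_ne (not_lt.mp hlt) hab.symm)
  simp only [Finset.mem_range] at hb
  have happrox : ∀ i, |((b - a : ℕ) : ℝ) * x i - (⌊(b : ℝ) * x i⌋ - ⌊(a : ℝ) * x i⌋ : ℤ)|
      ≤ 1 / Q := by
    intro i
    have h1 : ⌊Int.fract ((a : ℝ) * x i) * Q⌋₊ = ⌊Int.fract ((b : ℝ) * x i) * Q⌋₊ := congrFun heq i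
    have ha0 := Int.fract_nonneg ((a : ℝ) * x i)
    have hb0 := Int.fract_nonneg ((b : ℝ) * x i)
    have h2 := Nat.floor_le (mul_nonneg ha0 hQ'.le)
    have h3 := Nat.lt_floor_add_one (Int.fract ((a : ℝ) * x i) * Q)
    have h4 := Nat.floor_le (mul_nonneg hb0 hQ'.le)
    have h5 := Nat.lt_floor_add_one (Int.fract ((b : ℝ) * x i) * Q)
    rw [h1] at h2 h3
    have h6 : ((b - a : ℕ) : ℝ) * x i - (⌊(b : ℝ) * x i⌋ - ⌊(a : ℝ) * x i⌋ : ℤ) =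
        Int.fract ((b : ℝ) * x i) - Int.fract ((a : ℝ) * x i) := by
      push_cast [Nat.cast_sub hlt.le, Int.fract]
      ring
    rw [h6, le_div_iff₀ hQ', ← abs_of_pos hQ', ← abs_mul, abs_le]
    constructor <;> nlinarith
  refine ⟨fun i => ⌊(b : ℝ) * x i⌋ - ⌊(a : ℝ) * x i⌋, b - a, by omega, by omega, ?_, happrox,
    fun i => ?_⟩
  · simp only [hm, mul_one, Int.floor_natCast]
    omega
  · have h1 := happrox i
    have h2 : (1 : ℝ) / Q ≤ 1 := by
      rw [div_le_one hQ']
      exact_mod_cast hQ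
    have h3 : |((b - a : ℕ) : ℝ) * x i| ≤ (b - a : ℕ) := by
      rw [abs_mul, Nat.abs_cast]
      exact mul_le_of_le_one_right (Nat.cast_nonneg _) (hx i)
    rw [abs_le] at *
    constructor <;> linarith

theorem finrank_adjoin_finset_le {F : Type*} {E : Type*} [Field F] [Field E] [Algebra F E] {n : ℕ}
    (s : Finset E) (hs : ∀ x ∈ s, IsIntegral F x ∧ (minpoly F x).natDegree ≤ n) :
    FiniteDimensional F (IntermediateField.adjoin F (s : Set E)) ∧
      Module.finrank F (IntermediateField.adjoin F (s : Set E)) ≤ n ^ s.card := by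
  classical
  induction s using Finset.induction_on with
  | empty =>
    rw [Finset.coe_empty, IntermediateField.adjoin_empty, Finset.card_empty, pow_zero]
    exact ⟨inferInstance, IntermediateField.finrank_bot.le⟩
  | insert a s ha ih =>
    obtain ⟨h1, h2⟩ := ih fun x hx => hs x (Finset.mem_insert_of_mem hx)
    obtain ⟨h3, h4⟩ := hs a (Finset.mem_insert_self _ _)
    have := IntermediateField.adjoin.finiteDimensional h3
    rw [Finset.coe_insert, Set.insert_eq, IntermediateField.adjoin_union,
      Finset.card_insert_of_notMem ha]
    refine ⟨inferInstance, (IntermediateField.finrank_sup_le _ _).trans ?_⟩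
    rw [IntermediateField.adjoin.finrank h3, pow_succ']
    exact Nat.mul_le_mul h4 h2

open NumberField Height

theorem apply_le_mulHeight₁ {K : Type*} [Field K] [NumberField K] (x : K) (v : InfinitePlace K) :
    v x ≤ mulHeight₁ x := by
  classical
  rw [NumberField.mulHeight₁_eq]
  have h1 : v x ≤ ∏ w : InfinitePlace K, max (w x) 1 ^ w.mult := by
    rw [← Finset.mul_prod_erase _ _ (Finset.mem_univ v)]
    have h2 : v x ≤ max (v x) 1 ^ v.mult :=
      (le_max_left _ 1).trans (le_self_pow₀ (le_max_right _ _) v.mult_ne_zero)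
    have h3 : 1 ≤ ∏ w ∈ Finset.univ.erase v, max (w x) 1 ^ w.mult :=
      Finset.one_le_prod fun w _ => one_le_pow₀ (le_max_right _ _)
    nlinarith [le_max_right (v x) 1, apply_nonneg v x]
  have h4 : 1 ≤ ∏ᶠ v : FinitePlace K, max (v x) 1 := one_le_finprod fun _ => le_max_right _ _
  nlinarith [apply_nonneg v x]

theorem exists_finite_integral_of_norm_le (d : ℕ) (B : ℝ) : ∃ T : Set ℂ, T.Finite ∧
    ∀ (K : Type) [Field K] [NumberField K], Module.finrank ℚ K ≤ d →
      ∀ (x : K), IsIntegral ℤ x → (∀ φ : K →+* ℂ, ‖φ x‖ ≤ B) → ∀ φ : K →+* ℂ, φ x ∈ T := by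
  classical
  let C : ℕ := ⌈max B 1 ^ d * (2 : ℝ) ^ d⌉₊
  refine ⟨⋃ f : ℤ[X], ⋃ (_ : f.natDegree ≤ d ∧ ∀ i, f.coeff i ∈ Set.Icc (-(C:ℤ)) C),
    ((f.map (algebraMap ℤ ℂ)).roots.toFinset : Set ℂ),
    Polynomial.bUnion_roots_finite (algebraMap ℤ ℂ) d (Set.finite_Icc (-(C:ℤ)) C), ?_⟩
  intro K _ _ hd x hxi hx φ
  simp only [Set.mem_iUnion]
  have h_map_ℚ_minpoly := minpoly.isIntegrallyClosed_eq_field_fractions' ℚ hxi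
  refine ⟨minpoly ℤ x, ⟨?_, fun i => ?_⟩, ?_⟩
  · rw [← (minpoly.monic hxi).natDegree_map (algebraMap ℤ ℚ), ← h_map_ℚ_minpoly]
    exact (minpoly.natDegree_le x).trans hd
  · rw [Set.mem_Icc, ← abs_le, ← @Int.cast_le ℝ]
    refine le_trans ?_ (Nat.le_ceil _)
    refine le_trans ?_ ((Embeddings.coeff_bdd_of_norm_le hx i).trans ?_)
    · rw [h_map_ℚ_minpoly, coeff_map, eq_intCast, Int.norm_cast_rat, Int.norm_eq_abs, Int.cast_abs]
    · have h1 : (1:ℝ) ≤ max B 1 := le_max_right _ _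
      gcongr
      refine le_trans ?_ (pow_le_pow_right₀ (by norm_num : (1:ℝ) ≤ 2) hd)
      exact_mod_cast Nat.choose_le_two_pow _ _
  · simp only [Finset.mem_coe, Multiset.mem_toFinset]
    rw [mem_roots ((Polynomial.map_monic_ne_zero (minpoly.monic hxi))), IsRoot.def, eval_map,
      show algebraMap ℤ ℂ = φ.comp (algebraMap ℤ K) from RingHom.ext_int _ _, ← hom_eval₂,
      ← aeval_def, minpoly.aeval, map_zero]

theorem exists_pow_eq_one_of_mulHeight₁_pow_le (d : ℕ) : ∃ M : ℕ, 0 < M ∧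
    ∀ (K : Type) [Field K] [NumberField K], Module.finrank ℚ K ≤ d →
      ∀ x : K, x ≠ 0 → mulHeight₁ x ^ M ≤ 2 → ∃ j : ℕ, 0 < j ∧ j ≤ M ∧ x ^ j = 1 := by
  classical
  obtain ⟨T, hT, hT'⟩ := exists_finite_integral_of_norm_le d 4
  let S : Finset (ℕ × ℂ) := Finset.range 3 ×ˢ hT.toFinset
  refine ⟨S.card + 1, by omega, fun K _ _ hd x hx0 hx => ?_⟩
  have key : ∀ i ∈ Finset.range (S.card + 1), ∃ m : ℕ, m ≠ 0 ∧ m ≤ 2 ∧ IsIntegral ℤ (m * x ^ i) ∧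
      ∀ φ : K →+* ℂ, φ (m * x ^ i) ∈ T := by
    intro i hi
    have hh : mulHeight₁ (x ^ i) ≤ 2 := by
      rw [mulHeight₁_pow]
      exact (pow_le_pow_right₀ (one_le_mulHeight₁ x) (by simp at hi; omega)).trans hx
    obtain ⟨m, hm, hm', hintegral⟩ := exists_nat_le_mulHeight₁ (x ^ i)
    have hm2 : (m : ℝ) ≤ 2 := hm'.trans hh
    refine ⟨m, hm, by exact_mod_cast hm2, hintegral, hT' K hd _ hintegral fun φ => ?_⟩
    have h1 := (apply_le_mulHeight₁ (x ^ i) (InfinitePlace.mk φ)).trans hh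
    rw [InfinitePlace.apply] at h1
    rw [map_mul, map_natCast, norm_mul, Complex.norm_natCast]
    have := norm_nonneg (φ (x ^ i))
    nlinarith
  choose! m hm0 hm2 hintegral hmT using key
  obtain ⟨φ⟩ : Nonempty (K →+* ℂ) := inferInstance
  have hmaps : ∀ i ∈ Finset.range (S.card + 1), (m i, φ (m i * x ^ i)) ∈ S := by
    intro i hi
    simp only [S, Finset.mem_product, Finset.mem_range, Set.Finite.mem_toFinset]
    exact ⟨by have := hm2 i hi; omega, hmT i hi φ⟩
  obtain ⟨a, ha, b, hb, hab, heq⟩ :=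
    Finset.exists_ne_map_eq_of_card_lt_of_maps_to (by simp) hmaps
  wlog hlt : a < b generalizing a b
  · exact this b hb a ha hab.symm heq.symm (lt_of_le_of_ne (not_lt.mp hlt) hab.symm)
  rw [Prod.mk.injEq] at heq
  have h2 := φ.injective heq.2
  rw [heq.1] at h2
  have h3 := mul_left_cancel₀ (Nat.cast_ne_zero.mpr (hm0 b hb)) h2
  simp only [Finset.mem_range] at hb
  refine ⟨b - a, by omega, by omega, ?_⟩
  have h4 : x ^ a * x ^ (b - a) = x ^ a * 1 := by
    rw [← pow_add, mul_one, h3]; congr 1; omega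
  exact mul_left_cancel₀ (pow_ne_zero _ hx0) h4

theorem norm_leadingCoeff_mul_root_le {f : ℤ[X]} (hf : f ≠ 0) {H : ℤ} (hH : ∀ i, |f.coeff i| ≤ H)
    {z : ℂ} (hz : aeval z f = 0) : ‖(f.leadingCoeff : ℂ) * z‖ ≤ 2 * H := by
  have hinj : Function.Injective (Int.castRingHom ℂ) := (Int.castRingHom ℂ).injective_int
  set p := f.map (Int.castRingHom ℂ) with hp
  have hp0 : p ≠ 0 := (Polynomial.map_ne_zero_iff hinj).mpr hf
  have hroot : p.IsRoot z := by
    rw [IsRoot.def, hp, eval_map]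
    simpa [aeval_def] using hz
  have hlc : p.leadingCoeff = (f.leadingCoeff : ℂ) := by
    rw [hp, leadingCoeff_map_of_injective hinj]; simp
  have hlpos : 0 < ‖p.leadingCoeff‖₊ := by simpa using hp0
  have hlt : ‖z‖₊ ≤ cauchyBound p := (hroot.norm_lt_cauchyBound hp0).le
  have hcoeff : ∀ i, ‖p.coeff i‖ ≤ H := by
    intro i
    rw [hp, coeff_map, eq_intCast, Complex.norm_intCast]
    exact_mod_cast hH i
  have hH0 : (0 : ℝ) ≤ H := (norm_nonneg _).trans (hcoeff 0)
  have hb : ‖p.leadingCoeff‖₊ * cauchyBound p ≤ 2 * H.toNat := by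
    have hsup : ((Finset.range p.natDegree).sup fun i => ‖p.coeff i‖₊) ≤ H.toNat := by
      refine Finset.sup_le fun i _ => ?_
      rw [← NNReal.coe_le_coe, coe_nnnorm]
      refine (hcoeff i).trans ?_
      push_cast
      exact_mod_cast Int.self_le_toNat H
    have hl : ‖p.leadingCoeff‖₊ ≤ H.toNat := by
      rw [← NNReal.coe_le_coe, coe_nnnorm]
      refine (hcoeff _).trans ?_
      push_cast
      exact_mod_cast Int.self_le_toNat H
    rw [cauchyBound, mul_add, mul_one, mul_div_cancel₀ _ hlpos.ne', two_mul]
    exact add_le_add hsup hl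
  have h1 : ‖p.leadingCoeff * z‖₊ ≤ 2 * H.toNat := by
    rw [nnnorm_mul]
    exact (mul_le_mul_right hlt _).trans hb
  rw [← hlc]
  have h2 : ‖p.leadingCoeff * z‖ ≤ 2 * (H.toNat : ℝ) := by exact_mod_cast h1
  refine h2.trans (le_of_eq ?_)
  have : ((H.toNat : ℤ) : ℝ) = H := by
    rw [Int.toNat_of_nonneg (by exact_mod_cast hH0)]
  rw [← this]; norm_cast

theorem mulHeight₁_root_le {K : Type*} [Field K] [NumberField K] {f : ℤ[X]} (hf : f ≠ 0) {H : ℤ}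
    (hH : ∀ i, |f.coeff i| ≤ H) {x : K} (hx : aeval x f = 0) :
    mulHeight₁ x ≤ (2 * H) ^ Module.finrank ℚ K := by
  have hlc0 : f.leadingCoeff ≠ 0 := leadingCoeff_ne_zero.mpr hf
  have hlcK : (f.leadingCoeff : K) ≠ 0 := by exact_mod_cast hlc0
  have hintegral : IsIntegral ℤ ((f.leadingCoeff : K) * x) := by
    simpa [zsmul_eq_mul] using isIntegral_leadingCoeff_smul f x hx
  have hH1 : (1 : ℝ) ≤ H := by
    have h1 := Int.one_le_abs hlc0
    have h2 := hH f.natDegree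
    rw [coeff_natDegree] at h2
    exact_mod_cast h1.trans h2
  rw [← mul_div_cancel_left₀ x hlcK, mulHeight₁_div_eq_mulHeight,
    NumberField.mulHeight_eq (by simp [hlcK])]
  have harch : ∏ v : InfinitePlace K,
      (⨆ i, v (![(f.leadingCoeff : K) * x, f.leadingCoeff] i)) ^ v.mult
      ≤ (2 * H) ^ Module.finrank ℚ K := by
    rw [← InfinitePlace.sum_mult_eq, ← Finset.prod_pow_eq_pow_sum]
    refine Finset.prod_le_prod (fun v _ => pow_nonneg (Real.iSup_nonneg_of_nonnegHomClass ..) _)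
      fun v _ => ?_
    refine pow_le_pow_left₀ (Real.iSup_nonneg_of_nonnegHomClass ..) ?_ _
    refine ciSup_le fun i => ?_
    fin_cases i
    · simp only [Fin.zero_eta, Matrix.cons_val_zero]
      rw [← v.norm_embedding_eq, map_mul, map_intCast]
      refine norm_leadingCoeff_mul_root_le hf hH ?_
      have := congrArg v.embedding hx
      rwa [map_zero, aeval_def, hom_eval₂,
        show v.embedding.comp (algebraMap ℤ K) = algebraMap ℤ ℂ from RingHom.ext_int _ _] at this
    · simp only [Fin.mk_one, Matrix.cons_val_one, Matrix.cons_val_fin_one]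
      rw [← v.norm_embedding_eq, map_intCast, Complex.norm_intCast]
      have h2 : ((|f.leadingCoeff| : ℤ) : ℝ) ≤ H := by exact_mod_cast hH f.natDegree
      push_cast at h2
      linarith
  have hfin : ∏ᶠ v : FinitePlace K, ⨆ i, v (![(f.leadingCoeff : K) * x, f.leadingCoeff] i) ≤ 1 := by
    refine finprod_induction (p := fun r : ℝ => 0 ≤ r ∧ r ≤ 1) ⟨zero_le_one, le_rfl⟩
      (fun a b ha hb => ⟨mul_nonneg ha.1 hb.1, mul_le_one₀ ha.2 hb.1 hb.2⟩) (fun v => ?_) |>.2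
    refine ⟨Real.iSup_nonneg_of_nonnegHomClass .., ciSup_le fun i => ?_⟩
    have hv (y : 𝓞 K) : v (y : K) ≤ 1 := by
      simpa using FinitePlace.norm_le_one K v.maximalIdeal y
    fin_cases i
    · exact hv ⟨_, hintegral⟩
    · have := hv (f.leadingCoeff : 𝓞 K)
      rwa [show ((f.leadingCoeff : 𝓞 K) : K) = f.leadingCoeff from
        map_intCast (algebraMap (𝓞 K) K) _] at this
  refine (mul_le_of_le_one_right (Finset.prod_nonneg fun v _ => pow_nonneg
    (Real.iSup_nonneg_of_nonnegHomClass ..) _) hfin).trans harch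

theorem exists_small_relation (d n : ℕ) : ∃ M : ℕ, 0 < M ∧
    ∀ (K : Type) [Field K] [NumberField K], Module.finrank ℚ K ≤ d → ∀ α : Fin n → K,
      (∀ i, α i ≠ 0) → ∀ h : ℝ, (∀ i, logHeight₁ (α i) ≤ h) → ∀ k : Fin n → ℤ, k ≠ 0 →
      ∏ i, α i ^ k i = 1 → ∀ Q : ℕ, 0 < Q → M * (n * h) ≤ Q * Real.log 2 →
      ∃ p : Fin n → ℤ, p ≠ 0 ∧ ∏ i, α i ^ p i = 1 ∧ ∀ i, |p i| ≤ M * (Q ^ (n - 1) + 1) := by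
  obtain ⟨M, hM, hMK⟩ := exists_pow_eq_one_of_mulHeight₁_pow_le d
  refine ⟨M, hM, fun K _ _ hd α hα h hh k hk hrel Q hQ hMQ => ?_⟩
  obtain ⟨i₀, hi₀⟩ := Function.ne_iff.mp hk
  obtain ⟨m, -, hm⟩ := Finset.exists_max_image Finset.univ (fun i => |k i|) ⟨i₀, Finset.mem_univ _⟩
  replace hm : ∀ i, |k i| ≤ |k m| := fun i => hm i (Finset.mem_univ _)
  have hkm : k m ≠ 0 := by
    intro h0
    have := hm i₀
    rw [h0, abs_zero] at this
    exact hi₀ (abs_nonpos_iff.mp this)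
  have hkmR : (k m : ℝ) ≠ 0 := by exact_mod_cast hkm
  have habs : 0 < |(k m : ℝ)| := abs_pos.mpr hkmR
  obtain ⟨p, q, hq, hqQ, hpm, hpx, hpq⟩ := exists_simultaneous_approx (fun i => (k i : ℝ) / k m) m
    (div_self hkmR) (fun i => by
      rw [abs_div, div_le_one habs]
      exact_mod_cast hm i) hQ
  set γ := ∏ i, α i ^ p i with hγ
  have hγ0 : γ ≠ 0 := Finset.prod_ne_zero_iff.mpr fun i _ => zpow_ne_zero _ (hα i)
  have hγk : γ ^ k m = ∏ i, α i ^ (k m * p i - q * k i) := by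
    have : ∏ i, α i ^ (k m * p i - q * k i) = (∏ i, α i ^ p i) ^ k m / (∏ i, α i ^ k i) ^ q := by
      rw [← Finset.prod_zpow, ← Finset.prod_pow, ← Finset.prod_div_distrib]
      refine Finset.prod_congr rfl fun i _ => ?_
      rw [zpow_sub₀ (hα i), mul_comm (k m), zpow_mul, mul_comm (q : ℤ), zpow_mul, zpow_natCast]
    rw [this, hrel, one_pow, div_one]
  have hterm (i : Fin n) : ((k m * p i - q * k i : ℤ).natAbs : ℝ) * logHeight₁ (α i)
      ≤ |(k m : ℝ)| * (h / Q) := by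
    have h1 : ((k m * p i - q * k i : ℤ).natAbs : ℝ) ≤ |(k m : ℝ)| * (1 / Q) := by
      rw [Nat.cast_natAbs]
      push_cast
      rw [show (k m : ℝ) * p i - q * k i = -(k m * (q * (k i / k m) - p i)) by field_simp; ring,
        abs_neg, abs_mul]
      exact mul_le_mul_of_nonneg_left (hpx i) habs.le
    calc _ ≤ |(k m : ℝ)| * (1 / Q) * h :=
          mul_le_mul h1 (hh i) (zero_le_logHeight₁ _) (by positivity)
      _ = _ := by ring
  have hlog : |(k m : ℝ)| * logHeight₁ γ ≤ |(k m : ℝ)| * (n * (h / Q)) := by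
    calc |(k m : ℝ)| * logHeight₁ γ = logHeight₁ (γ ^ k m) := by
          rw [logHeight₁_zpow, Nat.cast_natAbs, Int.cast_abs]
      _ ≤ ∑ i, logHeight₁ (α i ^ (k m * p i - q * k i)) := by
          rw [hγk]; exact logHeight₁_prod_le _ _
      _ ≤ ∑ _i : Fin n, |(k m : ℝ)| * (h / Q) := by
          refine Finset.sum_le_sum fun i _ => ?_
          rw [logHeight₁_zpow]
          exact hterm i
      _ = _ := by simp; ring
  have hγh : M * logHeight₁ γ ≤ Real.log 2 := by
    have h1 := le_of_mul_le_mul_left hlog habs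
    have hQ' : (0 : ℝ) < Q := by exact_mod_cast hQ
    calc M * logHeight₁ γ ≤ M * (n * (h / Q)) := by gcongr
      _ = M * (n * h) / Q := by ring
      _ ≤ Real.log 2 := by rw [div_le_iff₀ hQ']; linarith
  have hγ2 : mulHeight₁ γ ^ M ≤ 2 := by
    rw [← Real.log_le_log_iff (pow_pos (mulHeight₁_pos _) _) two_pos, Real.log_pow]
    exact hγh
  obtain ⟨j, hj, hjM, hγj⟩ := hMK K hd γ hγ0 hγ2
  refine ⟨fun i => p i * j, fun h0 => ?_, ?_, fun i => ?_⟩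
  · have := congrFun h0 m
    simp only [hpm, Pi.zero_apply, mul_eq_zero, Nat.cast_eq_zero] at this
    omega
  · simp_rw [zpow_mul, zpow_natCast]
    rw [Finset.prod_pow, ← hγ, hγj]
  · have h1 : |p i| ≤ Q ^ (n - 1) + 1 := by
      have h2 : |p i| ≤ q + 1 := by exact_mod_cast hpq i
      have h3 : (q : ℤ) ≤ Q ^ (n - 1) := by exact_mod_cast hqQ
      omega
    rw [abs_mul, mul_comm]
    exact mul_le_mul (by simpa using hjM) h1 (abs_nonneg _) (by positivity)

theorem exists_bounded_relation {n : ℕ} (hn : 1 ≤ n) : ∃ C : ℝ, 0 < C ∧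
    ∀ H : ℤ, 3 ≤ H → ∀ f : ℤ[X], f ≠ 0 → f.natDegree ≤ n → (∀ i, |f.coeff i| ≤ H) →
      ∀ α : Fin n → ℂ, (∀ i, α i ≠ 0) → (∀ i, aeval (α i) f = 0) →
      ∀ k : Fin n → ℤ, k ≠ 0 → ∏ i, α i ^ k i = 1 →
      ∃ p : Fin n → ℤ, p ≠ 0 ∧ ∏ i, α i ^ p i = 1 ∧
        ∀ i, (|p i| : ℝ) ≤ C * Real.log H ^ (n - 1) := by
  classical
  obtain ⟨M, hM, hMK⟩ := exists_small_relation (n ^ n) n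
  have hl2 : 0 < Real.log 2 := Real.log_pos one_lt_two
  set c : ℝ := M * (n * (n ^ n * 2)) / Real.log 2 + 1 with hc
  have hc1 : 1 ≤ c := by rw [hc, le_add_iff_nonneg_left]; positivity
  refine ⟨M * (c ^ (n - 1) + 1), by positivity, fun H hH f hf hfn hfH α hα hroot k hk hrel => ?_⟩
  have hHR : (3 : ℝ) ≤ H := by exact_mod_cast hH
  have hlogH : 1 ≤ Real.log H := by
    rw [Real.le_log_iff_exp_le (by linarith)]
    linarith [Real.exp_one_lt_d9]
  set s : Finset ℂ := Finset.univ.image α with hs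
  have hfQ : f.map (Int.castRingHom ℚ) ≠ 0 :=
    (Polynomial.map_ne_zero_iff (Int.castRingHom ℚ).injective_int).mpr hf
  have hmin : ∀ x ∈ s, IsIntegral ℚ x ∧ (minpoly ℚ x).natDegree ≤ n := by
    intro x hx
    obtain ⟨i, -, rfl⟩ := Finset.mem_image.mp hx
    have h0 : aeval (α i) (f.map (Int.castRingHom ℚ)) = 0 :=
      (aeval_map_algebraMap ℚ (α i) f).trans (hroot i)
    refine ⟨(isAlgebraic_iff_isIntegral).mp ⟨_, hfQ, h0⟩, ?_⟩
    refine (natDegree_le_of_dvd (minpoly.dvd _ _ h0) hfQ).trans ?_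
    exact natDegree_map_le.trans hfn
  obtain ⟨hfd, hrank⟩ := finrank_adjoin_finset_le s hmin
  set K := IntermediateField.adjoin ℚ (s : Set ℂ)
  have : NumberField K := ⟨⟩
  have hcard : s.card ≤ n := Finset.card_image_le.trans (by simp)
  replace hrank : Module.finrank ℚ K ≤ n ^ n := hrank.trans (Nat.pow_le_pow_right hn hcard)
  have hmem (i : Fin n) : α i ∈ K :=
    IntermediateField.subset_adjoin _ _ (by simp [hs])
  set β : Fin n → K := fun i => ⟨α i, hmem i⟩ with hβ
  have hprod (p : Fin n → ℤ) : ∏ i, β i ^ p i = 1 ↔ ∏ i, α i ^ p i = 1 := by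
    rw [← (algebraMap K ℂ).injective.eq_iff, map_prod, map_one]
    simp_rw [map_zpow₀]
    rfl
  have hβh (i : Fin n) : logHeight₁ (β i) ≤ n ^ n * 2 * Real.log H := by
    have hr : aeval (β i) f = 0 := by
      apply (algebraMap K ℂ).injective
      rw [map_zero, ← aeval_algebraMap_apply]
      exact hroot i
    have h1 := mulHeight₁_root_le hf hfH hr
    have h2 := Real.log_le_log (mulHeight₁_pos _) h1
    rw [← logHeight₁_eq_log_mulHeight₁, Real.log_pow] at h2
    have h3 : Real.log (2 * H) ≤ 2 * Real.log H := by
      rw [Real.log_mul two_ne_zero (by positivity), two_mul]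
      gcongr
      linarith
    have h4 : (Module.finrank ℚ K : ℝ) ≤ (n : ℝ) ^ n := by exact_mod_cast hrank
    calc _ ≤ _ := h2
      _ ≤ (n : ℝ) ^ n * (2 * Real.log H) := by
        apply mul_le_mul h4 h3 (Real.log_nonneg (by linarith)) (by positivity)
      _ = _ := by ring
  obtain ⟨Q, hQ⟩ : ∃ Q : ℕ, Q = ⌊c * Real.log H⌋₊ := ⟨_, rfl⟩
  have hcl : 1 ≤ c * Real.log H := one_le_mul_of_one_le_of_one_le hc1 hlogH
  have hQ0 : 0 < Q := hQ ▸ Nat.floor_pos.mpr hcl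
  have hQle : (Q : ℝ) ≤ c * Real.log H := hQ ▸ Nat.floor_le (by linarith)
  have hQlt : c * Real.log H < Q + 1 := hQ ▸ Nat.lt_floor_add_one _
  have hMQ : M * (n * (n ^ n * 2 * Real.log H)) ≤ Q * Real.log 2 := by
    rw [← div_le_iff₀ hl2]
    have : (M * (n * (n ^ n * 2 * Real.log H))) / Real.log 2
        = M * (n * (n ^ n * 2)) / Real.log 2 * Real.log H := by ring
    rw [this]
    have h1 : c * Real.log H
        = M * (n * (n ^ n * 2)) / Real.log 2 * Real.log H + Real.log H := by rw [hc]; ring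
    linarith
  obtain ⟨p, hp0, hp, hpM⟩ := hMK K hrank β (fun i h => hα i (congrArg Subtype.val h)) _ hβh k hk
    ((hprod k).mpr hrel) Q hQ0 hMQ
  refine ⟨p, hp0, (hprod p).mp hp, fun i => ?_⟩
  have h1 : (|p i| : ℝ) ≤ M * (Q ^ (n - 1) + 1) := by exact_mod_cast hpM i
  have h2 : (Q : ℝ) ^ (n - 1) ≤ c ^ (n - 1) * Real.log H ^ (n - 1) := by
    rw [← mul_pow]; gcongr
  have h3 : 1 ≤ Real.log H ^ (n - 1) := one_le_pow₀ hlogH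
  calc _ ≤ _ := h1
    _ ≤ M * (c ^ (n - 1) * Real.log H ^ (n - 1) + Real.log H ^ (n - 1)) := by gcongr
    _ = _ := by ring

theorem exists_roots_param {f : ℤ[X]} (hf : Irreducible f) {n : ℕ} (hfn : f.natDegree = n)
    (hn : 2 ≤ n) : ∃ α : Fin n → ℂ, Function.Injective α ∧ (∀ i, α i ≠ 0) ∧
      f.map (Int.castRingHom ℂ) = C (f.leadingCoeff : ℂ) * ∏ i, (X - C (α i)) := by
  classical
  have hinj : Function.Injective (Int.castRingHom ℂ) := (Int.castRingHom ℂ).injective_int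
  have hirr : Irreducible (f.map (Int.castRingHom ℚ)) :=
    (IsPrimitive.Int.irreducible_iff_irreducible_map_cast (hf.isPrimitive (by omega))).mp hf
  have hmap : (f.map (Int.castRingHom ℚ)).map (algebraMap ℚ ℂ) = f.map (Int.castRingHom ℂ) := by
    rw [Polynomial.map_map]
    congr 1
  set p := f.map (Int.castRingHom ℂ) with hp
  have hp0 : p ≠ 0 := (Polynomial.map_ne_zero_iff hinj).mpr hf.ne_zero
  have hsep : p.Separable := by
    rw [← hmap]
    exact hirr.separable.map
  have hdeg : p.natDegree = n := by rw [hp, natDegree_map_eq_of_injective hinj, hfn]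
  have hlc : p.leadingCoeff = (f.leadingCoeff : ℂ) := by
    rw [hp, leadingCoeff_map_of_injective hinj]; simp
  have hnd := nodup_roots hsep
  have hspl := IsAlgClosed.splits p
  have hcard : p.roots.toFinset.card = n := by
    rw [Multiset.toFinset_card_of_nodup hnd, ← hspl.natDegree_eq_card_roots, hdeg]
  let e : Fin n ≃ p.roots.toFinset := (p.roots.toFinset.equivFinOfCardEq hcard).symm
  refine ⟨fun i => e i, Subtype.val_injective.comp e.injective, fun i h0 => ?_, ?_⟩
  · have h1 : p.IsRoot 0 := by
      rw [← h0]
      exact (mem_roots hp0).mp (Multiset.mem_toFinset.mp (e i).2)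
    rw [IsRoot.def, hp, ← coeff_zero_eq_eval_zero, coeff_map, eq_intCast, Int.cast_eq_zero] at h1
    obtain ⟨g, hg⟩ := X_dvd_iff.mpr h1
    rcases hf.isUnit_or_isUnit hg with h | h
    · exact not_isUnit_X h
    · have := natDegree_eq_zero_of_isUnit h
      have h2 := congrArg natDegree hg
      rw [natDegree_X_mul h.ne_zero] at h2
      omega
  · rw [e.prod_comp (fun z : p.roots.toFinset => (X - C (z : ℂ))),
      Finset.prod_coe_sort p.roots.toFinset (fun z => X - C z), ← hlc]
    conv_lhs => rw [hspl.eq_prod_roots]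
    rw [Finset.prod, Multiset.toFinset_val, hnd.dedup]

theorem aeval_roots_param {f : ℤ[X]} {n : ℕ} {α : Fin n → ℂ}
    (hα : f.map (Int.castRingHom ℂ) = C (f.leadingCoeff : ℂ) * ∏ i, (X - C (α i))) (i : Fin n) :
    aeval (α i) f = 0 := by
  rw [aeval_def, ← eval_map]
  change eval (α i) (f.map (Int.castRingHom ℂ)) = 0
  rw [hα, eval_mul, eval_prod, Finset.prod_eq_zero (Finset.mem_univ i) (by simp), mul_zero]

theorem genDeg_iff_of_roots_param {f : ℤ[X]} (hf : f ≠ 0) {n : ℕ} (hfn : f.natDegree = n)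
    (hn : 2 ≤ n) {α : Fin n → ℂ} (hinj : Function.Injective α) (h0 : ∀ i, α i ≠ 0)
    (hα : f.map (Int.castRingHom ℂ) = C (f.leadingCoeff : ℂ) * ∏ i, (X - C (α i))) :
    GenDeg f ↔ ∃ k : Fin n → ℤ, k ≠ 0 ∧ ∏ i, α i ^ k i = 1 := by
  classical
  have hlc : (f.leadingCoeff : ℂ) ≠ 0 := by simpa using hf
  have hprod : ∏ i, (X - C (α i)) ≠ 0 := Finset.prod_ne_zero_iff.mpr fun i _ => X_sub_C_ne_zero _
  have hroots : nzRoots f = Finset.univ.image α := by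
    ext z
    simp only [nzRoots, hα, roots_C_mul _ hlc, Finset.mem_filter,
      Multiset.mem_toFinset, roots_prod _ _ hprod, roots_X_sub_C, Multiset.mem_bind,
      Multiset.mem_singleton, Finset.mem_image, Finset.mem_univ, true_and, Finset.mem_val]
    constructor
    · rintro ⟨⟨i, rfl⟩, -⟩
      exact ⟨i, rfl⟩
    · rintro ⟨i, rfl⟩
      exact ⟨⟨i, rfl⟩, h0 i⟩
  rw [GenDeg, hfn, and_iff_right hn, hroots, MulDep]
  constructor
  · rintro ⟨k, ⟨z, hz, hkz⟩, hk⟩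
    obtain ⟨i, -, rfl⟩ := Finset.mem_image.mp hz
    rw [Finset.prod_image fun i _ j _ h => hinj h] at hk
    exact ⟨fun i => k (α i), fun h => hkz (congrFun h i), hk⟩
  · rintro ⟨k, hk0, hk⟩
    obtain ⟨i, hi⟩ := Function.ne_iff.mp hk0
    refine ⟨Function.extend α k 0, ⟨α i, Finset.mem_image_of_mem _ (Finset.mem_univ i), ?_⟩, ?_⟩
    · rwa [hinj.extend_apply]
    · rw [Finset.prod_image fun i _ j _ h => hinj h, ← hk]
      simp_rw [hinj.extend_apply]

theorem irreducible_of_map_eq_X_add_one_pow {f : ℤ[X]} {n : ℕ} (hn : n ≠ 0) (hfn : f.natDegree = n)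
    (hprim : f.IsPrimitive) (hmap : f.map (Int.castRingHom (ZMod 2)) = (X + 1) ^ n)
    (h1 : f.eval 1 % 4 = 2) : Irreducible f := by
  have htm : (taylor 1 f).map (Int.castRingHom (ZMod 2)) = X ^ n := by
    rw [taylor_apply, Polynomial.map_comp, hmap]
    simp only [Polynomial.map_add, map_X, Polynomial.map_one, pow_comp, add_comp, X_comp,
      one_comp, map_one]
    rw [add_assoc, CharTwo.add_self_eq_zero, add_zero]
  have hcoeff (i : ℕ) : (2 : ℤ) ∣ (taylor 1 f).coeff i ↔ i ≠ n := by
    have h := congrArg (fun p => coeff p i) htm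
    simp only [coeff_map, eq_intCast, coeff_X_pow] at h
    have h2 := ZMod.intCast_zmod_eq_zero_iff_dvd ((taylor 1 f).coeff i) 2
    rw [h] at h2
    rw [show (2 : ℤ) = (2 : ℕ) by rfl, ← h2]
    split_ifs with hi <;> simp [hi]
  have hprime : (Ideal.span {(2 : ℤ)}).IsPrime :=
    (Ideal.span_singleton_prime two_ne_zero).mpr Int.prime_two
  have htn : (taylor 1 f).natDegree = n := by rw [natDegree_taylor, hfn]
  have hirr : Irreducible (taylor 1 f) := by
    refine irreducible_of_eisenstein_criterion hprime ?_ ?_ ?_ ?_ ?_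
    · rw [Ideal.mem_span_singleton, leadingCoeff, htn, hcoeff]
      simp
    · intro i hi
      rw [Ideal.mem_span_singleton, hcoeff]
      have := coe_lt_degree.mp hi
      omega
    · exact natDegree_pos_iff_degree_pos.mp (by omega)
    · rw [Ideal.span_singleton_pow, Ideal.mem_span_singleton, taylor_coeff_zero]
      omega
    · intro r hr
      have : C r ∣ taylor (-1) (taylor 1 f) := by
        obtain ⟨g, hg⟩ := hr
        exact ⟨taylor (-1) g, by rw [hg, taylor_mul, taylor_C]⟩
      rw [taylor_taylor] at this
      simp only [neg_add_cancel, taylor_zero] at this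
      exact hprim r this
  exact (MulEquiv.irreducible_iff (taylorEquiv (1 : ℤ))).mp hirr

/-- Irreducible integer polynomials of bounded height whose leading and constant coefficients
coincide. -/
def balancedSet (n H : ℕ) : Set ℤ[X] :=
  {f | f.natDegree = n ∧ HeightLe f H ∧ Irreducible f ∧ f.coeff 0 = f.coeff n}

theorem balancedSet_subset_IstarSet {n : ℕ} (hn : 2 ≤ n) (H : ℕ) :
    balancedSet n H ⊆ IstarSet n H := by
  rintro f ⟨hfn, hfH, hirr, h0⟩
  refine ⟨hfn, hfH, hirr, ?_⟩
  obtain ⟨α, hinj, hα0, hα⟩ := exists_roots_param hirr hfn hn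
  refine (genDeg_iff_of_roots_param hirr.ne_zero hfn hn hinj hα0 hα).mpr ⟨fun _ => 2, ?_, ?_⟩
  · intro h
    simpa using congrFun h ⟨0, by omega⟩
  · have hlc : (f.leadingCoeff : ℂ) ≠ 0 := by simpa using hirr.ne_zero
    have h1 := congrArg (eval 0) hα
    rw [← coeff_zero_eq_eval_zero, coeff_map, h0,
      show f.coeff n = f.leadingCoeff by rw [leadingCoeff, hfn]] at h1
    simp only [eq_intCast, eval_mul, eval_C, eval_prod, eval_sub, eval_X, zero_sub] at h1
    rw [left_eq_mul₀ hlc, Finset.prod_neg] at h1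
    rw [Finset.prod_zpow, show (2 : ℤ) = (2 : ℕ) by rfl, zpow_natCast]
    have h2 := congrArg (· ^ 2) h1
    simp only [mul_pow, ← pow_mul, one_pow] at h2
    rwa [mul_comm _ 2, pow_mul, neg_one_sq, one_pow, one_mul] at h2

theorem finite_and_ncard_le_of_coeff_injOn {s : Set ℤ[X]} {N H : ℕ} (hs : ∀ f ∈ s, HeightLe f H)
    (hinj : Set.InjOn (fun (f : ℤ[X]) (i : Fin N) => f.coeff i) s) :
    s.Finite ∧ s.ncard ≤ (2 * H + 1) ^ N := by
  classical
  set T : Finset (Fin N → ℤ) := Fintype.piFinset fun _ => Finset.Icc (-(H : ℤ)) H with hT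
  have hmaps : ∀ f ∈ s, (fun i : Fin N => f.coeff i) ∈ (T : Set (Fin N → ℤ)) := by
    intro f hf
    simp only [hT, Finset.mem_coe, Fintype.mem_piFinset, Finset.mem_Icc]
    exact fun i => abs_le.mp (hs f hf i)
  refine ⟨Set.Finite.of_injOn hmaps hinj T.finite_toSet, ?_⟩
  refine (Set.ncard_le_ncard_of_injOn _ hmaps hinj T.finite_toSet).trans (le_of_eq ?_)
  rw [Set.ncard_coe_finset, hT, Fintype.card_piFinset_const, Int.card_Icc]
  congr 1
  omega

theorem finite_IstarSet (n H : ℕ) : (IstarSet n H).Finite := by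
  refine (finite_and_ncard_le_of_coeff_injOn (N := n + 1) (H := H) (fun f hf => hf.2.1) ?_).1
  intro f hf g hg hfg
  ext i
  rcases lt_or_ge i (n + 1) with hi | hi
  · exact congrFun hfg ⟨i, hi⟩
  · rw [coeff_eq_zero_of_natDegree_lt (by have := hf.1; omega),
      coeff_eq_zero_of_natDegree_lt (by have := hg.1; omega)]

theorem finite_balancedSet_and_ncard_le {n : ℕ} (hn : 2 ≤ n) (H : ℕ) :
    (balancedSet n H).Finite ∧ (balancedSet n H).ncard ≤ (2 * H + 1) ^ n := by
  refine finite_and_ncard_le_of_coeff_injOn (fun f hf => hf.2.1) ?_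
  intro f hf g hg hfg
  ext i
  rcases lt_trichotomy i n with hi | rfl | hi
  · exact congrFun hfg ⟨i, hi⟩
  · rw [← hf.2.2.2, ← hg.2.2.2]
    exact congrFun hfg ⟨0, by omega⟩
  · rw [coeff_eq_zero_of_natDegree_lt (by have := hf.1; omega),
      coeff_eq_zero_of_natDegree_lt (by have := hg.1; omega)]

/-- Polynomials with equal leading and constant coefficients whose primitive part is Eisenstein
at `2` after the shift `X ↦ X + 1`. -/
def shiftedEisensteinSet (n H : ℕ) : Set ℤ[X] :=
  {f | f.natDegree = n ∧ HeightLe f H ∧ f.coeff 0 = f.coeff n ∧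
    f.map (Int.castRingHom (ZMod 2)) = (X + 1) ^ n ∧ f.eval 1 % 4 = 2}

theorem shiftedEisensteinSet_subset {n : ℕ} (hn : 2 ≤ n) (H : ℕ) :
    shiftedEisensteinSet n H ⊆
      ⋃ d ∈ Finset.Icc 1 H, (fun g => C (d : ℤ) * g) '' balancedSet n (H / d) := by
  rintro f ⟨hfn, hfH, h0, hmap, h1⟩
  have hf0 : f ≠ 0 := by rintro rfl; simp at hfn; omega
  obtain ⟨c, hc⟩ :=
    Int.eq_ofNat_of_zero_le (Int.nonneg_of_normalize_eq_self (normalize_content (p := f)))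
  set g := f.primPart with hg
  have hfg : f = C (c : ℤ) * g := by rw [← hc]; exact f.eq_C_content_mul_primPart
  have hcoeff (i : ℕ) : f.coeff i = c * g.coeff i := by
    conv_lhs => rw [hfg]
    rw [coeff_C_mul]
  have hlead : ((f.coeff n : ℤ) : ZMod 2) = 1 := by
    have h := congrArg (fun p => coeff p n) hmap
    simp only [coeff_map, eq_intCast] at h
    rw [h, show (X + 1 : (ZMod 2)[X]) = X + C 1 by simp, coeff_X_add_C_pow]
    simp
  have hcc : (c : ZMod 2) = 1 := by
    have h := hlead
    rw [hcoeff] at h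
    push_cast at h
    generalize (c : ZMod 2) = a at h ⊢
    generalize ((g.coeff n : ℤ) : ZMod 2) = b at h
    revert a b
    decide
  have hcodd : c % 2 = 1 := by
    rw [← Nat.cast_one, ZMod.natCast_eq_natCast_iff] at hcc
    exact hcc
  have hcH : c ≤ H := by
    have h2 := hfH n
    have h3 : f.coeff n ≠ 0 := by rintro h; rw [h] at hlead; simp at hlead
    have h4 : (c : ℤ) ∣ f.coeff n := ⟨_, hcoeff n⟩
    have h5 := Int.le_of_dvd (abs_pos.mpr h3) ((dvd_abs _ _).mpr h4)
    omega
  have hgn : g.natDegree = n := by rw [hg, natDegree_primPart, hfn]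
  have hg1 : g.eval 1 % 4 = 2 := by
    rw [hfg, eval_mul, eval_C, Int.mul_emod] at h1
    have h2 : (c : ℤ) % 4 = 1 ∨ (c : ℤ) % 4 = 3 := by omega
    rcases h2 with h2 | h2 <;> rw [h2] at h1 <;> omega
  have hgmap : g.map (Int.castRingHom (ZMod 2)) = (X + 1) ^ n := by
    rw [← hmap, hfg, Polynomial.map_mul, map_C]
    simp [hcc]
  simp only [Set.mem_iUnion]
  refine ⟨c, Finset.mem_Icc.mpr ⟨by omega, hcH⟩, g, ⟨hgn, fun i => ?_, ?_, ?_⟩, hfg.symm⟩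
  · have h2 := hfH i
    rw [hcoeff, abs_mul, Nat.abs_cast] at h2
    push_cast
    rw [Int.le_ediv_iff_mul_le (by omega)]
    linarith
  · exact irreducible_of_map_eq_X_add_one_pow (by omega) hgn f.isPrimitive_primPart hgmap hg1
  · have h2 := h0
    rw [hcoeff, hcoeff] at h2
    exact mul_left_cancel₀ (by omega) h2

theorem finite_shiftedEisensteinSet (n H : ℕ) : (shiftedEisensteinSet n H).Finite := by
  refine (finite_and_ncard_le_of_coeff_injOn (N := n + 1) (H := H) (fun f hf => hf.2.1) ?_).1
  intro f hf g hg hfg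
  ext i
  rcases lt_or_ge i (n + 1) with hi | hi
  · exact congrFun hfg ⟨i, hi⟩
  · rw [coeff_eq_zero_of_natDegree_lt (by have := hf.1; omega),
      coeff_eq_zero_of_natDegree_lt (by have := hg.1; omega)]

theorem mem_shiftedEisensteinSet {n H : ℕ} (hn : 2 ≤ n) {a : ℕ → ℤ}
    (ha : ∀ i < n, a i % 4 = ((X + 1) ^ n + C 2 * X : ℤ[X]).coeff i % 4) (han : a n = a 0)
    (haH : ∀ i, |a i| ≤ H) :
    ∑ i ∈ Finset.range (n + 1), C (a i) * X ^ i ∈ shiftedEisensteinSet n H := by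
  set B : ℤ[X] := (X + 1) ^ n + C 2 * X with hB
  set f : ℤ[X] := ∑ i ∈ Finset.range (n + 1), C (a i) * X ^ i with hf
  have hcoeff (i : ℕ) : f.coeff i = if i < n + 1 then a i else 0 := by
    rw [hf, finsetSum_coeff]
    simp [coeff_X_pow]
  have hX (i : ℕ) : ((X + 1 : ℤ[X]) ^ n).coeff i = n.choose i := by
    rw [coeff_X_add_one_pow]
  have hB0 : B.coeff 0 = 1 := by simp [hB, hX]
  have hBn : B.coeff n = 1 := by
    rw [hB, coeff_add, hX, coeff_C_mul, coeff_X_of_ne_one (by omega)]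
    simp
  have hdvd : C 4 ∣ f - B := by
    rw [C_dvd_iff_dvd_coeff]
    intro i
    rw [coeff_sub, hcoeff]
    rcases lt_trichotomy i n with hi | rfl | hi
    · rw [if_pos (by omega)]
      have := ha i hi
      omega
    · rw [if_pos (by omega), hBn, han]
      have := ha 0 (by omega)
      omega
    · rw [if_neg (by omega), hB, coeff_add, hX, coeff_C_mul, coeff_X_of_ne_one (by omega),
        Nat.choose_eq_zero_of_lt hi]
      simp
  obtain ⟨u, hu⟩ := hdvd
  have hfB : f = B + C 4 * u := by rw [← hu]; ring
  refine ⟨?_, fun i => ?_, ?_, ?_, ?_⟩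
  · refine natDegree_eq_of_le_of_coeff_ne_zero ?_ ?_
    · refine natDegree_le_iff_coeff_eq_zero.mpr fun i hi => ?_
      rw [hcoeff, if_neg (by omega)]
    · rw [hcoeff, if_pos (by omega), han]
      intro h
      have := ha 0 (by omega)
      omega
  · rw [hcoeff]
    split_ifs
    · exact haH i
    · simp
  · rw [hcoeff, hcoeff, if_pos (by omega), if_pos (by omega), han]
  · rw [hfB, hB]
    have h2 : Int.castRingHom (ZMod 2) 2 = 0 := by decide
    have h4 : Int.castRingHom (ZMod 2) 4 = 0 := by decide
    rw [Polynomial.map_add, Polynomial.map_add, Polynomial.map_mul, Polynomial.map_mul, map_C,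
      map_C, h2, h4]
    simp
  · rw [hfB, hB]
    simp only [eval_add, eval_mul, eval_pow, eval_X, eval_one, eval_C]
    obtain ⟨m, rfl⟩ := Nat.exists_eq_add_of_le hn
    rw [pow_add]
    omega

theorem pow_le_ncard_shiftedEisensteinSet {n : ℕ} (hn : 2 ≤ n) {H : ℕ} (hH : 3 ≤ H) :
    ((H - 3) / 4 + 1) ^ n ≤ (shiftedEisensteinSet n H).ncard := by
  classical
  set B : ℤ[X] := (X + 1) ^ n + C 2 * X with hB
  set T := (H - 3) / 4 with hT
  let a (t : Fin n → ℕ) (i : ℕ) : ℤ :=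
    if h : i < n then B.coeff i % 4 + 4 * t ⟨i, h⟩ else B.coeff 0 % 4 + 4 * t ⟨0, by omega⟩
  let F (t : Fin n → ℕ) : ℤ[X] := ∑ i ∈ Finset.range (n + 1), C (a t i) * X ^ i
  have ha (t : Fin n → ℕ) (i : ℕ) (hi : i < n) : a t i = B.coeff i % 4 + 4 * t ⟨i, hi⟩ :=
    dif_pos hi
  have hmaps : ∀ t ∈ (Fintype.piFinset fun _ : Fin n => Finset.range (T + 1) : Set (Fin n → ℕ)),
      F t ∈ shiftedEisensteinSet n H := by
    intro t ht
    have ht' (i : Fin n) : t i ≤ T := by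
      have := Fintype.mem_piFinset.mp (Finset.mem_coe.mp ht) i
      rw [Finset.mem_range] at this
      omega
    refine mem_shiftedEisensteinSet hn (fun i hi => ?_) ?_ fun i => ?_
    · rw [ha t i hi, ← hB]
      omega
    · rw [ha t 0 (by omega)]
      exact dif_neg (lt_irrefl n)
    · rw [abs_le]
      simp only [a]
      split_ifs with hi
      · have := ht' ⟨i, hi⟩
        omega
      · have := ht' ⟨0, by omega⟩
        omega
  have hinj : Set.InjOn F (Fintype.piFinset fun _ : Fin n => Finset.range (T + 1) : Set _) := by
    intro t _ t' _ h
    funext i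
    have h1 := congrArg (fun p => coeff p i) h
    simp only [F, finsetSum_coeff, coeff_C_mul, coeff_X_pow, mul_ite, mul_one, mul_zero,
      Finset.sum_ite_eq, Finset.mem_range, show (i : ℕ) < n + 1 by omega, if_true] at h1
    rw [ha t i i.2, ha t' i i.2] at h1
    simp only [Fin.eta] at h1
    omega
  have h := Set.ncard_le_ncard_of_injOn F hmaps hinj (finite_shiftedEisensteinSet n H)
  rwa [Set.ncard_coe_finset, Fintype.card_piFinset_const, Finset.card_range] at h

theorem ncard_shiftedEisensteinSet_le {n : ℕ} (hn : 2 ≤ n) (H : ℕ) :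
    (shiftedEisensteinSet n H).ncard ≤ ∑ d ∈ Finset.Icc 1 H, (balancedSet n (H / d)).ncard := by
  have hfin (d : ℕ) := (finite_balancedSet_and_ncard_le hn (H / d)).1
  calc _ ≤ (⋃ d ∈ Finset.Icc 1 H, (fun g => C (d : ℤ) * g) '' balancedSet n (H / d)).ncard :=
        Set.ncard_le_ncard (shiftedEisensteinSet_subset hn H)
          ((Finset.Icc 1 H).finite_toSet.biUnion fun d _ => (hfin d).image _)
    _ ≤ ∑ d ∈ Finset.Icc 1 H, ((fun g => C (d : ℤ) * g) '' balancedSet n (H / d)).ncard :=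
        Finset.set_ncard_biUnion_le _ _
    _ ≤ _ := Finset.sum_le_sum fun d _ => Set.ncard_image_le (hfin d)

theorem balancedSet_mono (n : ℕ) {H H' : ℕ} (h : H ≤ H') : balancedSet n H ⊆ balancedSet n H' :=
  fun _ hf => ⟨hf.1, fun i => (hf.2.1 i).trans (by exact_mod_cast h), hf.2.2⟩

theorem exists_le_ncard_balancedSet {n : ℕ} (hn : 2 ≤ n) : ∃ c : ℝ, 0 < c ∧ ∀ H : ℕ, 3 ≤ H →
    c * (H : ℝ) ^ n ≤ (balancedSet n H).ncard := by
  set D : ℕ := 2 * 36 ^ n with hD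
  have hD0 : 0 < D := by positivity
  have hDR : (0 : ℝ) < D := by exact_mod_cast hD0
  refine ⟨(1 / 12) ^ n / (2 * D), by positivity, fun H hH => ?_⟩
  obtain ⟨N, hN⟩ : ∃ N : ℝ, N = (balancedSet n H).ncard := ⟨_, rfl⟩
  have hHR : (3 : ℝ) ≤ H := by exact_mod_cast hH
  have hterm (d : ℕ) (hd : d ∈ Finset.Icc 1 H) :
      ((balancedSet n (H / d)).ncard : ℝ) ≤ (if d ∈ Finset.Icc 1 D then N else 0) +
        (if d ∈ Finset.Ioc D H then (3 * H : ℝ) ^ n * ((d : ℝ) ^ 2)⁻¹ else 0) := by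
    rw [Finset.mem_Icc] at hd
    rcases le_or_gt d D with hdD | hdD
    · rw [if_pos (Finset.mem_Icc.mpr ⟨hd.1, hdD⟩), if_neg (by simp; omega), add_zero, hN]
      exact_mod_cast Set.ncard_le_ncard (balancedSet_mono n (Nat.div_le_self H d))
        (finite_balancedSet_and_ncard_le hn H).1
    · rw [if_neg (by simp; omega), if_pos (Finset.mem_Ioc.mpr ⟨hdD, hd.2⟩), zero_add]
      have hdR : (1 : ℝ) ≤ d := by exact_mod_cast hd.1
      have h1 : ((balancedSet n (H / d)).ncard : ℝ) ≤ (3 * (H / d : ℕ) : ℝ) ^ n := by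
        have h2 := (finite_balancedSet_and_ncard_le hn (H / d)).2
        have h3 : 1 ≤ H / d := (Nat.one_le_div_iff (by omega)).mpr hd.2
        exact_mod_cast h2.trans (Nat.pow_le_pow_left (by omega) n)
      calc _ ≤ _ := h1
        _ ≤ (3 * (H / d) : ℝ) ^ n := by gcongr; exact Nat.cast_div_le
        _ = (3 * H : ℝ) ^ n * ((d : ℝ) ^ n)⁻¹ := by rw [← mul_div_assoc, div_pow, div_eq_mul_inv]
        _ ≤ _ := by gcongr
  have hsum : (((H - 3) / 4 + 1 : ℕ) : ℝ) ^ n ≤ D * N + (3 * H) ^ n * (1 / D) := by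
    calc (((H - 3) / 4 + 1 : ℕ) : ℝ) ^ n
        ≤ ∑ d ∈ Finset.Icc 1 H, ((balancedSet n (H / d)).ncard : ℝ) := by
          exact_mod_cast (pow_le_ncard_shiftedEisensteinSet hn hH).trans
            (ncard_shiftedEisensteinSet_le hn H)
      _ ≤ _ := Finset.sum_le_sum hterm
      _ ≤ D * N + (3 * H) ^ n * (1 / D) := by
          rw [Finset.sum_add_distrib, ← Finset.sum_filter, ← Finset.sum_filter]
          gcongr
          · rw [Finset.sum_const, nsmul_eq_mul]
            gcongr
            · exact hN ▸ Nat.cast_nonneg _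
            · calc _ ≤ (Finset.Icc 1 D).card :=
                    Finset.card_le_card fun d hd => (Finset.mem_filter.mp hd).2
                _ = D := by simp
          · rw [← Finset.mul_sum]
            gcongr
            calc _ ≤ ∑ d ∈ Finset.Ioc D H, ((d : ℝ) ^ 2)⁻¹ :=
                  Finset.sum_le_sum_of_subset_of_nonneg (fun d hd => (Finset.mem_filter.mp hd).2)
                    fun _ _ _ => by positivity
              _ ≤ 1 / D := by
                rcases le_or_gt D H with h | h
                · have := sum_Ioc_inv_sq_le_sub (α := ℝ) hD0.ne' h
                  have h2 : (0 : ℝ) ≤ (H : ℝ)⁻¹ := by positivity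
                  rw [one_div]
                  linarith
                · rw [Finset.Ioc_eq_empty (by omega), Finset.sum_empty]
                  positivity
  have hlow : ((H : ℝ) / 12) ^ n ≤ (((H - 3) / 4 + 1 : ℕ) : ℝ) ^ n := by
    gcongr
    rw [div_le_iff₀ (by norm_num)]
    exact_mod_cast (by omega : H ≤ ((H - 3) / 4 + 1) * 12)
  have h36 : (3 * H : ℝ) ^ n * (1 / D) = ((H : ℝ) / 12) ^ n / 2 := by
    rw [hD, show (3 * H : ℝ) = 36 * (H / 12) by ring, mul_pow]
    push_cast
    field_simp
  rw [div_mul_eq_mul_div, div_le_iff₀ (by positivity), ← mul_pow, one_div_mul_eq_div, ← hN]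
  rw [h36] at hsum
  linarith

theorem Finsupp.apply_zero_le_of_toLex_le {n : ℕ} [NeZero n] {a b : Lex (Fin n →₀ ℕ)} (h : a ≤ b) :
    ofLex a 0 ≤ ofLex b 0 := by
  rcases h.lt_or_eq with h | rfl
  · obtain ⟨i, hi, hlt⟩ := Finsupp.Lex.lt_iff.mp h
    rcases eq_or_ne i 0 with rfl | h0
    · exact hlt.le
    · exact (hi 0 (Fin.pos_iff_ne_zero.mpr h0)).le
  · exact le_rfl

theorem totalDegree_le_degreeOf_aeval_esymm {R : Type*} [CommRing R] {n : ℕ} [NeZero n]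
    (P : MvPolynomial (Fin n) R) : P.totalDegree ≤
      (MvPolynomial.aeval (fun i : Fin n => MvPolynomial.esymm (Fin n) R (i + 1)) P).degreeOf 0 := by
  classical
  rcases eq_or_ne P 0 with rfl | hP
  · simp
  set F : (Fin n →₀ ℕ) → MvPolynomial (Fin n) R :=
    fun t => MvPolynomial.esymmAlgHomMonomial (Fin n) t (P.coeff t) with hF
  have hsum : MvPolynomial.aeval (fun i : Fin n => MvPolynomial.esymm (Fin n) R (i + 1)) P
      = ∑ t ∈ P.support, F t := by
    conv_lhs => rw [P.as_sum, map_sum]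
    exact Finset.sum_congr rfl fun t _ => (MvPolynomial.esymmAlgHom_apply _).symm
  have hdeg (t) (ht : t ∈ P.support) :
      ofLex (AddMonoidAlgebra.supDegree toLex (F t)) = Fin.accumulate n n t :=
    MvPolynomial.supDegree_esymmAlgHomMonomial (MvPolynomial.mem_support_iff.mp ht) t le_rfl
  obtain ⟨s, hs, hmax⟩ := Finset.exists_max_image P.support
    (fun t => AddMonoidAlgebra.supDegree toLex (F t)) (MvPolynomial.support_nonempty.mpr hP)
  have hlt : ∀ t ∈ P.support, t ≠ s → AddMonoidAlgebra.supDegree toLex (F t) <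
      AddMonoidAlgebra.supDegree toLex (F s) := by
    intro t ht hts
    refine (hmax t ht).lt_of_ne fun h => hts ?_
    apply DFunLike.ext'
    apply Fin.accumulate_injective le_rfl
    rw [← hdeg t ht, ← hdeg s hs, h]
  have hsup := (AddMonoidAlgebra.supDegree_leadingCoeff_sum_eq hs hlt).1
  have hFs : F s ≠ 0 := by
    rw [Ne, ← AddMonoidAlgebra.leadingCoeff_eq_zero toLex.injective, hF,
      MvPolynomial.leadingCoeff_esymmAlgHomMonomial s le_rfl]
    exact MvPolynomial.mem_support_iff.mp hs
  have hne : ∑ t ∈ P.support, F t ≠ 0 := by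
    rw [Ne, ← AddMonoidAlgebra.leadingCoeff_eq_zero toLex.injective,
      (AddMonoidAlgebra.supDegree_leadingCoeff_sum_eq hs hlt).2,
      AddMonoidAlgebra.leadingCoeff_eq_zero toLex.injective]
    exact hFs
  obtain ⟨u, hu, hue⟩ := AddMonoidAlgebra.exists_supDegree_mem_support toLex hne
  have hu0 : u 0 = ofLex (AddMonoidAlgebra.supDegree toLex (F s)) 0 := by
    rw [← hsup, hue]; rfl
  have hacc (t : Fin n →₀ ℕ) : Fin.accumulate n n t 0 = t.sum fun _ e => e := by
    rw [Fin.accumulate_apply, Finsupp.sum_fintype _ _ (by simp)]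
    refine Finset.sum_congr ?_ fun _ _ => rfl
    ext i
    simp
  rw [hsum]
  refine Finset.sup_le fun t ht => ?_
  calc t.sum (fun _ e => e) = ofLex (AddMonoidAlgebra.supDegree toLex (F t)) 0 := by
        rw [← hacc, hdeg t ht]
    _ ≤ ofLex (AddMonoidAlgebra.supDegree toLex (F s)) 0 :=
        Finsupp.apply_zero_le_of_toLex_le (hmax t ht)
    _ = u 0 := hu0.symm
    _ ≤ _ := MvPolynomial.monomial_le_degreeOf 0 hu

theorem card_zeros_piFinset_le {R : Type*} [CommRing R] [IsDomain R] [DecidableEq R] {n : ℕ}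
    (hn : 1 ≤ n) {P : MvPolynomial (Fin n) R} (hP : P ≠ 0) (S : Finset R) :
    ((Fintype.piFinset fun _ : Fin n => S).filter fun x => MvPolynomial.eval x P = 0).card
      ≤ P.totalDegree * S.card ^ (n - 1) := by
  have h := MvPolynomial.schwartz_zippel_totalDegree hP S
  rcases S.eq_empty_or_nonempty with rfl | hS
  · have : NeZero n := ⟨by omega⟩
    simp
  · have hpos : (0 : ℚ≥0) < S.card := by exact_mod_cast hS.card_pos
    rw [div_le_iff₀ (by positivity), div_mul_eq_mul_div, le_div_iff₀ hpos] at h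
    have h2 : (S.card : ℚ≥0) ^ n = S.card ^ (n - 1) * S.card := by
      rw [← pow_succ, Nat.sub_add_cancel hn]
    rw [h2, ← mul_assoc] at h
    exact_mod_cast le_of_mul_le_mul_right h hpos

/-- The binomial expressing `∏ xᵢ ^ kᵢ = 1` after clearing denominators. -/
noncomputable def relationPoly {n : ℕ} (k : Fin n → ℤ) : MvPolynomial (Fin n) ℂ :=
  MvPolynomial.monomial (Finsupp.equivFunOnFinite.symm fun i => (k i).toNat) 1 -
    MvPolynomial.monomial (Finsupp.equivFunOnFinite.symm fun i => (-k i).toNat) 1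

theorem relationPoly_ne_zero {n : ℕ} {k : Fin n → ℤ} (hk : k ≠ 0) : relationPoly k ≠ 0 := by
  obtain ⟨i, hi⟩ := Function.ne_iff.mp hk
  rw [relationPoly, sub_ne_zero]
  intro h
  have h1 := MvPolynomial.monomial_left_injective one_ne_zero h
  have h2 := congrFun (Finsupp.equivFunOnFinite.symm.injective h1) i
  simp only [Pi.zero_apply] at hi h2
  omega

theorem eval_relationPoly {n : ℕ} {k : Fin n → ℤ} {α : Fin n → ℂ} (hα : ∀ i, α i ≠ 0)
    (h : ∏ i, α i ^ k i = 1) : MvPolynomial.eval α (relationPoly k) = 0 := by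
  simp only [relationPoly, map_sub, MvPolynomial.eval_monomial, one_mul]
  rw [Finsupp.prod_fintype _ _ (by simp), Finsupp.prod_fintype _ _ (by simp), sub_eq_zero]
  simp only [Finsupp.equivFunOnFinite_symm_apply_apply]
  rw [← div_eq_one_iff_eq (Finset.prod_ne_zero_iff.mpr fun i _ => pow_ne_zero _ (hα i)),
    ← Finset.prod_div_distrib, ← h]
  refine Finset.prod_congr rfl fun i _ => ?_
  rw [← zpow_natCast, ← zpow_natCast, ← zpow_sub₀ (hα i)]
  congr 1
  omega

theorem degreeOf_relationPoly_le {n : ℕ} {k : Fin n → ℤ} {K : ℕ} (hk : ∀ i, |k i| ≤ K)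
    (i : Fin n) : (relationPoly k).degreeOf i ≤ K := by
  refine (MvPolynomial.degreeOf_sub_le _ _ _).trans (max_le ?_ ?_)
  all_goals
    rw [MvPolynomial.degreeOf_monomial_eq _ _ one_ne_zero,
      Finsupp.equivFunOnFinite_symm_apply_apply]
    have := abs_le.mp (hk i)
    omega

theorem exists_esymm_relation_poly {n : ℕ} [NeZero n] {k : Fin n → ℤ} (hk : k ≠ 0) {K : ℕ}
    (hkK : ∀ i, |k i| ≤ K) : ∃ P : MvPolynomial (Fin n) ℂ, P ≠ 0 ∧ P.totalDegree ≤ n.factorial * K ∧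
      ∀ α : Fin n → ℂ, (∀ i, α i ≠ 0) → ∏ i, α i ^ k i = 1 →
        MvPolynomial.eval (fun i : Fin n => (Finset.univ.val.map α).esymm (i + 1)) P = 0 := by
  set G : MvPolynomial (Fin n) ℂ :=
    ∏ σ : Equiv.Perm (Fin n), MvPolynomial.rename σ (relationPoly k) with hG
  have hsymm : G.IsSymmetric := by
    intro τ
    rw [hG, map_prod]
    simp_rw [MvPolynomial.rename_rename]
    exact Fintype.prod_equiv (Equiv.mulLeft τ) _ _ fun σ => rfl
  have hG0 : G ≠ 0 := by
    refine Finset.prod_ne_zero_iff.mpr fun σ _ h => relationPoly_ne_zero hk ?_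
    exact MvPolynomial.rename_injective _ σ.injective (by rw [h, map_zero])
  obtain ⟨P, hP⟩ := (MvPolynomial.esymmAlgHom_fin_bijective ℂ n).2 ⟨G, hsymm⟩
  have hPG : MvPolynomial.aeval (fun i : Fin n => MvPolynomial.esymm (Fin n) ℂ (i + 1)) P = G := by
    rw [← MvPolynomial.esymmAlgHom_apply, hP]
  refine ⟨P, ?_, ?_, fun α hα hrel => ?_⟩
  · rintro rfl
    exact hG0 (by rw [← hPG, map_zero])
  · refine (totalDegree_le_degreeOf_aeval_esymm P).trans ?_
    rw [hPG]
    refine (MvPolynomial.degreeOf_prod_le _ _ _).trans ?_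
    calc _ ≤ ∑ _σ : Equiv.Perm (Fin n), K := Finset.sum_le_sum fun σ _ => ?_
      _ = n.factorial * K := by simp [Fintype.card_perm]
    rw [← σ.apply_symm_apply 0, MvPolynomial.degreeOf_rename_of_injective σ.injective]
    exact degreeOf_relationPoly_le hkK _
  · have h1 : MvPolynomial.eval α G = 0 := by
      rw [hG, map_prod]
      refine Finset.prod_eq_zero (Finset.mem_univ 1) ?_
      rw [Equiv.Perm.coe_one, MvPolynomial.rename_id_apply]
      exact eval_relationPoly hα hrel
    rw [← hPG] at h1
    have h2 : (MvPolynomial.eval α).comp (MvPolynomial.aeval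
        (fun i : Fin n => MvPolynomial.esymm (Fin n) ℂ (i + 1))).toRingHom
        = MvPolynomial.eval (fun i : Fin n => (Finset.univ.val.map α).esymm (i + 1)) := by
      ext i
      · simp
      · simp only [AlgHom.toRingHom_eq_coe, RingHom.coe_comp, RingHom.coe_coe, Function.comp_apply,
          MvPolynomial.aeval_X, MvPolynomial.eval_X]
        rw [← MvPolynomial.aeval_esymm_eq_multiset_esymm (Fin n) ℂ _ α, MvPolynomial.aeval_eq_eval]
    rw [← h2]
    exact h1

/-- Integer polynomials of bounded height and given leading coefficient whose nonzero roots satisfy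
a given multiplicative relation. -/
def relationSet (n H : ℕ) (a : ℤ) (k : Fin n → ℤ) : Set ℤ[X] :=
  {f | f.natDegree = n ∧ HeightLe f H ∧ f.leadingCoeff = a ∧ ∃ α : Fin n → ℂ, (∀ i, α i ≠ 0) ∧
    f.map (Int.castRingHom ℂ) = C (f.leadingCoeff : ℂ) * ∏ i, (X - C (α i)) ∧ ∏ i, α i ^ k i = 1}

theorem esymm_roots_eq_coeff_div {f : ℤ[X]} (hf : f ≠ 0) {n : ℕ} {α : Fin n → ℂ}
    (hα : f.map (Int.castRingHom ℂ) = C (f.leadingCoeff : ℂ) * ∏ i, (X - C (α i))) (i : Fin n) :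
    (Finset.univ.val.map α).esymm (i + 1)
      = ((-1) ^ (i + 1 : ℕ) * f.coeff (n - 1 - i) : ℤ) / (f.leadingCoeff : ℂ) := by
  have hlc : (f.leadingCoeff : ℂ) ≠ 0 := by simpa using hf
  have hcard : Multiset.card (Finset.univ.val.map α) = n := by simp
  have h := Multiset.prod_X_sub_C_coeff (Finset.univ.val.map α) (k := n - 1 - i)
    (by rw [hcard]; omega)
  rw [hcard, show n - (n - 1 - i) = i + 1 by omega, Multiset.map_map] at h
  have h1 := congrArg (fun p => coeff p (n - 1 - i)) hα
  simp only [coeff_map, eq_intCast, coeff_C_mul] at h1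
  have hcoeff : coeff (∏ i, (X - C (α i))) (n - 1 - i)
      = (-1) ^ (i + 1 : ℕ) * (Finset.univ.val.map α).esymm (i + 1) := h
  rw [hcoeff] at h1
  rw [eq_div_iff hlc]
  push_cast
  rw [h1]
  have h2 : ((-1 : ℂ) ^ (i + 1 : ℕ)) * (-1) ^ (i + 1 : ℕ) = 1 := by
    rw [← mul_pow]; simp
  linear_combination (-(f.leadingCoeff : ℂ) * (Finset.univ.val.map α).esymm (i + 1)) * h2

theorem ncard_relationSet_le {n : ℕ} (hn : 1 ≤ n) (H : ℕ) {a : ℤ} (ha : a ≠ 0) {k : Fin n → ℤ}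
    (hk : k ≠ 0) {K : ℕ} (hkK : ∀ i, |k i| ≤ K) :
    (relationSet n H a k).Finite ∧
      (relationSet n H a k).ncard ≤ n.factorial * K * (2 * H + 1) ^ (n - 1) := by
  classical
  have : NeZero n := ⟨by omega⟩
  obtain ⟨P, hP0, hPdeg, hP⟩ := exists_esymm_relation_poly hk hkK
  have haC : (a : ℂ) ≠ 0 := by exact_mod_cast ha
  set S : Finset ℂ := (Finset.Icc (-(H : ℤ)) H).image fun c : ℤ => (c : ℂ) / a with hS
  have hScard : S.card ≤ 2 * H + 1 := by
    refine Finset.card_image_le.trans (le_of_eq ?_)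
    rw [Int.card_Icc]
    omega
  set Z := (Fintype.piFinset fun _ : Fin n => S).filter fun x => MvPolynomial.eval x P = 0 with hZ
  let φ (f : ℤ[X]) (i : Fin n) : ℂ := ((-1) ^ (i + 1 : ℕ) * f.coeff (n - 1 - i) : ℤ) / (a : ℂ)
  have hmaps : ∀ f ∈ relationSet n H a k, φ f ∈ (Z : Set (Fin n → ℂ)) := by
    rintro f ⟨hfn, hfH, rfl, α, hα0, hα, hrel⟩
    have hf : f ≠ 0 := by simpa using ha
    rw [Finset.mem_coe, hZ, Finset.mem_filter, Fintype.mem_piFinset]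
    refine ⟨fun i => Finset.mem_image_of_mem (fun c : ℤ => (c : ℂ) / f.leadingCoeff) ?_, ?_⟩
    · rw [Finset.mem_Icc, ← abs_le, abs_mul, abs_pow, abs_neg, abs_one, one_pow, one_mul]
      exact hfH _
    · rw [← hP α hα0 hrel]
      congr 2
      funext i
      exact (esymm_roots_eq_coeff_div hf hα i).symm
  have hinj : Set.InjOn φ (relationSet n H a k) := by
    intro f hf g hg h
    ext i
    rcases lt_trichotomy i n with hi | rfl | hi
    · have h1 := congrFun h ⟨n - 1 - i, by omega⟩
      simp only [φ] at h1
      rw [div_left_inj' haC, Int.cast_inj, show n - 1 - (n - 1 - i) = i by omega] at h1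
      exact mul_left_cancel₀ (pow_ne_zero _ (by norm_num)) h1
    · conv_lhs => rw [← hf.1, coeff_natDegree, hf.2.2.1]
      conv_rhs => rw [← hg.1, coeff_natDegree, hg.2.2.1]
    · rw [coeff_eq_zero_of_natDegree_lt (by have := hf.1; omega),
        coeff_eq_zero_of_natDegree_lt (by have := hg.1; omega)]
  refine ⟨Set.Finite.of_injOn hmaps hinj Z.finite_toSet, ?_⟩
  calc _ ≤ (Z : Set (Fin n → ℂ)).ncard :=
        Set.ncard_le_ncard_of_injOn _ hmaps hinj Z.finite_toSet
    _ = Z.card := Set.ncard_coe_finset _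
    _ ≤ P.totalDegree * S.card ^ (n - 1) := card_zeros_piFinset_le hn hP0 S
    _ ≤ _ := by gcongr

theorem ncard_IstarSet_le_of_bounded_relation {n : ℕ} (hn : 2 ≤ n) {H K : ℕ}
    (hK : ∀ f : ℤ[X], f ≠ 0 → f.natDegree ≤ n → (∀ i, |f.coeff i| ≤ H) →
      ∀ α : Fin n → ℂ, (∀ i, α i ≠ 0) → (∀ i, aeval (α i) f = 0) →
      ∀ k : Fin n → ℤ, k ≠ 0 → ∏ i, α i ^ k i = 1 →
      ∃ p : Fin n → ℤ, p ≠ 0 ∧ ∏ i, α i ^ p i = 1 ∧ ∀ i, |p i| ≤ K) :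
    (IstarSet n H).ncard ≤
      (2 * H + 1) * ((2 * K + 1) ^ n * (n.factorial * K * (2 * H + 1) ^ (n - 1))) := by
  classical
  set A : Finset ℤ := (Finset.Icc (-(H : ℤ)) H).filter (· ≠ 0) with hA
  set B : Finset (Fin n → ℤ) :=
    (Fintype.piFinset fun _ => Finset.Icc (-(K : ℤ)) K).filter (· ≠ 0) with hB
  have hAcard : A.card ≤ 2 * H + 1 := by
    refine (Finset.card_filter_le _ _).trans (le_of_eq ?_)
    rw [Int.card_Icc]
    omega
  have hBcard : B.card ≤ (2 * K + 1) ^ n := by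
    refine (Finset.card_filter_le _ _).trans (le_of_eq ?_)
    rw [Fintype.card_piFinset_const, Int.card_Icc]
    congr 1
    omega
  have hfin (a) (haA : a ∈ A) (k) (hkB : k ∈ B) : (relationSet n H a k).Finite ∧
      (relationSet n H a k).ncard ≤ n.factorial * K * (2 * H + 1) ^ (n - 1) := by
    obtain ⟨hk, hk0⟩ := Finset.mem_filter.mp hkB
    refine ncard_relationSet_le (by omega) H (Finset.mem_filter.mp haA).2 hk0 fun i => ?_
    exact abs_le.mpr (Finset.mem_Icc.mp (Fintype.mem_piFinset.mp hk i))
  have hsub : IstarSet n H ⊆ ⋃ a ∈ A, ⋃ k ∈ B, relationSet n H a k := by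
    rintro f ⟨hfn, hfH, hirr, hgen⟩
    obtain ⟨α, hinj, hα0, hα⟩ := exists_roots_param hirr hfn hn
    obtain ⟨k, hk0, hk⟩ := (genDeg_iff_of_roots_param hirr.ne_zero hfn hn hinj hα0 hα).mp hgen
    obtain ⟨p, hp0, hp, hpK⟩ := hK f hirr.ne_zero hfn.le hfH α hα0 (aeval_roots_param hα) k hk0 hk
    simp only [Set.mem_iUnion]
    refine ⟨f.leadingCoeff, ?_, p, ?_, hfn, hfH, rfl, α, hα0, hα, hp⟩
    · exact Finset.mem_filter.mpr ⟨Finset.mem_Icc.mpr (abs_le.mp (hfH _)),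
        leadingCoeff_ne_zero.mpr hirr.ne_zero⟩
    · exact Finset.mem_filter.mpr
        ⟨Fintype.mem_piFinset.mpr fun i => Finset.mem_Icc.mpr (abs_le.mp (hpK i)), hp0⟩
  calc (IstarSet n H).ncard ≤ (⋃ a ∈ A, ⋃ k ∈ B, relationSet n H a k).ncard :=
        Set.ncard_le_ncard hsub (A.finite_toSet.biUnion fun a ha =>
          B.finite_toSet.biUnion fun k hk => (hfin a ha k hk).1)
    _ ≤ ∑ a ∈ A, (⋃ k ∈ B, relationSet n H a k).ncard := Finset.set_ncard_biUnion_le _ _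
    _ ≤ ∑ a ∈ A, ∑ k ∈ B, (relationSet n H a k).ncard :=
        Finset.sum_le_sum fun a _ => Finset.set_ncard_biUnion_le _ _
    _ ≤ ∑ a ∈ A, ∑ k ∈ B, n.factorial * K * (2 * H + 1) ^ (n - 1) :=
        Finset.sum_le_sum fun a ha => Finset.sum_le_sum fun k hk => (hfin a ha k hk).2
    _ = A.card * (B.card * (n.factorial * K * (2 * H + 1) ^ (n - 1))) := by
        simp only [Finset.sum_const, smul_eq_mul]
    _ ≤ _ := by gcongr

theorem exists_ncard_IstarSet_le {n : ℕ} (hn : 2 ≤ n) : ∃ c : ℝ, 0 < c ∧ ∀ H : ℕ, 3 ≤ H →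
    ((IstarSet n H).ncard : ℝ) ≤ c * (H : ℝ) ^ n * Real.log H ^ (2 * n ^ 2 - n - 1) := by
  obtain ⟨C₀, hC₀, hrel⟩ := exists_bounded_relation (n := n) (by omega)
  refine ⟨3 ^ n * (2 * C₀ + 1) ^ n * n.factorial * C₀, by positivity, fun H hH => ?_⟩
  have hHR : (3 : ℝ) ≤ H := by exact_mod_cast hH
  have hlog : 1 ≤ Real.log H := by
    rw [Real.le_log_iff_exp_le (by linarith)]
    linarith [Real.exp_one_lt_d9]
  set L := Real.log H ^ (n - 1) with hL
  have hL1 : 1 ≤ L := one_le_pow₀ hlog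
  obtain ⟨K, hK⟩ : ∃ K : ℕ, K = ⌊C₀ * L⌋₊ := ⟨_, rfl⟩
  have hKL : (K : ℝ) ≤ C₀ * L := hK ▸ Nat.floor_le (by positivity)
  have h := ncard_IstarSet_le_of_bounded_relation hn (H := H) (K := K)
    fun f hf hfn hfH α hα0 hroot k hk0 hk => by
      obtain ⟨p, hp0, hp, hpC⟩ :=
        hrel H (by exact_mod_cast hH) f hf hfn hfH α hα0 hroot k hk0 hk
      refine ⟨p, hp0, hp, fun i => ?_⟩
      have h1 : (((p i).natAbs : ℕ) : ℝ) ≤ C₀ * L := by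
        rw [Nat.cast_natAbs, Int.cast_abs]
        simpa using hpC i
      rw [Int.abs_eq_natAbs, hK]
      exact_mod_cast Nat.le_floor h1
  have h2H : (2 * H + 1 : ℝ) ≤ 3 * H := by linarith
  have h2K : (2 * K + 1 : ℝ) ≤ (2 * C₀ + 1) * L := by linarith
  have hpow : L ^ n * L ≤ Real.log H ^ (2 * n ^ 2 - n - 1) := by
    rw [hL, ← pow_succ, ← pow_mul]
    refine pow_le_pow_right₀ hlog ?_
    obtain ⟨m, rfl⟩ := Nat.exists_eq_add_of_le hn
    have : (2 + m - 1) * (2 + m + 1) + (2 + m + 1) ≤ 2 * (2 + m) ^ 2 := by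
      rw [show 2 + m - 1 = m + 1 by omega]
      nlinarith
    omega
  calc ((IstarSet n H).ncard : ℝ)
      ≤ (2 * H + 1) * ((2 * K + 1) ^ n * (n.factorial * K * (2 * H + 1) ^ (n - 1))) := by
        exact_mod_cast h
    _ ≤ (3 * H) * (((2 * C₀ + 1) * L) ^ n * (n.factorial * (C₀ * L) * (3 * H) ^ (n - 1))) := by
        gcongr
    _ = 3 ^ n * (2 * C₀ + 1) ^ n * n.factorial * C₀ * (H : ℝ) ^ n * (L ^ n * L) := by
        obtain ⟨m, rfl⟩ := Nat.exists_eq_add_of_le hn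
        rw [mul_pow (2 * C₀ + 1) L, show 2 + m - 1 = m + 1 by omega]
        generalize 2 * C₀ + 1 = b
        generalize L = l
        ring
    _ ≤ _ := by gcongr

theorem stmt_9 (n : ℕ) (hn : 2 ≤ n) :
    ∃ c1 c2 : ℝ, 0 < c1 ∧ 0 < c2 ∧ ∀ H : ℤ, 3 ≤ H →
      c1 * (H : ℝ) ^ n ≤ ((IstarSet n H).ncard : ℝ) ∧
      ((IstarSet n H).ncard : ℝ) ≤ c2 * (H : ℝ) ^ n * (Real.log H) ^ (2 * n ^ 2 - n - 1) := by
  obtain ⟨c1, hc1, hlow⟩ := exists_le_ncard_balancedSet hn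
  obtain ⟨c2, hc2, hup⟩ := exists_ncard_IstarSet_le hn
  refine ⟨c1, c2, hc1, hc2, fun H hH => ?_⟩
  lift H to ℕ using by omega
  have hH' : 3 ≤ H := by exact_mod_cast hH
  simp only [Int.cast_natCast]
  refine ⟨(hlow H hH').trans ?_, hup H hH'⟩
  exact_mod_cast Set.ncard_le_ncard (balancedSet_subset_IstarSet hn H) (finite_IstarSet n H)
end
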